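/- Every commutative noetherian local ring R has only finitely many semidualizing modules up to isomorphism; that is, the set 𝔖₀(R) of isomorphism classes of semidualizing R-modules is finite. -/

import Mathlib

/-!
STATEMENT 3: Every commutative noetherian local ring has only finitely many
semidualizing modules up to isomorphism.
-/

open CategoryTheory

/-- `Ext^i_R(M, N)` for `R`-modules `M`, `N`. -/
noncomputable def extMod (R : Type) [CommRing R] (M N : ModuleCat R) (i : ℕ) : ModuleCat R :=
  ((Ext R (ModuleCat R) i).obj (Opposite.op M)).obj N

/-- A finitely generated `R`-module `C` is semidualizing if the homothety map
`R → Hom_R(C, C)`, `r ↦ (c ↦ r • c)`, is bijective and `Ext^i_R(C, C) = 0` for all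
`i ≥ 1`. -/
def IsSemidualizing (R : Type) [CommRing R] (C : Type) [AddCommGroup C] [Module R C] :
    Prop :=
  Module.Finite R C ∧
    Function.Bijective (LinearMap.lsmul R C) ∧
    ∀ i : ℕ, 1 ≤ i → Subsingleton (extMod R (ModuleCat.of R C) (ModuleCat.of R C) i)

/-- A local ring whose maximal ideal is generated by a nilpotent element `π`
with `π ^ t ≠ 0` and `π ^ (t + 1) = 0`. -/
structure IsChainRing (B : Type*) [CommRing B] (π : B) (t : ℕ) : Prop where
  isUnit_or_dvd : ∀ x : B, IsUnit x ∨ π ∣ x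
  pow_ne_zero : π ^ t ≠ 0
  pow_succ_eq_zero : π ^ (t + 1) = 0

namespace IsChainRing

variable {B : Type*} [CommRing B] {π : B} {t : ℕ} (hB : IsChainRing B π t)
include hB

lemma pow_eq_zero_of_lt {a : ℕ} (ha : t < a) : π ^ a = 0 := by
  obtain ⟨k, rfl⟩ := Nat.exists_eq_add_of_lt ha
  rw [show t + k + 1 = (t + 1) + k by ring, pow_add, hB.pow_succ_eq_zero, zero_mul]

lemma not_isUnit : ¬ IsUnit π := fun h => by
  have := h.pow (t + 1)
  rw [hB.pow_succ_eq_zero, isUnit_zero_iff] at this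
  exact hB.pow_ne_zero (by rw [← mul_one (π ^ t), ← this, mul_zero])

lemma exists_eq_mul_pow (x : B) : ∃ i ≤ t + 1, ∃ u : B, IsUnit u ∧ x = u * π ^ i := by
  by_contra! hx
  have key : ∀ i ≤ t + 1, π ^ i ∣ x := by
    intro i hi
    induction i with
    | zero => simp
    | succ i ih =>
      obtain ⟨y, hy⟩ := ih (by omega)
      rcases hB.isUnit_or_dvd y with h | ⟨z, rfl⟩
      · exact absurd (by rw [hy, mul_comm]) (hx i (by omega) y h)
      · exact ⟨z, by rw [hy]; ring⟩
  obtain ⟨y, hy⟩ := key (t + 1) le_rfl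
  rw [hB.pow_succ_eq_zero, zero_mul] at hy
  exact hx (t + 1) le_rfl 1 isUnit_one (by rw [hy, hB.pow_succ_eq_zero, mul_zero])

lemma le_of_pow_dvd_pow {a b : ℕ} (hb : b ≤ t) (h : π ^ a ∣ π ^ b) : a ≤ b := by
  by_contra! hab
  have : π ^ t = 0 := by
    obtain ⟨y, hy⟩ := h
    have : π ^ t = π ^ (t - b) * π ^ b := by rw [← pow_add]; congr 1; omega
    rw [this, hy, ← mul_assoc, ← pow_add, hB.pow_eq_zero_of_lt (by omega), zero_mul]
  exact hB.pow_ne_zero this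

lemma dvd_pow_iff {l : ℕ} (hl : l ≤ t) (y : B) : y ∣ π ^ l ↔ π ^ (t - l) * y ≠ 0 := by
  constructor
  · rintro ⟨z, hz⟩ h0
    apply hB.pow_ne_zero
    have : π ^ t = π ^ (t - l) * π ^ l := by rw [← pow_add]; congr 1; omega
    rw [this, hz, ← mul_assoc, h0, zero_mul]
  · intro h
    obtain ⟨i, -, u, hu, rfl⟩ := hB.exists_eq_mul_pow y
    have : i ≤ l := by
      by_contra! hi
      apply h
      rw [mul_left_comm, ← pow_add, hB.pow_eq_zero_of_lt (by omega), mul_zero]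
    exact (hu.mul_left_dvd).2 (pow_dvd_pow _ this)

lemma exists_ideal_eq (J : Ideal B) : ∃ a ≤ t + 1, J = Ideal.span {π ^ a} := by
  classical
  have h : ∃ a, π ^ a ∈ J := ⟨t + 1, by simp [hB.pow_succ_eq_zero]⟩
  refine ⟨Nat.find h, Nat.find_min' h (by simp [hB.pow_succ_eq_zero]), le_antisymm ?_ ?_⟩
  · intro x hx
    obtain ⟨i, -, u, hu, rfl⟩ := hB.exists_eq_mul_pow x
    have : π ^ i ∈ J := by
      obtain ⟨v, hv⟩ := hu.exists_left_inv
      have := J.mul_mem_left v hx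
      rwa [← mul_assoc, hv, one_mul] at this
    exact Ideal.mul_mem_left _ _
      (Ideal.mem_span_singleton.2 (pow_dvd_pow _ (Nat.find_min' h this)))
  · rw [Ideal.span_singleton_le_iff_mem]; exact Nat.find_spec h

lemma isNoetherianRing : IsNoetherianRing B := by
  rw [isNoetherianRing_iff_ideal_fg]
  intro J
  obtain ⟨a, -, rfl⟩ := hB.exists_ideal_eq J
  exact ⟨{π ^ a}, by simp⟩

lemma isMaximal_span : (Ideal.span {π}).IsMaximal := by
  rw [Ideal.isMaximal_def]
  refine ⟨fun h => hB.not_isUnit (Ideal.span_singleton_eq_top.1 h), fun J hJ => ?_⟩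
  obtain ⟨x, hxJ, hx⟩ := SetLike.exists_of_lt hJ
  rcases hB.isUnit_or_dvd x with h | h
  · exact J.eq_top_of_isUnit_mem hxJ h
  · exact absurd (Ideal.mem_span_singleton.2 h) hx

lemma length_quotient_span (a : ℕ) (ha : a ≤ t + 1) :
    Module.length B (B ⧸ Ideal.span {π ^ a}) = a := by
  induction a with
  | zero =>
    have : Subsingleton (B ⧸ Ideal.span {π ^ 0}) := by
      rw [Ideal.Quotient.subsingleton_iff]; simp
    simp only [Nat.cast_zero]
    exact Module.length_eq_zero_iff.2 this
  | succ a ih =>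
    have hle : Ideal.span {π ^ (a + 1)} ≤ Ideal.span {π ^ a} :=
      Ideal.span_singleton_le_span_singleton.2 (pow_dvd_pow _ (by omega))
    have hker : ∀ x, π ∣ x ↔ π ^ (a + 1) ∣ π ^ a * x := by
      intro x
      constructor
      · rintro ⟨y, rfl⟩; exact ⟨y, by ring⟩
      · intro h
        rcases hB.isUnit_or_dvd x with hx | hx
        · have := hB.le_of_pow_dvd_pow (by omega) ((hx.dvd_mul_right).1 h)
          omega
        · exact hx
    let f : (B ⧸ Ideal.span {π}) →ₗ[B] (B ⧸ Ideal.span {π ^ (a + 1)}) :=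
      Submodule.mapQ _ _ (LinearMap.lsmul B B (π ^ a)) (by
        intro x hx
        simp only [Submodule.mem_comap, LinearMap.lsmul_apply, smul_eq_mul]
        exact Ideal.mem_span_singleton.2 ((hker x).1 (Ideal.mem_span_singleton.1 hx)))
    let g : (B ⧸ Ideal.span {π ^ (a + 1)}) →ₗ[B] (B ⧸ Ideal.span {π ^ a}) :=
      Submodule.factor hle
    have hf : Function.Injective f := by
      rw [injective_iff_map_eq_zero]
      intro x
      obtain ⟨x, rfl⟩ := Submodule.mkQ_surjective _ x
      intro h
      have h' : π ^ a * x ∈ Ideal.span {π ^ (a + 1)} := (Submodule.Quotient.mk_eq_zero _).1 h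
      exact (Submodule.Quotient.mk_eq_zero _).2
        (Ideal.mem_span_singleton.2 ((hker x).2 (Ideal.mem_span_singleton.1 h')))
    have hg : Function.Surjective g := Submodule.factor_surjective hle
    have hfg : Function.Exact f g := by
      intro y
      obtain ⟨y, rfl⟩ := Submodule.mkQ_surjective _ y
      constructor
      · intro h
        have h' : y ∈ Ideal.span {π ^ a} := (Submodule.Quotient.mk_eq_zero _).1 h
        obtain ⟨z, rfl⟩ := Ideal.mem_span_singleton.1 h'
        exact ⟨Submodule.Quotient.mk z, rfl⟩
      · rintro ⟨z, hz⟩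
        obtain ⟨z, rfl⟩ := Submodule.mkQ_surjective _ z
        rw [← hz]
        exact (Submodule.Quotient.mk_eq_zero _).2 (Ideal.mem_span_singleton.2 (dvd_mul_right _ _))
    have := hB.isMaximal_span
    have hs : IsSimpleModule B (B ⧸ Ideal.span {π}) := by
      rw [isSimpleModule_iff_isCoatom]; exact Ideal.isMaximal_def.1 this
    rw [Module.length_eq_add_of_exact f g hf hg hfg, ih (by omega), Module.length_eq_one, add_comm]
    simp

end IsChainRing

namespace IsChainRing

variable {B : Type*} [CommRing B] {π : B} {t : ℕ} (hB : IsChainRing B π t)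
include hB

/-- Every submodule of a free module of finite rank over a chain ring is the column space of a
square matrix whose determinant records the colength. -/
lemma exists_hermite (g : ℕ) (M : Submodule B (Fin g → B)) :
    ∃ (H : Matrix (Fin g) (Fin g) B) (n : ℕ), LinearMap.range H.mulVecLin = M ∧
      H.det = π ^ n ∧ Module.length B ((Fin g → B) ⧸ M) = n := by
  induction g with
  | zero =>
    refine ⟨1, 0, Subsingleton.elim _ _, by simp, ?_⟩
    have : Subsingleton ((Fin 0 → B) ⧸ M) := by
      rw [Submodule.Quotient.subsingleton_iff]; exact Subsingleton.elim _ _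
    simp
  | succ g ih =>
    let p : (Fin (g + 1) → B) →ₗ[B] B := LinearMap.proj 0
    let ι : (Fin g → B) →ₗ[B] (Fin (g + 1) → B) :=
      { toFun := fun v => Fin.cons 0 v
        map_add' := fun v w => by
          ext i; refine Fin.cases ?_ (fun i => ?_) i <;> simp
        map_smul' := fun c v => by
          ext i; refine Fin.cases ?_ (fun i => ?_) i <;> simp }
    have hι : ∀ v, ι v = Fin.cons 0 v := fun v => rfl
    obtain ⟨a, ha, hJ⟩ := hB.exists_ideal_eq (M.map p)
    obtain ⟨m, hmM, hm0⟩ : ∃ m ∈ M, m 0 = π ^ a := by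
      have : π ^ a ∈ M.map p := by rw [hJ]; exact Ideal.mem_span_singleton_self _
      exact this
    obtain ⟨H, n, hH, hdet, hlen⟩ := ih (M.comap ι)
    let H' : Matrix (Fin (g + 1)) (Fin (g + 1)) B :=
      Matrix.of (Fin.cons (Fin.cons (π ^ a) 0) (fun i => Fin.cons (m i.succ) (H i)))
    have hH' : ∀ v : Fin (g + 1) → B, H'.mulVecLin v = v 0 • m + ι (H.mulVecLin (Fin.tail v)) := by
      intro v
      ext i
      refine Fin.cases ?_ (fun i => ?_) i
      · simp [H', Matrix.mulVec, dotProduct, Fin.sum_univ_succ, hι, hm0, mul_comm]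
      · simp [H', Matrix.mulVec, dotProduct, Fin.sum_univ_succ, hι, mul_comm, Fin.tail]
    have hιM : ∀ w, ι (H.mulVecLin w) ∈ M := fun w => by
      have : H.mulVecLin w ∈ M.comap ι := hH ▸ LinearMap.mem_range_self _ w
      exact this
    refine ⟨H', a + n, le_antisymm ?_ ?_, ?_, ?_⟩
    · rintro _ ⟨v, rfl⟩
      rw [hH']
      exact M.add_mem (M.smul_mem _ hmM) (hιM _)
    · intro x hx
      have : x 0 ∈ M.map p := ⟨x, hx, rfl⟩
      rw [hJ] at this
      obtain ⟨c, hc⟩ := Ideal.mem_span_singleton.1 this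
      have hx' : x - c • m ∈ M := M.sub_mem hx (M.smul_mem _ hmM)
      have hx0 : ι (Fin.tail (x - c • m)) = x - c • m := by
        ext i
        refine Fin.cases ?_ (fun i => ?_) i
        · simp [hι, hm0, hc, mul_comm]
        · simp [hι, Fin.tail]
      have : Fin.tail (x - c • m) ∈ M.comap ι := by
        rw [Submodule.mem_comap, hx0]; exact hx'
      rw [← hH] at this
      obtain ⟨w, hw⟩ := this
      refine ⟨Fin.cons c w, ?_⟩
      rw [hH', Fin.tail_cons, hw, hx0]
      simp
    · rw [Matrix.det_succ_row_zero, Fin.sum_univ_succ, Finset.sum_eq_zero]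
      · have : H'.submatrix Fin.succ (Fin.succAbove 0) = H := by
          ext i j; simp [H']
        rw [this, hdet]
        simp [H', pow_add]
      · intro i _
        simp [H']
    · have hle : M ≤ (M.map p).comap p := Submodule.le_comap_map _ _
      let f : ((Fin g → B) ⧸ M.comap ι) →ₗ[B] ((Fin (g + 1) → B) ⧸ M) :=
        Submodule.mapQ _ _ ι le_rfl
      let q : ((Fin (g + 1) → B) ⧸ M) →ₗ[B] (B ⧸ M.map p) := Submodule.mapQ _ _ p hle
      have hf : Function.Injective f := by
        rw [injective_iff_map_eq_zero]
        intro x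
        obtain ⟨x, rfl⟩ := Submodule.mkQ_surjective _ x
        intro h
        exact (Submodule.Quotient.mk_eq_zero _).2 ((Submodule.Quotient.mk_eq_zero M).1 h)
      have hq : Function.Surjective q := by
        intro y
        obtain ⟨y, rfl⟩ := Submodule.mkQ_surjective _ y
        exact ⟨Submodule.Quotient.mk (fun _ => y), rfl⟩
      have hfq : Function.Exact f q := by
        intro y
        obtain ⟨y, rfl⟩ := Submodule.mkQ_surjective _ y
        constructor
        · intro h
          obtain ⟨z, hz, hzy⟩ : y 0 ∈ M.map p := (Submodule.Quotient.mk_eq_zero _).1 h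
          refine ⟨Submodule.Quotient.mk (Fin.tail (y - z)), ?_⟩
          have : ι (Fin.tail (y - z)) = y - z := by
            ext i
            refine Fin.cases ?_ (fun i => ?_) i
            · have : z 0 = y 0 := hzy
              simp [hι, this]
            · simp [hι, Fin.tail]
          change Submodule.Quotient.mk (ι (Fin.tail (y - z))) = _
          rw [this]
          refine (Submodule.Quotient.eq _).2 ?_
          simpa using hz
        · rintro ⟨z, hz⟩
          obtain ⟨z, rfl⟩ := Submodule.mkQ_surjective _ z
          rw [← hz]
          refine (Submodule.Quotient.mk_eq_zero _).2 ?_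
          have : p (ι z) = 0 := by simp [p, hι]
          rw [this]; exact zero_mem _
      rw [Module.length_eq_add_of_exact f q hf hq hfq, hlen, hJ, hB.length_quotient_span a ha]
      push_cast; rw [add_comm]

lemma exists_length_quotient_range {g : ℕ} (Ψ : Matrix (Fin g) (Fin g) B) :
    ∃ n : ℕ, Module.length B ((Fin g → B) ⧸ LinearMap.range Ψ.mulVecLin) = n ∧
      π ^ n ∣ Ψ.det := by
  obtain ⟨H, n, hH, hdet, hlen⟩ := hB.exists_hermite g (LinearMap.range Ψ.mulVecLin)
  have h1 : ∀ j, ∃ w, H.mulVecLin w = Ψ.mulVecLin (Pi.single j 1) := fun j => by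
    have : Ψ.mulVecLin (Pi.single j 1) ∈ LinearMap.range H.mulVecLin := by
      rw [hH]; exact LinearMap.mem_range_self _ _
    exact this
  choose w hw using h1
  have h2 : Ψ = H * (Matrix.of fun i j => w j i) := by
    ext i j
    have := congr_fun (hw j) i
    simp only [Matrix.mulVecLin_apply, Matrix.mulVec_single_one, Matrix.col_apply] at this
    rw [← this]; rfl
  refine ⟨n, hlen, ?_⟩
  rw [← hdet]
  conv_rhs => rw [h2, Matrix.det_mul]
  exact dvd_mul_right _ _

lemma length_quotient_range_le {g l : ℕ} (Ψ : Matrix (Fin g) (Fin g) B) (hl : l ≤ t)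
    (h : Ψ.det ∣ π ^ l) : Module.length B ((Fin g → B) ⧸ LinearMap.range Ψ.mulVecLin) ≤ l := by
  obtain ⟨n, hlen, hn⟩ := hB.exists_length_quotient_range Ψ
  rw [hlen]
  exact_mod_cast hB.le_of_pow_dvd_pow hl (hn.trans h)

end IsChainRing

lemma Module.injective_of_length_le {B M P : Type*} [Ring B] [AddCommGroup M] [Module B M]
    [AddCommGroup P] [Module B P] (f : M →ₗ[B] P) (hf : Function.Surjective f)
    (h : Module.length B M ≤ Module.length B P) (hP : Module.length B P ≠ ⊤) :
    Function.Injective f := by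
  have := Module.length_eq_add_of_exact (LinearMap.ker f).subtype f
    (Submodule.subtype_injective _) hf (LinearMap.exact_subtype_ker_map f)
  rw [this] at h
  have h0 : Module.length B (LinearMap.ker f) = 0 := by
    by_contra hne
    have h1 : (1 : ℕ∞) ≤ Module.length B (LinearMap.ker f) := Order.one_le_iff_pos.2
      (pos_iff_ne_zero.2 hne)
    have h2 : 1 + Module.length B P ≤ Module.length B P := le_trans (by gcongr) h
    obtain ⟨k, hk⟩ := ENat.ne_top_iff_exists.1 hP
    rw [← hk] at h2
    have : 1 + k ≤ k := by exact_mod_cast h2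
    omega
  rw [Module.length_eq_zero_iff] at h0
  rw [← LinearMap.ker_eq_bot]
  exact Submodule.subsingleton_iff_eq_bot.1 h0

lemma Module.length_range_add {B M P : Type*} [Ring B] [AddCommGroup M] [Module B M]
    [AddCommGroup P] [Module B P] (f : M →ₗ[B] P) :
    Module.length B P = Module.length B (LinearMap.range f) +
      Module.length B (P ⧸ LinearMap.range f) :=
  Module.length_eq_add_of_exact (LinearMap.range f).subtype (LinearMap.range f).mkQ
    (Submodule.subtype_injective _) (Submodule.mkQ_surjective _)
    (LinearMap.exact_subtype_mkQ _)

/-- For a complex, exactness in the middle can be read off from lengths of cokernels. -/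
lemma exact_of_length_le {B G₀ G₁ G₂ : Type*} [CommRing B] [AddCommGroup G₀] [Module B G₀]
    [AddCommGroup G₁] [Module B G₁] [AddCommGroup G₂] [Module B G₂]
    (f : G₀ →ₗ[B] G₁) (g : G₁ →ₗ[B] G₂) (hgf : g ∘ₗ f = 0) {l₀ l₁ : ℕ}
    (h₀ : Module.length B (G₁ ⧸ LinearMap.range f) ≤ l₀)
    (h₁ : Module.length B (G₂ ⧸ LinearMap.range g) ≤ l₁)
    (h : Module.length B G₂ = l₀ + l₁) :
    LinearMap.ker g ≤ LinearMap.range f ∧ Module.length B (G₁ ⧸ LinearMap.range f) = l₀ := by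
  let q : (G₁ ⧸ LinearMap.range f) →ₗ[B] LinearMap.range g :=
    (LinearMap.range f).liftQ g.rangeRestrict (by
      rintro _ ⟨x, rfl⟩
      rw [LinearMap.mem_ker]
      exact Subtype.ext (LinearMap.congr_fun hgf x))
  have hq : Function.Surjective q := by
    rintro ⟨_, x, rfl⟩
    exact ⟨Submodule.Quotient.mk x, rfl⟩
  have h2 := Module.length_range_add g
  have h3 := Module.length_le_of_surjective q hq
  obtain ⟨a, ha⟩ := ENat.ne_top_iff_exists.1 (ne_top_of_le_ne_top (ENat.natCast_ne_top l₀) h₀)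
  obtain ⟨c, hc⟩ := ENat.ne_top_iff_exists.1 (ne_top_of_le_ne_top (ENat.natCast_ne_top l₁) h₁)
  obtain ⟨b, hb⟩ := ENat.ne_top_iff_exists.1
    (ne_top_of_le_ne_top (ENat.natCast_ne_top l₀) (h3.trans h₀))
  have h4 := h2
  rw [h, ← hb, ← hc] at h4
  rw [← ha] at h₀ h3
  rw [← hc] at h₁
  rw [← hb] at h3
  norm_cast at h₀ h₁ h3 h4
  have hab : a = b := by omega
  have ha' : a = l₀ := by omega
  refine ⟨?_, by rw [← ha, ha']⟩
  have hinj := Module.injective_of_length_le q hq (by rw [← ha, ← hb, hab])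
    (by rw [← hb]; exact ENat.natCast_ne_top _)
  intro x hx
  have : q (Submodule.Quotient.mk x) = 0 := Subtype.ext hx
  exact (Submodule.Quotient.mk_eq_zero _).1 (hinj (this.trans (map_zero q).symm))

lemma length_quotient_add_of_exact {B G₀ G₁ G₂ : Type*} [CommRing B] [AddCommGroup G₀]
    [Module B G₀] [AddCommGroup G₁] [Module B G₁] [AddCommGroup G₂] [Module B G₂]
    (f : G₀ →ₗ[B] G₁) (g : G₁ →ₗ[B] G₂) (hgf : LinearMap.ker g = LinearMap.range f) :
    Module.length B G₂ = Module.length B (G₁ ⧸ LinearMap.range f) +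
      Module.length B (G₂ ⧸ LinearMap.range g) := by
  rw [Module.length_range_add g, ← hgf, (g.quotKerEquivRange).length_eq]

namespace MvPolynomial

variable {B : Type*} [CommRing B] {σ : Type*} [Fintype σ]

lemma exists_lift_affine {G : Type*} [AddCommGroup G] [Module B G] {g : ℕ}
    (p : (Fin g → B) →ₗ[B] G) (hp : Function.Surjective p) (c₀ : σ → B) (L : (σ → B) →ₗ[B] G) :
    ∃ y : Fin g → MvPolynomial σ B, (∀ c, p (fun i => eval c (y i)) = L (c - c₀)) ∧
      ∀ i, eval c₀ (y i) = 0 := by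
  classical
  choose ly hly using fun μ => hp (L (Pi.single μ 1))
  refine ⟨fun i => ∑ μ, (X μ - C (c₀ μ)) * C (ly μ i), fun c => ?_, fun i => by simp⟩
  have h1 : (fun i => eval c (∑ μ, (X μ - C (c₀ μ)) * C (ly μ i))) =
      ∑ μ, (c - c₀) μ • ly μ := by
    ext i; simp
  rw [h1, map_sum]
  conv_rhs => rw [pi_eq_sum_univ' (c - c₀)]
  rw [map_sum]
  refine Finset.sum_congr rfl fun μ _ => ?_
  rw [map_smul, map_smul, hly]

/-- A polynomial family of square matrices covering the images of an affine family of maps. -/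
lemma exists_matrix_lift {G G' : Type*} [AddCommGroup G] [Module B G] [AddCommGroup G']
    [Module B G'] {π : B} {t : ℕ} (hB : IsChainRing B π t) {g g' : ℕ}
    (p : (Fin g → B) →ₗ[B] G) (hp : Function.Surjective p)
    (p' : (Fin g' → B) →ₗ[B] G') (hp' : Function.Surjective p')
    (c₀ : σ → B) (D : (σ → B) → G →ₗ[B] G') (L : (σ → B) →ₗ[B] G →ₗ[B] G')
    (hD : ∀ c, D c = D c₀ + L (c - c₀)) {l : ℕ}
    (hl : Module.length B (G' ⧸ LinearMap.range (D c₀)) = l) :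
    ∃ (Ψ : Matrix (Fin g') (Fin g') (MvPolynomial σ B)) (Q : (Fin g' → B) →ₗ[B] (Fin g → B)),
      eval c₀ Ψ.det = π ^ l ∧
      ∀ c w, p' ((Ψ.map (eval c)).mulVecLin w) = D c (p (Q w)) := by
  classical
  let S := (LinearMap.range (D c₀)).comap p'
  obtain ⟨H, n, hH, hdet, hlen⟩ := hB.exists_hermite g' S
  have hn : n = l := by
    let e : ((Fin g' → B) ⧸ S) →ₗ[B] (G' ⧸ LinearMap.range (D c₀)) := Submodule.mapQ _ _ p' le_rfl
    have he : Function.Bijective e := by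
      constructor
      · rw [injective_iff_map_eq_zero]
        intro x
        obtain ⟨x, rfl⟩ := Submodule.mkQ_surjective _ x
        intro h
        exact (Submodule.Quotient.mk_eq_zero _).2
          ((Submodule.Quotient.mk_eq_zero (LinearMap.range (D c₀))).1 h)
      · intro y
        obtain ⟨y, rfl⟩ := Submodule.mkQ_surjective _ y
        obtain ⟨x, rfl⟩ := hp' y
        exact ⟨Submodule.Quotient.mk x, rfl⟩
    have := (LinearEquiv.ofBijective e he).length_eq
    rw [hlen, hl] at this
    exact_mod_cast this
  subst hn
  have hcol : ∀ q, ∃ x : Fin g → B, p' (H.mulVecLin (Pi.single q 1)) = D c₀ (p x) := by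
    intro q
    have : H.mulVecLin (Pi.single q 1) ∈ S := by rw [← hH]; exact LinearMap.mem_range_self _ _
    obtain ⟨x, hx⟩ := this
    obtain ⟨x, rfl⟩ := hp x
    exact ⟨x, hx.symm⟩
  choose x hx using hcol
  choose y hy hy0 using fun q => exists_lift_affine p' hp' c₀ (L.flip (p (x q)))
  refine ⟨Matrix.of fun i j => C (H i j) + y j i, Fintype.linearCombination B x, ?_, ?_⟩
  · rw [RingHom.map_det, ← hdet]
    congr 1
    ext i j
    simp [hy0]
  · intro c w
    have key : (p' ∘ₗ ((Matrix.of fun i j => C (H i j) + y j i :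
        Matrix (Fin g') (Fin g') (MvPolynomial σ B)).map (eval c)).mulVecLin) =
        (D c ∘ₗ p ∘ₗ Fintype.linearCombination B x) := by
      refine LinearMap.pi_ext' fun q => LinearMap.ext_ring ?_
      simp only [LinearMap.comp_apply, LinearMap.single_apply,
        Fintype.linearCombination_apply_single, one_smul]
      have hy' : L (c - c₀) (p (x q)) = p' fun i => eval c (y q i) := (hy q c).symm
      rw [hD c, LinearMap.add_apply, ← hx, hy', ← map_add]
      refine congrArg p' ?_
      funext i
      simp
    exact LinearMap.congr_fun key w

end MvPolynomial

namespace MvPolynomial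

variable {B : Type*} [CommRing B] {σ : Type*} [Fintype σ]

/-- Exactness and the existence of a cocycle with invertible reduction are open conditions on the
parameter of an affine family of complexes over a chain ring. -/
lemma exists_open_condition {π : B} {t : ℕ} (hB : IsChainRing B π t)
    {K : Type*} [Field K] (res : B →+* K) (hres : Function.Surjective res)
    {G₀ G₁ G₂ : Type*} [AddCommGroup G₀] [Module B G₀] [AddCommGroup G₁] [Module B G₁]
    [AddCommGroup G₂] [Module B G₂] [Module.Finite B G₀] [Module.Finite B G₁] [Module.Finite B G₂]
    (c₀ : σ → B)
    (D₀ : (σ → B) → G₀ →ₗ[B] G₁) (L₀ : (σ → B) →ₗ[B] G₀ →ₗ[B] G₁)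
    (hD₀ : ∀ c, D₀ c = D₀ c₀ + L₀ (c - c₀))
    (D₁ : (σ → B) → G₁ →ₗ[B] G₂) (L₁ : (σ → B) →ₗ[B] G₁ →ₗ[B] G₂)
    (hD₁ : ∀ c, D₁ c = D₁ c₀ + L₁ (c - c₀))
    (hexact : LinearMap.ker (D₁ c₀) = LinearMap.range (D₀ c₀))
    {b : ℕ} (ρ : G₀ → Matrix (Fin b) (Fin b) K) (hρadd : ∀ x y, ρ (x + y) = ρ x + ρ y)
    (hρsmul : ∀ a x, ρ (a • x) = res a • ρ x)
    (z₀ : G₀) (hz₀ : D₀ c₀ z₀ = 0) (hρz₀ : (ρ z₀).det ≠ 0)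
    {l : ℕ} (hl₁ : Module.length B G₁ ≤ l) (hl₂ : Module.length B G₂ ≤ l) (hlt : l ≤ t)
    (hblt : l * b ≤ t) :
    ∃ f : Fin 3 → MvPolynomial σ B, (∀ k, eval c₀ (f k) ≠ 0) ∧
      ∀ c, (∀ k, eval c (f k) ≠ 0) → D₁ c ∘ₗ D₀ c = 0 →
        LinearMap.ker (D₁ c) ≤ LinearMap.range (D₀ c) ∧ ∃ z, D₀ c z = 0 ∧ (ρ z).det ≠ 0 := by
  classical
  have hresπ : res π = 0 := by
    have h : res π ^ (t + 1) = 0 := by rw [← map_pow, hB.pow_succ_eq_zero, map_zero]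
    exact pow_eq_zero_iff (by omega) |>.1 h
  have hunit : ∀ x, res x ≠ 0 → IsUnit x := fun x hx => (hB.isUnit_or_dvd x).resolve_right
    (by rintro ⟨y, rfl⟩; exact hx (by rw [map_mul, hresπ, zero_mul]))
  obtain ⟨g₀, p₀, hp₀⟩ := Module.Finite.exists_fin' B G₀
  obtain ⟨g₁, p₁, hp₁⟩ := Module.Finite.exists_fin' B G₁
  obtain ⟨g₂, p₂, hp₂⟩ := Module.Finite.exists_fin' B G₂
  obtain ⟨l₀, hl₀⟩ := ENat.ne_top_iff_exists.1 (ne_top_of_le_ne_top (ENat.natCast_ne_top l)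
    ((Module.length_le_of_surjective _ (Submodule.mkQ_surjective (LinearMap.range (D₀ c₀)))).trans
      hl₁))
  obtain ⟨l₁, hl₁'⟩ := ENat.ne_top_iff_exists.1 (ne_top_of_le_ne_top (ENat.natCast_ne_top l)
    ((Module.length_le_of_surjective _ (Submodule.mkQ_surjective (LinearMap.range (D₁ c₀)))).trans
      hl₂))
  have hl₀l : l₀ ≤ l := by
    have := (Module.length_le_of_surjective _
      (Submodule.mkQ_surjective (LinearMap.range (D₀ c₀)))).trans hl₁
    rw [← hl₀] at this
    exact_mod_cast this
  have hl₁l : l₁ ≤ l := by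
    have := (Module.length_le_of_surjective _
      (Submodule.mkQ_surjective (LinearMap.range (D₁ c₀)))).trans hl₂
    rw [← hl₁'] at this
    exact_mod_cast this
  have hl₀b : l₀ * b ≤ t := (Nat.mul_le_mul_right b hl₀l).trans hblt
  have hsum : Module.length B G₂ = l₀ + l₁ := by
    rw [length_quotient_add_of_exact _ _ hexact, hl₀, hl₁']
  obtain ⟨Ψ₀, Q₀, hdet₀, hΨ₀⟩ := exists_matrix_lift hB p₀ hp₀ p₁ hp₁ c₀ D₀ L₀ hD₀ hl₀.symm
  obtain ⟨Ψ₁, Q₁, hdet₁, hΨ₁⟩ := exists_matrix_lift hB p₁ hp₁ p₂ hp₂ c₀ D₁ L₁ hD₁ hl₁'.symm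
  obtain ⟨y, hy, hy0⟩ := exists_lift_affine p₁ hp₁ c₀ (L₀.flip z₀)
  have hy' : ∀ c, p₁ (fun i => eval c (y i)) = D₀ c z₀ := fun c => by
    rw [hy, hD₀ c, LinearMap.add_apply, hz₀, zero_add]; rfl
  obtain ⟨zt, hzt⟩ := hp₀ z₀
  choose P hP using fun i j k => hres (ρ (p₀ (Pi.single i 1)) j k)
  -- the lift of `ρ` to matrices over the chain ring
  let ρt : (Fin g₀ → B) → Matrix (Fin b) (Fin b) B := fun v => ∑ i, v i • Matrix.of (P i)
  have hρ0 : ρ 0 = 0 := by simpa using hρadd 0 0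
  have hρt : ∀ v, (ρt v).map res = ρ (p₀ v) := by
    intro v
    let ρh : G₀ →+ Matrix (Fin b) (Fin b) K := ⟨⟨ρ, hρ0⟩, hρadd⟩
    have h1 : ρ (p₀ v) = ∑ i, res (v i) • ρ (p₀ (Pi.single i 1)) := by
      conv_lhs => rw [pi_eq_sum_univ' v]
      rw [map_sum]
      change ρh _ = _
      rw [map_sum]
      refine Finset.sum_congr rfl fun i _ => ?_
      change ρ _ = _
      rw [map_smul, hρsmul]
    rw [h1]
    ext j k
    simp [ρt, Matrix.sum_apply, hP]
  have hρtdet : ∀ v, res (ρt v).det = (ρ (p₀ v)).det := fun v => by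
    rw [RingHom.map_det, ← hρt]; rfl
  -- the linear part of `Q₀`
  let q : Fin g₀ → Fin g₁ → B := fun i j => Q₀ (Pi.single j 1) i
  have hq : ∀ w i, Q₀ w i = ∑ j, w j * q i j := by
    intro w i
    conv_lhs => rw [pi_eq_sum_univ' w]
    simp [q]
  let U : Fin g₀ → MvPolynomial σ B := fun i =>
    Ψ₀.det * C (zt i) - ∑ j, (Ψ₀.adjugate.mulVec y) j * C (q i j)
  let ρU : Matrix (Fin b) (Fin b) (MvPolynomial σ B) := ∑ i, U i • (Matrix.of (P i)).map C
  have hρU : ∀ c, eval c ρU.det = (ρt fun i => eval c (U i)).det := fun c => by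
    rw [RingHom.map_det]
    congr 1
    ext j k
    simp [ρU, ρt, Matrix.sum_apply]
  have hρtsmul : ∀ (a : B) v, (ρt (a • v)).det = a ^ b * (ρt v).det := fun a v => by
    have : ρt (a • v) = a • ρt v := by simp [ρt, Finset.smul_sum, mul_smul]
    rw [this, Matrix.det_smul, Fintype.card_fin]
  refine ⟨![C (π ^ (t - l₀)) * Ψ₀.det, C (π ^ (t - l₁)) * Ψ₁.det,
    C (π ^ (t - l₀ * b)) * ρU.det], ?_, ?_⟩
  · have hU0 : (fun i => eval c₀ (U i)) = π ^ l₀ • zt := by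
      ext i
      simp only [U, map_sub, map_mul, hdet₀, eval_C, map_sum, Pi.smul_apply, smul_eq_mul]
      rw [Finset.sum_eq_zero, sub_zero]
      intro j _
      simp [Matrix.mulVec, dotProduct, hy0]
    intro k
    fin_cases k
    · simp only [Fin.zero_eta, Matrix.cons_val_zero, map_mul, eval_C, hdet₀]
      exact (hB.dvd_pow_iff (hl₀l.trans hlt) _).1 dvd_rfl
    · simp only [Fin.mk_one, Matrix.cons_val_one, Matrix.cons_val_zero, map_mul, eval_C, hdet₁]
      exact (hB.dvd_pow_iff (hl₁l.trans hlt) _).1 dvd_rfl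
    · simp only [Fin.reduceFinMk, Matrix.cons_val, map_mul, eval_C, hρU, hU0, hρtsmul]
      refine (hB.dvd_pow_iff hl₀b _).1 ?_
      have hu : IsUnit (ρt zt).det := hunit _ (by rw [hρtdet, hzt]; exact hρz₀)
      rw [hu.mul_right_dvd, ← pow_mul]
  · intro c hf hcomp
    have hf0 : (Ψ₀.map (eval c)).det ∣ π ^ l₀ := by
      refine (hB.dvd_pow_iff (hl₀l.trans hlt) _).2 ?_
      have := hf 0
      simp only [Matrix.cons_val_zero, map_mul, eval_C, RingHom.map_det] at this
      exact this
    have hf1 : (Ψ₁.map (eval c)).det ∣ π ^ l₁ := by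
      refine (hB.dvd_pow_iff (hl₁l.trans hlt) _).2 ?_
      have := hf 1
      simp only [Matrix.cons_val_one, Matrix.cons_val_zero, map_mul, eval_C,
        RingHom.map_det] at this
      exact this
    have hf2 : (ρt fun i => eval c (U i)).det ∣ π ^ (l₀ * b) := by
      refine (hB.dvd_pow_iff hl₀b _).2 ?_
      have := hf 2
      simp only [Matrix.cons_val, map_mul, eval_C, hρU] at this
      exact this
    -- comparison of cokernels
    have hle₀ : LinearMap.range (Ψ₀.map (eval c)).mulVecLin ≤ (LinearMap.range (D₀ c)).comap p₁ := by
      rintro _ ⟨w, rfl⟩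
      exact ⟨p₀ (Q₀ w), (hΨ₀ c w).symm⟩
    have hle₁ : LinearMap.range (Ψ₁.map (eval c)).mulVecLin ≤ (LinearMap.range (D₁ c)).comap p₂ := by
      rintro _ ⟨w, rfl⟩
      exact ⟨p₁ (Q₁ w), (hΨ₁ c w).symm⟩
    have hs₀ : Function.Surjective (Submodule.mapQ _ _ p₁ hle₀) := by
      intro y
      obtain ⟨y, rfl⟩ := Submodule.mkQ_surjective _ y
      obtain ⟨x, rfl⟩ := hp₁ y
      exact ⟨Submodule.Quotient.mk x, rfl⟩
    have hs₁ : Function.Surjective (Submodule.mapQ _ _ p₂ hle₁) := by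
      intro y
      obtain ⟨y, rfl⟩ := Submodule.mkQ_surjective _ y
      obtain ⟨x, rfl⟩ := hp₂ y
      exact ⟨Submodule.Quotient.mk x, rfl⟩
    have hlen₀ := hB.length_quotient_range_le _ (hl₀l.trans hlt) hf0
    have hlen₁ := hB.length_quotient_range_le _ (hl₁l.trans hlt) hf1
    obtain ⟨hex, hlen⟩ := exact_of_length_le (D₀ c) (D₁ c) hcomp
      ((Module.length_le_of_surjective _ hs₀).trans hlen₀)
      ((Module.length_le_of_surjective _ hs₁).trans hlen₁) hsum
    refine ⟨hex, ?_⟩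
    have hinj := Module.injective_of_length_le _ hs₀ (by rw [hlen]; exact hlen₀)
      (by rw [hlen]; exact ENat.natCast_ne_top _)
    obtain ⟨w, hw⟩ : (fun i => eval c (y i)) ∈ LinearMap.range (Ψ₀.map (eval c)).mulVecLin := by
      refine (Submodule.Quotient.mk_eq_zero _).1 (hinj ?_)
      rw [map_zero]
      refine (Submodule.Quotient.mk_eq_zero (LinearMap.range (D₀ c))).2 ?_
      rw [hy']
      exact LinearMap.mem_range_self _ _
    refine ⟨p₀ (zt - Q₀ w), ?_, ?_⟩
    · rw [map_sub, map_sub, hzt, ← hΨ₀, hw, hy', sub_self]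
    · have hU : (fun i => eval c (U i)) = (Ψ₀.map (eval c)).det • (zt - Q₀ w) := by
        have hadj : ∀ j, eval c (Ψ₀.adjugate.mulVec y j) = (Ψ₀.map (eval c)).det * w j := by
          intro j
          have h1 : eval c (Ψ₀.adjugate.mulVec y j) =
              ((Ψ₀.map (eval c)).adjugate.mulVec fun i => eval c (y i)) j := by
            have := RingHom.map_adjugate (eval c) Ψ₀
            rw [RingHom.mapMatrix_apply, RingHom.mapMatrix_apply] at this
            rw [← this]
            simp [Matrix.mulVec, dotProduct]
          rw [h1, ← hw, Matrix.mulVecLin_apply, Matrix.mulVec_mulVec, Matrix.adjugate_mul,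
            Matrix.smul_mulVec, Matrix.one_mulVec]
          rfl
        ext i
        have hd : eval c Ψ₀.det = (Ψ₀.map (eval c)).det := by rw [RingHom.map_det]; rfl
        simp only [U, map_sub, map_mul, map_sum, eval_C, hadj, Pi.smul_apply, Pi.sub_apply, hq,
          smul_eq_mul, hd, mul_sub, Finset.mul_sum, mul_assoc]
      rw [hU, hρtsmul] at hf2
      intro h0
      rw [← hρtdet] at h0
      have hπ : π ∣ (ρt (zt - Q₀ w)).det :=
        (hB.isUnit_or_dvd _).resolve_left fun h => (h.map res).ne_zero h0
      obtain ⟨n, hn, hn'⟩ := hB.exists_length_quotient_range (Ψ₀.map (eval c))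
      have hl₀n : l₀ ≤ n := by
        have := Module.length_le_of_surjective _ hs₀
        rw [hn, hlen] at this
        exact_mod_cast this
      have hd := (mul_dvd_mul (pow_dvd_pow_of_dvd ((pow_dvd_pow π hl₀n).trans hn') b) hπ).trans hf2
      rw [← pow_mul, ← pow_succ] at hd
      have := hB.le_of_pow_dvd_pow hl₀b hd
      omega

/-- Pigeonhole principle for open conditions in a noetherian affine space. -/
lemma exists_infinite_mutually_generic [IsNoetherianRing B] {X : Type*} {κ : Type*} [Finite κ]
    (S : Set X) (hS : S.Infinite)
    (c : X → σ → B) (f : X → κ → MvPolynomial σ B) (hf : ∀ x k, eval (c x) (f x k) ≠ 0) :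
    ∃ Z ⊆ S, Z.Infinite ∧ ∀ x ∈ Z, {y ∈ Z | ∃ k, eval (c y) (f x k) = 0}.Finite := by
  let zero : Ideal (MvPolynomial σ B) → Set X := fun I => {x ∈ S | ∀ g ∈ I, eval (c x) g = 0}
  have hne : {I : Ideal (MvPolynomial σ B) | (zero I).Infinite}.Nonempty :=
    ⟨⊥, by simpa [zero] using hS⟩
  obtain ⟨I, hI, hmax⟩ := set_has_maximal_iff_noetherian.2
    (inferInstance : IsNoetherian (MvPolynomial σ B) (MvPolynomial σ B)) _ hne
  refine ⟨zero I, fun x hx => hx.1, hI, fun x hx => ?_⟩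
  have : {y ∈ zero I | ∃ k, eval (c y) (f x k) = 0} =
      ⋃ k, {y ∈ zero I | eval (c y) (f x k) = 0} := by
    ext y; simp
  rw [this]
  refine Set.finite_iUnion fun k => ?_
  by_contra hinf
  have hlt : I < I ⊔ Ideal.span {f x k} := by
    refine lt_of_le_of_ne le_sup_left fun h => hf x k (hx.2 _ ?_)
    rw [h]
    exact Ideal.mem_sup_right (Ideal.mem_span_singleton_self _)
  refine hmax _ (Set.Infinite.mono ?_ hinf) hlt
  rintro y ⟨hy, hy0⟩
  refine ⟨hy.1, fun g hg => ?_⟩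
  obtain ⟨a, ha, b, hb, rfl⟩ := Submodule.mem_sup.1 hg
  obtain ⟨d, rfl⟩ := Ideal.mem_span_singleton.1 hb
  rw [map_add, hy.2 a ha, map_mul, hy0]
  simp

end MvPolynomial

/-- The mixed terms in a `p ^ e`-th power of a sum. -/
lemma add_pow_prime_pow_mem {A : Type*} [CommRing A] {p : ℕ} (hp : p.Prime) (G : AddSubgroup A)
    (a e : ℕ) (h : ∀ v < e, ∀ w : A, (p : A) ^ (a + (e - v)) * w ^ p ^ v ∈ G) (y z : A) :
    (p : A) ^ a * ((y + z) ^ p ^ e - y ^ p ^ e - z ^ p ^ e) ∈ G := by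
  have hpos : 0 < p ^ e := pow_pos hp.pos e
  have h1 : (y + z) ^ p ^ e - y ^ p ^ e - z ^ p ^ e =
      ∑ i ∈ Finset.Ico 1 (p ^ e), y ^ i * z ^ (p ^ e - i) * ((p ^ e).choose i : A) := by
    rw [add_pow, Finset.sum_range_succ, Finset.range_eq_Ico, Finset.sum_eq_sum_Ico_succ_bot hpos]
    simp
  rw [h1, Finset.mul_sum]
  refine sum_mem fun i hi => ?_
  rw [Finset.mem_Ico] at hi
  have hi0 : i ≠ 0 := by omega
  have hfac := Nat.factorization_choose_prime_pow_add_factorization hp hi.2.le hi0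
  set v := i.factorization p with hv
  have hpv : p ^ v ∣ i := Nat.ordProj_dvd i p
  have hve : v < e := by
    by_contra! hle
    have := Nat.le_of_dvd (by omega) ((pow_dvd_pow p hle).trans hpv)
    omega
  obtain ⟨i', hi'⟩ := hpv
  obtain ⟨j', hj'⟩ : p ^ v ∣ p ^ e - i := Nat.dvd_sub (pow_dvd_pow p hve.le) ⟨i', hi'⟩
  obtain ⟨c, hc⟩ : p ^ (e - v) ∣ (p ^ e).choose i := by
    have : ((p ^ e).choose i).factorization p = e - v := by omega
    rw [← this]
    exact Nat.ordProj_dvd _ p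
  have h2 : (p : A) ^ a * (y ^ i * z ^ (p ^ e - i) * ((p ^ e).choose i : A)) =
      c • ((p : A) ^ (a + (e - v)) * (y ^ i' * z ^ j') ^ p ^ v) := by
    rw [hj', hc]
    conv_lhs => rw [hi']
    rw [nsmul_eq_mul]
    push_cast
    rw [mul_pow, ← pow_mul, ← pow_mul, pow_add, mul_comm i', mul_comm j']
    ring
  rw [h2]
  exact nsmul_mem (h v hve _) c

lemma Ideal.pow_prime_sub_mem {A : Type*} [CommRing A] {p : ℕ} (n : Ideal A)
    (hpn : (p : A) ∈ n) {i : ℕ} (hi : 1 ≤ i) {a b : A} (hab : a - b ∈ n ^ i) :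
    a ^ p - b ^ p ∈ n ^ (i + 1) := by
  rw [← (Commute.all a b).geom_sum₂_mul, pow_succ']
  refine Ideal.mul_mem_mul ?_ hab
  have hab' : Ideal.Quotient.mk n a = Ideal.Quotient.mk n b :=
    Ideal.Quotient.eq.2 (Ideal.pow_le_self (by omega) hab)
  rw [← Ideal.Quotient.eq_zero_iff_mem, map_sum]
  have : ∀ j ∈ Finset.range p, Ideal.Quotient.mk n (a ^ j * b ^ (p - 1 - j)) =
      Ideal.Quotient.mk n (b ^ (p - 1)) := by
    intro j hj
    rw [map_mul, map_pow, map_pow, hab', ← pow_add, ← map_pow]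
    congr 2
    have := Finset.mem_range.1 hj
    omega
  rw [Finset.sum_congr rfl this, Finset.sum_const, Finset.card_range, ← map_nsmul,
    Ideal.Quotient.eq_zero_iff_mem, nsmul_eq_mul]
  exact n.mul_mem_right _ hpn

lemma Ideal.pow_prime_pow_eq {A : Type*} [CommRing A] {p : ℕ} (n : Ideal A)
    (hpn : (p : A) ∈ n) {m : ℕ} (hm : n ^ (m + 1) = ⊥) {a b : A} (hab : a - b ∈ n) :
    a ^ p ^ m = b ^ p ^ m := by
  have : ∀ i, a ^ p ^ i - b ^ p ^ i ∈ n ^ (i + 1) := by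
    intro i
    induction i with
    | zero => simpa using hab
    | succ i ih =>
      rw [show p ^ (i + 1) = p ^ i * p from pow_succ p i, pow_mul, pow_mul]
      exact Ideal.pow_prime_sub_mem n hpn (by omega) ih
  have h := this m
  rw [hm, Ideal.mem_bot] at h
  exact sub_eq_zero.1 h

section PBasis

variable {k : Type*} [Field k] (p : ℕ) [hp : Fact p.Prime] [CharP k p]

/-- Evaluation of the polynomial `∑ c_β X ^ β` to `∑ c_β ^ (p ^ m) x ^ β`. -/
noncomputable def frobEval (m : ℕ) : MvPolynomial k k →+* k :=
  MvPolynomial.eval₂Hom (iterateFrobenius k p m) id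

/-- The exponents of `P` are supported on `T` and smaller than `p ^ m`. -/
def IsFrobReduced (T : Set k) (m : ℕ) (P : MvPolynomial k k) : Prop :=
  ∀ β ∈ P.support, ∀ i, (β i ≠ 0 → i ∈ T) ∧ β i < p ^ m

/-- The set `T` is independent over the field of `p ^ m`-th powers. -/
def IsPIndep (T : Set k) (m : ℕ) : Prop :=
  ∀ P : MvPolynomial k k, IsFrobReduced p T m P → frobEval p m P = 0 → P = 0

lemma frobEval_monomial (m : ℕ) (β : k →₀ ℕ) (c : k) :
    frobEval p m (MvPolynomial.monomial β c) = c ^ p ^ m * β.prod fun i e => i ^ e := by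
  simp [frobEval, MvPolynomial.eval₂Hom_monomial, iterateFrobenius_def]

/-- Splitting of exponents: independence can be checked on the parts of a polynomial. -/
lemma eq_zero_of_parts {T : Set k} {m : ℕ} (hT : IsPIndep p T m) {ι : Type*} [DecidableEq ι]
    (P : MvPolynomial k k) (f : (k →₀ ℕ) → ι) (g : (k →₀ ℕ) → (k →₀ ℕ))
    (hinj : ∀ β ∈ P.support, ∀ γ ∈ P.support, f β = f γ → g β = g γ → β = γ)
    (hg : ∀ β ∈ P.support, ∀ i, (g β i ≠ 0 → i ∈ T) ∧ g β i < p ^ m)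
    (h0 : ∀ j,
      ∑ β ∈ P.support with f β = j, frobEval p m (MvPolynomial.monomial (g β) (P.coeff β)) = 0) :
    P = 0 := by
  classical
  by_contra hP
  obtain ⟨γ, hγ⟩ := MvPolynomial.support_nonempty.2 hP
  let Q : MvPolynomial k k := ∑ β ∈ P.support with f β = f γ,
    MvPolynomial.monomial (g β) (P.coeff β)
  have hQ : Q = 0 := by
    refine hT Q ?_ ?_
    · intro δ hδ
      have := MvPolynomial.support_sum hδ
      obtain ⟨β, hβ, hδβ⟩ := Finset.mem_biUnion.1 this
      have h2 := MvPolynomial.support_monomial_subset hδβ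
      rw [Finset.mem_singleton] at h2
      rw [h2]
      exact hg β (Finset.mem_filter.1 hβ).1
    · rw [map_sum]
      exact h0 (f γ)
  have hc : MvPolynomial.coeff (g γ) Q = P.coeff γ := by
    rw [MvPolynomial.coeff_sum, Finset.sum_eq_single γ]
    · simp
    · intro β hβ hne
      rw [Finset.mem_filter] at hβ
      rw [MvPolynomial.coeff_monomial, if_neg]
      exact fun h => hne (hinj β hβ.1 γ hγ hβ.2 h)
    · intro h
      exact absurd (Finset.mem_filter.2 ⟨hγ, (rfl : f γ = f γ)⟩) h
  rw [hQ, MvPolynomial.coeff_zero] at hc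
  exact MvPolynomial.mem_support_iff.1 hγ hc.symm

lemma frobEval_eq_sum (m : ℕ) (P : MvPolynomial k k) :
    frobEval p m P = ∑ β ∈ P.support, P.coeff β ^ p ^ m * β.prod fun i e => i ^ e := by
  conv_lhs => rw [P.as_sum]
  rw [map_sum]
  exact Finset.sum_congr rfl fun β _ => frobEval_monomial p m β _

lemma IsPIndep.succ {T : Set k} (h1 : IsPIndep p T 1) {m : ℕ} (hm : IsPIndep p T m) :
    IsPIndep p T (m + 1) := by
  classical
  intro P hP hP0
  have hp0 : 0 < p := hp.out.pos
  let r : (k →₀ ℕ) → (k →₀ ℕ) := fun β => β.mapRange (· % p) (Nat.zero_mod p)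
  let d : (k →₀ ℕ) → (k →₀ ℕ) := fun β => β.mapRange (· / p) (Nat.zero_div p)
  have hrd : ∀ β, r β + p • d β = β := by
    intro β; ext i
    simp only [r, d, Finsupp.add_apply, Finsupp.mapRange_apply, Finsupp.smul_apply, smul_eq_mul]
    exact Nat.mod_add_div _ _
  let Q : MvPolynomial k k := ∑ β ∈ P.support,
    MvPolynomial.monomial (r β) (frobEval p m (MvPolynomial.monomial (d β) (P.coeff β)))
  have hQ : Q = 0 := by
    refine h1 Q ?_ ?_
    · intro δ hδ
      obtain ⟨β, hβ, hδβ⟩ := Finset.mem_biUnion.1 (MvPolynomial.support_sum hδ)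
      have h2 := MvPolynomial.support_monomial_subset hδβ
      rw [Finset.mem_singleton] at h2
      subst h2
      intro i
      refine ⟨fun hi => (hP β hβ i).1 fun h => hi (by simp [r, h]), ?_⟩
      simpa [r] using Nat.mod_lt _ hp0
    · rw [← hP0, map_sum, frobEval_eq_sum]
      refine Finset.sum_congr rfl fun β _ => ?_
      rw [frobEval_monomial, frobEval_monomial, pow_one, mul_pow, ← pow_mul, ← pow_succ,
        mul_assoc]
      congr 1
      conv_rhs => rw [← hrd β, add_comm]
      rw [Finsupp.prod_add_index' (by simp) (by intros; rw [pow_add])]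
      congr 1
      rw [Finsupp.prod_of_support_subset _ (Finsupp.support_smul : (p • d β).support ⊆ _) _
        (by simp), Finsupp.prod, ← Finset.prod_pow]
      refine Finset.prod_congr rfl fun i _ => ?_
      rw [← pow_mul, mul_comm, Finsupp.smul_apply, smul_eq_mul]
  refine eq_zero_of_parts p hm P r d ?_ ?_ ?_
  · intro β _ γ _ h h'
    rw [← hrd β, ← hrd γ, h, h']
  · intro β hβ i
    refine ⟨fun hi => (hP β hβ i).1 fun h => hi (by simp [d, h]), ?_⟩
    have := (hP β hβ i).2
    simp only [d, Finsupp.mapRange_apply]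
    rw [Nat.div_lt_iff_lt_mul hp0, ← pow_succ]
    exact this
  · intro j
    have := congrArg (MvPolynomial.coeff j) hQ
    rw [MvPolynomial.coeff_sum, MvPolynomial.coeff_zero] at this
    simp only [MvPolynomial.coeff_monomial] at this
    rw [← Finset.sum_filter] at this
    convert this

lemma IsPIndep.all {T : Set k} (h1 : IsPIndep p T 1) (m : ℕ) : IsPIndep p T m := by
  classical
  induction m with
  | zero =>
    intro P hP hP0
    have hz : ∀ β ∈ P.support, β = 0 := fun β hβ => by
      ext i
      have := (hP β hβ i).2
      simp only [pow_zero, Nat.lt_one_iff] at this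
      simpa using this
    have hP1 : P = MvPolynomial.C (P.coeff 0) := by
      ext β
      rw [MvPolynomial.coeff_C]
      split_ifs with h
      · rw [h]
      · by_contra hne
        exact h (hz β (MvPolynomial.mem_support_iff.2 hne)).symm
    rw [hP1] at hP0 ⊢
    have : frobEval p 0 (MvPolynomial.C (P.coeff 0)) = P.coeff 0 := by
      simp [frobEval]
    rw [this] at hP0
    rw [hP0, map_zero]
  | succ m ih => exact IsPIndep.succ p h1 ih

end PBasis

section PBasisExists

variable {k : Type*} [Field k] (p : ℕ) [hp : Fact p.Prime] [CharP k p]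

lemma IsPIndep.empty : IsPIndep p (∅ : Set k) 1 := by
  classical
  intro P hP hP0
  have hz : ∀ β ∈ P.support, β = 0 := fun β hβ => by
    ext i
    by_contra h
    exact (hP β hβ i).1 h
  have hP1 : P = MvPolynomial.C (P.coeff 0) := by
    ext β
    rw [MvPolynomial.coeff_C]
    split_ifs with h
    · rw [h]
    · by_contra hne
      exact h (hz β (MvPolynomial.mem_support_iff.2 hne)).symm
  rw [hP1] at hP0 ⊢
  have : frobEval p 1 (MvPolynomial.C (P.coeff 0)) = P.coeff 0 ^ p := by
    simp [frobEval, frobenius_def]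
  rw [this] at hP0
  rw [eq_zero_of_pow_eq_zero hP0, map_zero]

lemma frobEval_monomial_mem {T : Set k} {m : ℕ} {L : Subring k} (hL : ∀ b, b ^ p ^ m ∈ L)
    (hT : T ⊆ L) {β : k →₀ ℕ} (hβ : ∀ i, β i ≠ 0 → i ∈ T) (c : k) :
    frobEval p m (MvPolynomial.monomial β c) ∈ L := by
  rw [frobEval_monomial]
  refine mul_mem (hL c) (prod_mem fun i hi => pow_mem (hT (hβ i ?_)) _)
  exact Finsupp.mem_support_iff.1 hi

lemma IsPIndep.insert {T : Set k} (hT : IsPIndep p T 1) {L : Subring k}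
    (hL : ∀ b, b ^ p ∈ L) (hTL : T ⊆ L) {x : k} (hx : x ∉ L) :
    IsPIndep p (insert x T) 1 := by
  classical
  intro P hP hP0
  have hinv : ∀ y ∈ L, y⁻¹ ∈ L := by
    intro y hy
    by_cases h0 : y = 0
    · simp [h0]
    · have : y⁻¹ = y ^ (p - 1) * (y⁻¹) ^ p := by
        obtain ⟨q, hq⟩ : ∃ q, p = q + 1 := ⟨p - 1, by have := hp.out.pos; omega⟩
        rw [hq, Nat.add_sub_cancel, pow_succ, ← mul_assoc, ← mul_pow, mul_inv_cancel₀ h0, one_pow,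
          one_mul]
      rw [this]
      exact mul_mem (pow_mem hy _) (hL _)
  let F : Subfield k := { L with inv_mem' := hinv }
  have hirr : Irreducible (Polynomial.X ^ p - Polynomial.C (⟨x ^ p, hL x⟩ : F)) := by
    refine X_pow_sub_C_irreducible_of_prime hp.out fun b hb => hx ?_
    have h1 : (b : k) ^ p = x ^ p := congrArg Subtype.val hb
    have h2 : (b : k) = x := frobenius_inj k p (by simpa [frobenius_def] using h1)
    rw [← h2]
    exact b.2
  have hmin : Polynomial.X ^ p - Polynomial.C (⟨x ^ p, hL x⟩ : F) = minpoly F x := by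
    refine minpoly.eq_of_irreducible_of_monic hirr ?_ (Polynomial.monic_X_pow_sub_C _ hp.out.ne_zero)
    rw [map_sub, map_pow, Polynomial.aeval_X, Polynomial.aeval_C]
    exact sub_self _
  have hsupp : ∀ β ∈ P.support, ∀ i, β.erase x i ≠ 0 → i ∈ T := by
    intro β hβ i hi
    by_cases hix : i = x
    · exact absurd (by rw [hix, Finsupp.erase_same]) hi
    · rw [Finsupp.erase_ne hix] at hi
      exact Set.mem_of_mem_insert_of_ne ((hP β hβ i).1 hi) hix
  let Q : Polynomial F := ∑ β ∈ P.support.attach, Polynomial.monomial (β.1 x)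
    (⟨frobEval p 1 (MvPolynomial.monomial (β.1.erase x) (P.coeff β.1)),
      frobEval_monomial_mem p (L := L) (by simpa using hL) hTL (hsupp β.1 β.2) _⟩ : F)
  have hQ0 : Polynomial.aeval x Q = 0 := by
    rw [← hP0, map_sum, frobEval_eq_sum, ← Finset.sum_attach P.support]
    refine Finset.sum_congr rfl fun β _ => ?_
    rw [Polynomial.aeval_monomial]
    change frobEval p 1 _ * _ = _
    rw [frobEval_monomial, mul_assoc]
    congr 1
    conv_rhs => rw [← Finsupp.erase_add_single x β.1]
    rw [Finsupp.prod_add_index' (by simp) (by intros; rw [pow_add])]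
    simp
  have hQ : Q = 0 := by
    refine Polynomial.eq_zero_of_dvd_of_natDegree_lt (minpoly.dvd F x hQ0) ?_
    rw [← hmin, Polynomial.natDegree_X_pow_sub_C]
    refine lt_of_le_of_lt (Polynomial.natDegree_sum_le _ _) ?_
    rw [Finset.fold_max_lt]
    refine ⟨hp.out.pos, fun β _ => lt_of_le_of_lt (Polynomial.natDegree_monomial_le _) ?_⟩
    simpa using (hP β.1 β.2 x).2
  refine eq_zero_of_parts p hT P (fun β => β x) (fun β => β.erase x) ?_ ?_ ?_
  · intro β _ γ _ h h'
    rw [← Finsupp.erase_add_single x β, ← Finsupp.erase_add_single x γ]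
    rw [h, h']
  · intro β hβ i
    refine ⟨hsupp β hβ i, ?_⟩
    by_cases hix : i = x
    · rw [hix, Finsupp.erase_same]
      exact pow_pos hp.out.pos 1
    · rw [Finsupp.erase_ne hix]
      exact (hP β hβ i).2
  · intro j
    have h := congrArg (fun q => ((Polynomial.coeff q j : F) : k)) hQ
    simp only [Q, Polynomial.finsetSum_coeff, Polynomial.coeff_zero, Polynomial.coeff_monomial]
      at h
    rw [← Finset.sum_filter, AddSubmonoidClass.coe_finsetSum, ZeroMemClass.coe_zero] at h
    rw [← h]
    symm
    refine Finset.sum_bij (fun β _ => β.1) ?_ ?_ ?_ ?_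
    · intro β hβ
      simp only [Finset.mem_filter, Finset.mem_attach, true_and] at hβ
      exact Finset.mem_filter.2 ⟨β.2, hβ⟩
    · intro a _ b _ hab
      exact Subtype.ext hab
    · intro β hβ
      exact ⟨⟨β, (Finset.mem_filter.1 hβ).1⟩, by simpa using (Finset.mem_filter.1 hβ).2, rfl⟩
    · intro β _
      rfl

/-- Existence of `p`-bases. -/
lemma exists_pBasis : ∃ T : Set k, IsPIndep p T 1 ∧
    ∀ m, Subring.closure (Set.range (fun b : k => b ^ p ^ m) ∪ T) = ⊤ := by
  classical
  obtain ⟨T, -, hT⟩ := zorn_subset_nonempty {T : Set k | IsPIndep p T 1} (by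
    intro c hc hch hne
    refine ⟨⋃₀ c, ?_, fun s hs => Set.subset_sUnion_of_mem hs⟩
    intro P hP hP0
    let V : Finset k := P.support.biUnion fun β => β.support
    have hV : (V : Set k) ⊆ ⋃₀ c := by
      intro i hi
      obtain ⟨β, hβ, hi⟩ := Finset.mem_biUnion.1 (Finset.mem_coe.1 hi)
      exact (hP β hβ i).1 (Finsupp.mem_support_iff.1 hi)
    obtain ⟨s, hs, hVs⟩ := DirectedOn.exists_mem_subset_of_finset_subset_biUnion
      (f := id) hne (hch.directedOn) (s := V) (by simpa [Set.sUnion_eq_biUnion] using hV)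
    refine hc hs P (fun β hβ i => ⟨fun hi => hVs ?_, (hP β hβ i).2⟩) hP0
    exact Finset.mem_coe.2 (Finset.mem_biUnion.2 ⟨β, hβ, Finsupp.mem_support_iff.2 hi⟩))
    ∅ (IsPIndep.empty p)
  refine ⟨T, hT.1, ?_⟩
  have h1 : Subring.closure (Set.range (fun b : k => b ^ p ^ 1) ∪ T) = ⊤ := by
    rw [eq_top_iff]
    intro x _
    by_contra hx
    have h2 := IsPIndep.insert p hT.1 (L := Subring.closure (Set.range (fun b : k => b ^ p ^ 1) ∪ T))
      (fun b => Subring.subset_closure (Or.inl ⟨b, by simp⟩))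
      (fun i hi => Subring.subset_closure (Or.inr hi)) hx
    exact hx (Subring.subset_closure (Or.inr (hT.2 h2 (Set.subset_insert x T)
      (Set.mem_insert x T))))
  intro m
  induction m with
  | zero =>
    rw [eq_top_iff]
    exact fun x _ => Subring.subset_closure (Or.inl ⟨x, by simp⟩)
  | succ m ih =>
    rw [eq_top_iff, ← h1, Subring.closure_le]
    rintro x (⟨b, rfl⟩ | hx)
    · have : (⊤ : Subring k) ≤ (Subring.closure
          (Set.range (fun b : k => b ^ p ^ (m + 1)) ∪ T)).comap (frobenius k p) := by
        rw [← ih, Subring.closure_le]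
        rintro x (⟨b, rfl⟩ | hx)
        · refine Subring.subset_closure (Or.inl ⟨b, ?_⟩)
          simp [frobenius_def, pow_succ, pow_mul]
        · rw [Subring.coe_comap, Set.mem_preimage, frobenius_def]
          refine pow_mem (?_ : x ∈ Subring.closure _) p
          exact Subring.subset_closure (Or.inr hx)
      have h := this (Subring.mem_top b)
      simpa [frobenius_def] using h
    · exact Subring.subset_closure (Or.inr hx)

end PBasisExists

/-- A surjection with nilpotent kernel onto a field of characteristic `p` restricts to a
surjection from a subring on which the kernel is contained in the multiples of `p`. -/
lemma exists_subring_ker_le_span_prime {A k : Type*} [CommRing A] [Field k] (p : ℕ)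
    [hp : Fact p.Prime] [CharP k p] (res : A →+* k) (hres : Function.Surjective res) {m : ℕ}
    (hm : RingHom.ker res ^ (m + 1) = ⊥) :
    ∃ B : Subring A, (∀ x, ∃ b : B, res b = x) ∧
      ∀ b : B, res b = 0 → ∃ c : B, b = (p : B) * c := by
  classical
  obtain ⟨T, hT, hgen⟩ := exists_pBasis (k := k) p
  have hpn : (p : A) ∈ RingHom.ker res := by
    rw [RingHom.mem_ker, map_natCast, CharP.cast_eq_zero]
  obtain ⟨s, hs⟩ : ∃ s : k → A, ∀ x, res (s x) = x := hres.hasRightInverse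
  set q := p ^ m with hq
  have hq0 : 0 < q := pow_pos hp.out.pos m
  let τ : k → A := fun x => s x ^ q
  have hτ : ∀ a, τ (res a) = a ^ q := fun a =>
    Ideal.pow_prime_pow_eq _ hpn hm (by rw [RingHom.mem_ker, map_sub, hs, sub_self])
  let B : Subring A := Subring.closure (Set.range τ ∪ s '' T)
  have hτB : ∀ x, τ x ∈ B := fun x => Subring.subset_closure (Or.inl ⟨x, rfl⟩)
  have hsB : ∀ x ∈ T, s x ∈ B := fun x hx => Subring.subset_closure (Or.inr ⟨x, hx, rfl⟩)
  have hresB : ∀ x, ∃ b : B, res b = x := by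
    have : (⊤ : Subring k) ≤ B.map res := by
      rw [← hgen m, Subring.closure_le]
      rintro x (⟨b, rfl⟩ | hx)
      · exact ⟨τ b, hτB b, by simp [τ, hs, hq]⟩
      · exact ⟨s x, hsB x hx, hs x⟩
    intro x
    obtain ⟨b, hb, rfl⟩ := this (Subring.mem_top x)
    exact ⟨⟨b, hb⟩, rfl⟩
  let G : AddSubgroup A := B.toAddSubgroup.map (AddMonoidHom.mulLeft (p : A))
  have hG : ∀ b ∈ B, (p : A) * b ∈ G := fun b hb => ⟨b, hb, rfl⟩
  have hpow : ∀ e u, 1 ≤ u → u + e = m → ∀ y, (p : A) ^ u * y ^ p ^ e ∈ G := by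
    intro e
    induction e using Nat.strong_induction_on with
    | _ e ih =>
      intro u hu hue
      have hadd := add_pow_prime_pow_mem hp.out G u e fun v hv w =>
        ih v hv (u + (e - v)) (by omega) (by omega) w
      have hBY : ∀ y ∈ B, (p : A) ^ u * y ^ p ^ e ∈ G := by
        intro y hy
        obtain ⟨u', rfl⟩ : ∃ u', u = u' + 1 := ⟨u - 1, by omega⟩
        rw [pow_succ', mul_assoc]
        exact hG _ (mul_mem (pow_mem (natCast_mem B p) _) (pow_mem hy _))
      have hnY : ∀ y ∈ RingHom.ker res, (p : A) ^ u * y ^ p ^ e ∈ G := by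
        intro y hy
        have h1 : (p : A) ^ u * y ^ p ^ e ∈ RingHom.ker res ^ (m + 1) := by
          have h2 := Nat.lt_pow_self hp.out.one_lt (n := e)
          refine Ideal.pow_le_pow_right (m := m + 1) (n := u + p ^ e) (by omega) ?_
          rw [pow_add]
          exact Ideal.mul_mem_mul (Ideal.pow_mem_pow hpn _) (Ideal.pow_mem_pow hy _)
        rw [hm, Ideal.mem_bot] at h1
        rw [h1]
        exact zero_mem G
      intro y
      obtain ⟨b, hb⟩ := hresB (res y)
      have h3 := hadd b (y - b)
      rw [add_sub_cancel] at h3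
      have h4 := add_mem (add_mem h3 (hBY b b.2)) (hnY (y - b)
        (by rw [RingHom.mem_ker, map_sub, hb, sub_self]))
      convert h4 using 1
      ring
  have hτadd : ∀ x y, τ (x + y) - τ x - τ y ∈ G := by
    intro x y
    have h1 := add_pow_prime_pow_mem hp.out G 0 m (fun v hv w =>
      hpow v (0 + (m - v)) (by omega) (by omega) w) (s x) (s y)
    rw [pow_zero, one_mul] at h1
    have h2 : τ (x + y) = (s x + s y) ^ q := by rw [← hτ, map_add, hs, hs]
    rw [h2]
    exact h1
  have hτmul : ∀ x y, τ (x * y) = τ x * τ y := by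
    intro x y
    have h2 : τ (x * y) = (s x * s y) ^ q := by rw [← hτ, map_mul, hs, hs]
    rw [h2, mul_pow]
  have hτ1 : τ 1 = 1 := by rw [← map_one res, hτ, one_pow]
  have hτ0 : τ 0 = 0 := by rw [← map_zero res, hτ, zero_pow hq0.ne']
  let mk := Ideal.Quotient.mk (Ideal.span {(p : B)})
  have hmk : ∀ b : B, (b : A) ∈ G → mk b = 0 := by
    rintro b ⟨c, hc, hcb⟩
    refine Ideal.Quotient.eq_zero_iff_mem.2 (Ideal.mem_span_singleton.2 ⟨⟨c, hc⟩, ?_⟩)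
    exact Subtype.ext hcb.symm
  let τ' : k →+* B ⧸ Ideal.span {(p : B)} :=
    { toFun := fun x => mk ⟨τ x, hτB x⟩
      map_one' := by
        rw [← map_one mk]
        exact congrArg mk (Subtype.ext hτ1)
      map_zero' := by
        rw [← map_zero mk]
        exact congrArg mk (Subtype.ext hτ0)
      map_mul' := fun x y => by
        rw [← map_mul mk]
        exact congrArg mk (Subtype.ext (hτmul x y))
      map_add' := fun x y => by
        rw [← map_add mk, ← sub_eq_zero, ← map_sub]
        refine hmk _ ?_
        have := hτadd x y
        rw [sub_sub] at this
        exact this }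
  let v : k → B ⧸ Ideal.span {(p : B)} := fun i =>
    if hi : i ∈ T then mk ⟨s i, hsB i hi⟩ else 1
  let θ : MvPolynomial k k →+* B ⧸ Ideal.span {(p : B)} := MvPolynomial.eval₂Hom τ' v
  have hθ : ∀ b (hb : b ∈ B), mk ⟨b, hb⟩ ∈ θ.range := by
    intro b hb
    induction hb using Subring.closure_induction with
    | mem x hx =>
      obtain ⟨x, rfl⟩ | ⟨x, hx, rfl⟩ := hx
      · exact ⟨MvPolynomial.C x, by simp only [θ, MvPolynomial.eval₂Hom_C]; rfl⟩
      · exact ⟨MvPolynomial.X x, by simp only [θ, MvPolynomial.eval₂Hom_X', v, dif_pos hx]⟩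
    | zero => exact zero_mem _
    | one => exact one_mem _
    | add x y hx hy ihx ihy => exact add_mem ihx ihy
    | neg x hx ihx => exact neg_mem ihx
    | mul x y hx hy ihx ihy => exact mul_mem ihx ihy
  have hvq : ∀ i ∈ T, v i ^ q = τ' i := by
    intro i hi
    simp only [v, dif_pos hi]
    rw [← map_pow]
    rfl
  have hred : ∀ P, ∃ P', IsFrobReduced p T m P' ∧ θ P' = θ P := by
    intro P
    induction P using MvPolynomial.monomial_add_induction_on with
    | C a =>
      refine ⟨MvPolynomial.C a, ?_, rfl⟩
      intro β hβ i
      have : β = 0 := by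
        have := MvPolynomial.support_monomial_subset hβ
        simpa using this
      rw [this]
      exact ⟨fun h => absurd rfl h, hq0⟩
    | monomial_add β c P hβ hc ih =>
      obtain ⟨P', hP', hθP'⟩ := ih
      let β' : k →₀ ℕ := (β.filter (· ∈ T)).mapRange (· % q) (Nat.zero_mod q)
      have hβ' : ∀ i, β' i = if i ∈ T then β i % q else 0 := by
        intro i
        simp only [β', Finsupp.mapRange_apply, Finsupp.filter_apply]
        split_ifs <;> simp
      refine ⟨MvPolynomial.monomial β' (c * β.prod fun i e => if i ∈ T then i ^ (e / q) else 1)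
        + P', ?_, ?_⟩
      · intro γ hγ i
        rcases Finset.mem_union.1 (MvPolynomial.support_add hγ) with h | h
        · have h2 := Finset.mem_singleton.1 (MvPolynomial.support_monomial_subset h)
          rw [h2, hβ']
          split_ifs with hi
          · exact ⟨fun _ => hi, Nat.mod_lt _ hq0⟩
          · exact ⟨fun h => absurd rfl h, hq0⟩
        · exact hP' γ h i
      · rw [map_add, map_add, hθP']
        congr 1
        simp only [θ, MvPolynomial.eval₂Hom_monomial]
        rw [Finsupp.prod_of_support_subset β' (s := β.support) _ _ (by simp), map_mul, mul_assoc,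
          Finsupp.prod, Finsupp.prod, map_prod, ← Finset.prod_mul_distrib]
        · congr 1
          refine Finset.prod_congr rfl fun i _ => ?_
          rw [hβ']
          split_ifs with hi
          · rw [map_pow, ← hvq i hi, ← pow_mul, ← pow_add, Nat.div_add_mod]
          · simp [v, hi]
        · intro i hi
          rw [Finsupp.mem_support_iff, hβ'] at hi
          rw [Finsupp.mem_support_iff]
          intro h0
          simp [h0] at hi
  let res' : B ⧸ Ideal.span {(p : B)} →+* k :=
    Ideal.Quotient.lift _ (res.comp B.subtype) (by
      intro a ha
      obtain ⟨c, rfl⟩ := Ideal.mem_span_singleton.1 ha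
      simp)
  have hres' : ∀ P, IsFrobReduced p T m P → res' (θ P) = frobEval p m P := by
    intro P hP
    rw [P.as_sum, map_sum, map_sum, map_sum]
    refine Finset.sum_congr rfl fun β hβ => ?_
    rw [frobEval_monomial]
    simp only [θ, MvPolynomial.eval₂Hom_monomial]
    rw [map_mul, Finsupp.prod, Finsupp.prod, map_prod]
    congr 1
    · change res (s _ ^ q) = _
      rw [map_pow, hs]
    · refine Finset.prod_congr rfl fun i hi => ?_
      have hiT := (hP β hβ i).1 (Finsupp.mem_support_iff.1 hi)
      rw [map_pow]
      congr 1
      simp only [v, dif_pos hiT]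
      exact hs i
  refine ⟨B, hresB, fun b hb => ?_⟩
  obtain ⟨P, hP⟩ := hθ b b.2
  obtain ⟨P', hP', hPP'⟩ := hred P
  have h0 : frobEval p m P' = 0 := by
    rw [← hres' P' hP', hPP', hP, ← hb]
    rfl
  rw [IsPIndep.all p hT m P' hP' h0, map_zero, hP] at hPP'
  obtain ⟨c, hc⟩ := Ideal.mem_span_singleton.1 (Ideal.Quotient.eq_zero_iff_mem.1 hPP'.symm)
  exact ⟨c, hc⟩

lemma WittVector.p_dvd_of_constantCoeff_eq_zero (p : ℕ) [Fact p.Prime] {K : Type*} [Field K]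
    [CharP K p] [PerfectRing K p] {x : WittVector p K} (hx : WittVector.constantCoeff x = 0) :
    (p : WittVector p K) ∣ x := by
  by_cases h0 : x = 0
  · simp [h0]
  obtain ⟨m, b, hb, rfl⟩ := WittVector.exists_eq_pow_p_mul x h0
  rcases m with _ | m
  · rw [pow_zero, one_mul] at hx
    exact absurd hx hb
  · exact ⟨p ^ m * b, by rw [pow_succ', mul_assoc]⟩

/-- A local ring with nilpotent maximal ideal and residue characteristic `p` receives a
homomorphism from a chain ring with the same residue field. -/
lemma exists_chainRing_charP {Λ : Type} [CommRing Λ] [IsLocalRing Λ] (p : ℕ) [hp : Fact p.Prime]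
    [CharP (IsLocalRing.ResidueField Λ) p] {t : ℕ}
    (ht : IsLocalRing.maximalIdeal Λ ^ (t + 1) = ⊥) :
    ∃ (B : Type) (_ : CommRing B) (π : B) (φ : B →+* Λ), IsChainRing B π t ∧
      Function.Surjective ((IsLocalRing.residue Λ).comp φ) := by
  let k := IsLocalRing.ResidueField Λ
  let K := PerfectClosure k p
  let I : Ideal (WittVector p K) := Ideal.span {(p : WittVector p K) ^ (t + 1)}
  let wbar : WittVector p K ⧸ I →+* K := Ideal.Quotient.lift I WittVector.constantCoeff (by
    intro a ha
    obtain ⟨c, rfl⟩ := Ideal.mem_span_singleton.1 ha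
    rw [map_mul, map_pow, map_natCast, CharP.cast_eq_zero, zero_pow (by omega), zero_mul])
  let ι : k →+* K := PerfectClosure.of k p
  let A : Subring (Λ × (WittVector p K ⧸ I)) :=
    RingHom.eqLocus ((ι.comp (IsLocalRing.residue Λ)).comp (RingHom.fst _ _))
      (wbar.comp (RingHom.snd _ _))
  let res : A →+* k := ((IsLocalRing.residue Λ).comp (RingHom.fst _ _)).comp A.subtype
  have hres : Function.Surjective res := by
    intro x
    obtain ⟨a, ha⟩ := IsLocalRing.residue_surjective x
    obtain ⟨w, hw⟩ := WittVector.constantCoeff_surjective p (ι x)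
    refine ⟨⟨(a, Ideal.Quotient.mk I w), ?_⟩, ha⟩
    change ι (IsLocalRing.residue Λ a) = wbar (Ideal.Quotient.mk I w)
    rw [ha, Ideal.Quotient.lift_mk, hw]
  have hker : RingHom.ker wbar ≤ Ideal.span {(p : WittVector p K ⧸ I)} := by
    intro x hx
    obtain ⟨w, rfl⟩ := Ideal.Quotient.mk_surjective x
    rw [RingHom.mem_ker, Ideal.Quotient.lift_mk] at hx
    obtain ⟨c, rfl⟩ := WittVector.p_dvd_of_constantCoeff_eq_zero p hx
    rw [map_mul, map_natCast]
    exact Ideal.mul_mem_right _ _ (Ideal.mem_span_singleton_self _)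
  have hpw : (p : WittVector p K ⧸ I) ^ (t + 1) = 0 := by
    rw [← map_natCast (Ideal.Quotient.mk I), ← map_pow, Ideal.Quotient.eq_zero_iff_mem]
    exact Ideal.mem_span_singleton_self _
  have hpw' : (p : WittVector p K ⧸ I) ^ t ≠ 0 := by
    intro h
    rw [← map_natCast (Ideal.Quotient.mk I), ← map_pow, Ideal.Quotient.eq_zero_iff_mem,
      Ideal.mem_span_singleton] at h
    have := (pow_dvd_pow_iff (WittVector.irreducible p).ne_zero
      (WittVector.irreducible p).not_isUnit).1 h
    omega
  have hm : RingHom.ker res ^ (t + 1) = ⊥ := by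
    rw [eq_bot_iff]
    have h1 : (RingHom.ker res ^ (t + 1)).map ((RingHom.fst _ _).comp A.subtype) ≤ ⊥ := by
      rw [Ideal.map_pow, ← ht]
      refine Ideal.pow_right_mono ?_ _
      rw [Ideal.map_le_iff_le_comap]
      intro x hx
      exact (IsLocalRing.residue_eq_zero_iff _).1 hx
    have h2 : (RingHom.ker res ^ (t + 1)).map ((RingHom.snd _ _).comp A.subtype) ≤ ⊥ := by
      rw [Ideal.map_pow]
      refine (Ideal.pow_right_mono (J := Ideal.span {(p : WittVector p K ⧸ I)}) ?_ _).trans ?_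
      · rw [Ideal.map_le_iff_le_comap]
        intro x hx
        refine hker ?_
        have h3 : ι (IsLocalRing.residue Λ x.1.1) = wbar x.1.2 := x.2
        rw [RingHom.mem_ker]
        change wbar x.1.2 = 0
        rw [← h3, show IsLocalRing.residue Λ x.1.1 = 0 from hx, map_zero]
      · rw [Ideal.span_singleton_pow, hpw, Ideal.span_singleton_le_iff_mem]
        exact zero_mem _
    intro x hx
    have h3 := h1 (Ideal.mem_map_of_mem _ hx)
    have h4 := h2 (Ideal.mem_map_of_mem _ hx)
    rw [Ideal.mem_bot] at h3 h4 ⊢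
    exact Subtype.ext (Prod.ext h3 h4)
  obtain ⟨B, hB, hker'⟩ := exists_subring_ker_le_span_prime p res hres hm
  have hpA : (p : A) ^ (t + 1) = 0 := by
    have : (p : A) ^ (t + 1) ∈ RingHom.ker res ^ (t + 1) :=
      Ideal.pow_mem_pow (by rw [RingHom.mem_ker, map_natCast, CharP.cast_eq_zero]) _
    rwa [hm] at this
  have hpB : (p : B) ^ (t + 1) = 0 := by
    apply Subtype.ext
    push_cast
    exact hpA
  refine ⟨B, inferInstance, p, (RingHom.fst _ _).comp (A.subtype.comp B.subtype), ⟨?_, ?_, hpB⟩, ?_⟩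
  · intro b
    by_cases h0 : res b = 0
    · right
      obtain ⟨c, hc⟩ := hker' b h0
      exact ⟨c, hc⟩
    · left
      obtain ⟨c, hc⟩ := hB (res b)⁻¹
      obtain ⟨d, hd⟩ := hker' (1 - b * c) (by
        push_cast
        rw [map_sub, map_one, map_mul, hc, mul_inv_cancel₀ h0, sub_self])
      have h1 : IsUnit (1 - (p : B) * d) :=
        IsNilpotent.isUnit_one_sub ⟨t + 1, by rw [mul_pow, hpB, zero_mul]⟩
      rw [← hd, sub_sub_cancel] at h1
      exact isUnit_of_mul_isUnit_left h1
  · intro h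
    apply hpw'
    have := congrArg (fun b : B => b.1.1.2) h
    simpa using this
  · intro x
    obtain ⟨b, hb⟩ := hB x
    exact ⟨b, hb⟩

lemma exists_chainRing_charZero {Λ : Type} [CommRing Λ] [IsLocalRing Λ]
    [CharZero (IsLocalRing.ResidueField Λ)] {t : ℕ}
    (ht : IsLocalRing.maximalIdeal Λ ^ (t + 1) = ⊥) :
    ∃ (B : Type) (_ : CommRing B) (π : B) (φ : B →+* Λ), IsChainRing B π t ∧
      Function.Surjective ((IsLocalRing.residue Λ).comp φ) := by
  obtain ⟨hQ⟩ : Nonempty (Algebra ℚ Λ) := by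
    rw [EqualCharZero.nonempty_algebraRat_iff]
    intro J hJ
    let f : Λ ⧸ J →+* IsLocalRing.ResidueField Λ :=
      Ideal.Quotient.factor (IsLocalRing.le_maximalIdeal hJ)
    exact ⟨fun a b hab => by
      have := congrArg f hab
      rw [map_natCast, map_natCast] at this
      exact_mod_cast this⟩
  obtain ⟨s, v, hv⟩ := exists_isTranscendenceBasis' ℚ (IsLocalRing.ResidueField Λ)
  have := hv.isAlgebraic_field
  have : Algebra.FormallySmooth ℚ (IsLocalRing.ResidueField Λ) :=
    Algebra.FormallySmooth.of_algebraicIndependent_of_isSeparable hv.1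
  let g : IsLocalRing.ResidueField Λ →ₐ[ℚ] Λ ⧸ IsLocalRing.maximalIdeal Λ :=
    RingHom.toRatAlgHom (RingHom.id (IsLocalRing.ResidueField Λ))
  let σ := Algebra.FormallySmooth.lift _ ⟨t + 1, ht⟩ g
  have hσ : ∀ x, IsLocalRing.residue Λ (σ x) = x := fun x =>
    Algebra.FormallySmooth.mk_lift _ ⟨t + 1, ht⟩ g x
  let P := PowerSeries (IsLocalRing.ResidueField Λ)
  let I : Ideal P := Ideal.span {(PowerSeries.X : P) ^ (t + 1)}
  refine ⟨P ⧸ I, inferInstance, Ideal.Quotient.mk I PowerSeries.X,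
    Ideal.Quotient.lift I ((σ : _ →+* Λ).comp PowerSeries.constantCoeff) ?_, ⟨?_, ?_, ?_⟩, ?_⟩
  · intro a ha
    obtain ⟨c, rfl⟩ := Ideal.mem_span_singleton.1 ha
    have h0 : PowerSeries.constantCoeff (PowerSeries.X : P) = 0 := PowerSeries.constantCoeff_X
    rw [map_mul, map_pow, RingHom.comp_apply, h0, map_zero, zero_pow (by omega), zero_mul]
  · intro x
    obtain ⟨w, rfl⟩ := Ideal.Quotient.mk_surjective x
    by_cases h0 : PowerSeries.constantCoeff w = 0
    · exact Or.inr (map_dvd _ (PowerSeries.X_dvd_iff.2 h0))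
    · exact Or.inl ((PowerSeries.isUnit_iff_constantCoeff.2 (isUnit_iff_ne_zero.2 h0)).map _)
  · intro h
    rw [← map_pow, Ideal.Quotient.eq_zero_iff_mem, Ideal.mem_span_singleton] at h
    have := (pow_dvd_pow_iff PowerSeries.X_irreducible.ne_zero
      PowerSeries.X_irreducible.not_isUnit).1 h
    omega
  · rw [← map_pow, Ideal.Quotient.eq_zero_iff_mem]
    exact Ideal.mem_span_singleton_self _
  · intro x
    refine ⟨Ideal.Quotient.mk I (PowerSeries.C x), ?_⟩
    have h0 : PowerSeries.constantCoeff (PowerSeries.C x : P) = x :=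
      PowerSeries.constantCoeff_C x
    rw [RingHom.comp_apply, Ideal.Quotient.lift_mk, RingHom.comp_apply, h0]
    exact hσ x

/-- A local ring with nilpotent maximal ideal receives homomorphisms from arbitrarily long chain
rings with the same residue field. -/
lemma exists_chainRing {Λ : Type} [CommRing Λ] [IsLocalRing Λ] {t : ℕ}
    (ht : IsLocalRing.maximalIdeal Λ ^ (t + 1) = ⊥) :
    ∃ (B : Type) (_ : CommRing B) (π : B) (φ : B →+* Λ), IsChainRing B π t ∧
      Function.Surjective ((IsLocalRing.residue Λ).comp φ) := by
  obtain ⟨p, hp⟩ := CharP.exists (IsLocalRing.ResidueField Λ)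
  rcases CharP.char_is_prime_or_zero (IsLocalRing.ResidueField Λ) p with h | rfl
  · have : Fact p.Prime := ⟨h⟩
    exact exists_chainRing_charP p ht
  · have := CharP.charP_to_charZero (IsLocalRing.ResidueField Λ)
    exact exists_chainRing_charZero ht

lemma exists_extension_of_subsingleton_ext {R : Type} [CommRing R] {C N : Type} [AddCommGroup C]
    [Module R C] [AddCommGroup N] [Module R N] (F : ℕ → Type) [∀ l, AddCommGroup (F l)]
    [∀ l, Module R (F l)] [∀ l, Module.Projective R (F l)] (d : ∀ l, F (l + 1) →ₗ[R] F l)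
    (π : F 0 →ₗ[R] C)
    (hπ : Function.Surjective π) (hπd : Function.Exact (d 0) π)
    (hd : ∀ l, Function.Exact (d (l + 1)) (d l)) {l : ℕ}
    (hext : Subsingleton (extMod R (ModuleCat.of R C) (ModuleCat.of R N) (l + 1)))
    (φ : F (l + 1) →ₗ[R] N) (hφ : φ ∘ₗ d (l + 1) = 0) : ∃ ψ : F l →ₗ[R] N, φ = ψ ∘ₗ d l := by
  let K : ChainComplex (ModuleCat R) ℕ :=
    ChainComplex.of (fun l => ModuleCat.of R (F l)) (fun l => ModuleCat.ofHom (d l))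
      (fun l => by
        rw [← ModuleCat.ofHom_comp]
        ext x
        exact (hd l).apply_apply_eq_zero x)
  have hKd : ∀ l, K.d (l + 1) l = ModuleCat.ofHom (d l) := fun l =>
    ChainComplex.of_d (fun l => ModuleCat.of R (F l)) (fun l => ModuleCat.ofHom (d l)) l
  let P : ProjectiveResolution (ModuleCat.of R C) :=
    { complex := K
      projective := fun n => (IsProjective.iff_projective (F n)).1 inferInstance
      π := (ChainComplex.toSingle₀Equiv _ _).symm ⟨ModuleCat.ofHom π, by
        rw [hKd 0, ← ModuleCat.ofHom_comp]
        ext x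
        exact hπd.apply_apply_eq_zero x⟩
      quasiIso := ⟨fun n => by
        cases n with
        | zero =>
          rw [ChainComplex.quasiIsoAt₀_iff, ShortComplex.quasiIso_iff_of_zeros']
          · have h : (ShortComplex.mk (ModuleCat.ofHom (d 0)) (ModuleCat.ofHom π) (by
                rw [← ModuleCat.ofHom_comp]
                ext x
                exact hπd.apply_apply_eq_zero x)).Exact ∧ Epi (ModuleCat.ofHom π) :=
              ⟨(ShortComplex.ShortExact.moduleCat_exact_iff_function_exact _).2 hπd,
                (ModuleCat.epi_iff_surjective _).2 hπ⟩
            refine (ShortComplex.exact_and_epi_g_iff_of_iso ?_).2 h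
            exact ShortComplex.isoMk (Iso.refl _) (Iso.refl _) (Iso.refl _)
              ((Category.id_comp (ModuleCat.ofHom (d 0))).trans
                ((hKd 0).symm.trans (Category.comp_id (K.d 1 0)).symm))
              ((Category.id_comp (ModuleCat.ofHom π)).trans
                (Category.comp_id (ModuleCat.ofHom π)).symm)
          all_goals rfl
        | succ n =>
          rw [quasiIsoAt_iff_exactAt']
          · rw [HomologicalComplex.exactAt_iff' _ (n + 1 + 1) (n + 1) n (by simp) (by simp),
              ShortComplex.ShortExact.moduleCat_exact_iff_function_exact]
            change Function.Exact (K.d (n + 2) (n + 1)).hom (K.d (n + 1) n).hom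
            rw [hKd, hKd]
            exact hd n
          · apply ChainComplex.exactAt_succ_single_obj⟩ }
  have h1 : (P.complex.linearYonedaObj R (ModuleCat.of R N)).ExactAt (l + 1) := by
    rw [HomologicalComplex.exactAt_iff_isZero_homology]
    refine Limits.IsZero.of_iso ?_ (P.isoExt (l + 1) (ModuleCat.of R N)).symm
    have : Subsingleton (((Ext R (ModuleCat R) (l + 1)).obj
      (Opposite.op (ModuleCat.of R C))).obj (ModuleCat.of R N)) := hext
    exact ModuleCat.isZero_of_subsingleton _
  rw [HomologicalComplex.exactAt_iff' _ l (l + 1) (l + 2) (by simp) (by simp),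
    ShortComplex.moduleCat_exact_iff] at h1
  obtain ⟨ψ, hψ⟩ := h1 (ModuleCat.ofHom φ) (by
    change K.d (l + 2) (l + 1) ≫ ModuleCat.ofHom φ = 0
    rw [hKd, ← ModuleCat.ofHom_comp, hφ]
    rfl)
  refine ⟨ModuleCat.Hom.hom (show ModuleCat.of R (F l) ⟶ ModuleCat.of R N from ψ), ?_⟩
  have h2 : K.d (l + 1) l ≫ (show ModuleCat.of R (F l) ⟶ ModuleCat.of R N from ψ) =
    ModuleCat.ofHom φ := hψ
  rw [hKd] at h2
  exact (congrArg ModuleCat.Hom.hom h2).symm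

section MinimalResolution

variable {R : Type*} [CommRing R] [IsLocalRing R]

/-- A minimal free resolution given by matrices. -/
structure IsMinimalResolution {C : Type*} [AddCommGroup C] [Module R C] (b : ℕ → ℕ)
    (d : ∀ l, Matrix (Fin (b l)) (Fin (b (l + 1))) R) (π : (Fin (b 0) → R) →ₗ[R] C) : Prop where
  surjective : Function.Surjective π
  exact_zero : Function.Exact (d 0).mulVecLin π
  exact : ∀ l, Function.Exact (d (l + 1)).mulVecLin (d l).mulVecLin
  mem_maximalIdeal : ∀ l i j, d l i j ∈ IsLocalRing.maximalIdeal R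

lemma exists_minimal_cover (C : Type*) [AddCommGroup C] [Module R C] [Module.Finite R C] :
    ∃ (n : ℕ) (π : (Fin n → R) →ₗ[R] C), Function.Surjective π ∧
      ∀ v, π v = 0 → ∀ i, v i ∈ IsLocalRing.maximalIdeal R := by
  classical
  have hex : ∃ (n : ℕ) (π : (Fin n → R) →ₗ[R] C), Function.Surjective π :=
    Module.Finite.exists_fin' R C
  obtain ⟨π, hπ⟩ := Nat.find_spec hex
  refine ⟨Nat.find hex, π, hπ, ?_⟩
  intro v hv i
  by_contra hi
  have hu : IsUnit (v i) := by
    by_contra h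
    exact hi ((IsLocalRing.mem_maximalIdeal _).2 h)
  obtain ⟨a, ha⟩ := hu.exists_left_inv
  generalize hn : Nat.find hex = n at π v i
  obtain _ | n := n
  · exact i.elim0
  have hlt : n < Nat.find hex := by omega
  apply Nat.find_min hex hlt
  let ι : (Fin n → R) →ₗ[R] (Fin (n + 1) → R) :=
    LinearMap.pi fun j => if h : ∃ j', i.succAbove j' = j then LinearMap.proj h.choose else 0
  have hι : ∀ u : Fin (n + 1) → R, u i = 0 → ι (fun j => u (i.succAbove j)) = u := by
    intro u hu
    ext j
    simp only [ι, LinearMap.pi_apply]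
    split_ifs with h
    · exact congrArg u h.choose_spec
    · have : j = i := by
        by_contra hne
        exact h (Fin.exists_succAbove_eq hne)
      rw [this, hu]
      rfl
  refine ⟨π ∘ₗ ι, fun x => ?_⟩
  obtain ⟨u, rfl⟩ := hπ x
  refine ⟨fun j => (u - (u i * a) • v) (i.succAbove j), ?_⟩
  rw [LinearMap.comp_apply, hι]
  · rw [map_sub, map_smul, hv, smul_zero, sub_zero]
  · simp [mul_assoc, ha]

lemma exists_minimal_syzygy [IsNoetherianRing R] {n : ℕ} {C : Type*} [AddCommGroup C] [Module R C]
    (f : (Fin n → R) →ₗ[R] C) (hf : ∀ v, f v = 0 → ∀ i, v i ∈ IsLocalRing.maximalIdeal R) :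
    ∃ (m : ℕ) (D : Matrix (Fin n) (Fin m) R), Function.Exact D.mulVecLin f ∧
      (∀ i j, D i j ∈ IsLocalRing.maximalIdeal R) ∧
      ∀ v, D.mulVecLin v = 0 → ∀ i, v i ∈ IsLocalRing.maximalIdeal R := by
  classical
  obtain ⟨m, π, hπ, hker⟩ := exists_minimal_cover (R := R) (LinearMap.ker f)
  have hD : (LinearMap.toMatrix' ((LinearMap.ker f).subtype ∘ₗ π)).mulVecLin =
      (LinearMap.ker f).subtype ∘ₗ π := Matrix.toLin'_toMatrix' _
  refine ⟨m, LinearMap.toMatrix' ((LinearMap.ker f).subtype ∘ₗ π), ?_, ?_, ?_⟩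
  · rw [hD]
    intro y
    constructor
    · intro hy
      obtain ⟨x, hx⟩ := hπ ⟨y, hy⟩
      exact ⟨x, by simp [hx]⟩
    · rintro ⟨x, rfl⟩
      exact (π x).2
  · intro i j
    rw [LinearMap.toMatrix'_apply]
    exact hf _ (π _).2 i
  · intro v hv
    rw [hD] at hv
    exact hker v (Subtype.ext hv)

lemma exists_isMinimalResolution [IsNoetherianRing R] (C : Type*) [AddCommGroup C] [Module R C]
    [Module.Finite R C] : ∃ (b : ℕ → ℕ) (d : ∀ l, Matrix (Fin (b l)) (Fin (b (l + 1))) R)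
      (π : (Fin (b 0) → R) →ₗ[R] C), IsMinimalResolution b d π := by
  let S := Σ' (n m : ℕ) (D : Matrix (Fin n) (Fin m) R), (∀ i j, D i j ∈ IsLocalRing.maximalIdeal R) ∧
      ∀ v, D.mulVecLin v = 0 → ∀ i, v i ∈ IsLocalRing.maximalIdeal R
  obtain ⟨n, π, hπ, hker⟩ := exists_minimal_cover (R := R) C
  obtain ⟨m, D, hD, hD1, hD2⟩ := exists_minimal_syzygy π hker
  have hstep : ∀ s : S, ∃ (m' : ℕ) (D' : Matrix (Fin s.2.1) (Fin m') R),
      Function.Exact D'.mulVecLin s.2.2.1.mulVecLin ∧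
      (∀ i j, D' i j ∈ IsLocalRing.maximalIdeal R) ∧
      ∀ v, D'.mulVecLin v = 0 → ∀ i, v i ∈ IsLocalRing.maximalIdeal R := fun s =>
    exists_minimal_syzygy s.2.2.1.mulVecLin s.2.2.2.2
  choose m' D' h1 h2 h3 using hstep
  let next : S → S := fun s => ⟨s.2.1, m' s, D' s, h2 s, h3 s⟩
  let seq : ℕ → S := fun l => Nat.rec ⟨n, m, D, hD1, hD2⟩ (fun _ s => next s) l
  exact ⟨fun l => (seq l).1, fun l => (seq l).2.2.1, π, hπ, hD, fun l => h1 (seq l),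
    fun l => (seq l).2.2.2.1⟩

end MinimalResolution

/-- The homological properties of a semidualizing module in terms of a resolution. -/
lemma IsSemidualizing.exists_extension {R : Type} [CommRing R] {C : Type}
    [AddCommGroup C] [Module R C] (hC : IsSemidualizing R C) [IsLocalRing R] {b : ℕ → ℕ}
    {d : ∀ l, Matrix (Fin (b l)) (Fin (b (l + 1))) R} {π : (Fin (b 0) → R) →ₗ[R] C}
    (hd : IsMinimalResolution b d π) {l : ℕ} (φ : (Fin (b (l + 1)) → R) →ₗ[R] C)
    (hφ : φ ∘ₗ (d (l + 1)).mulVecLin = 0) :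
    ∃ ψ : (Fin (b l) → R) →ₗ[R] C, φ = ψ ∘ₗ (d l).mulVecLin :=
  exists_extension_of_subsingleton_ext (fun l => Fin (b l) → R) (fun l => (d l).mulVecLin) π
    hd.surjective hd.exact_zero hd.exact (hC.2.2 (l + 1) (by omega)) φ hφ

section TensorPairing

open TensorProduct

variable {R : Type*} [CommRing R] {M : Type*} [AddCommGroup M] [Module R M]

lemma exists_factorization_of_forall {X Y G : Type*} [AddCommGroup X] [Module R X] [AddCommGroup Y]
    [Module R Y] [AddCommGroup G] [Module R G] [Module.Projective R G] (P : X →ₗ[R] Y)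
    (u : G →ₗ[R] Y) (h : ∀ g, ∃ x, P x = u g) : ∃ w : G →ₗ[R] X, P ∘ₗ w = u := by
  obtain ⟨w, hw⟩ := Module.projective_lifting_property P.rangeRestrict
    (u.codRestrict (LinearMap.range P) h) P.surjective_rangeRestrict
  exact ⟨w, LinearMap.ext fun g => congrArg Subtype.val (LinearMap.congr_fun hw g)⟩

lemma exists_tensor_factorization {F₀ F₁ F₂ G : Type*} [AddCommGroup F₀] [Module R F₀]
    [AddCommGroup F₁] [Module R F₁] [AddCommGroup F₂] [Module R F₂] [AddCommGroup G] [Module R G]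
    [Module.Projective R G] {d : F₁ →ₗ[R] F₀} {d' : F₂ →ₗ[R] F₁}
    (h : ∀ φ : F₁ →ₗ[R] M, φ ∘ₗ d' = 0 → ∃ ψ : F₀ →ₗ[R] M, φ = ψ ∘ₗ d)
    (v : F₁ ⊗[R] G →ₗ[R] M) (hv : v ∘ₗ d'.rTensor G = 0) :
    ∃ w : F₀ ⊗[R] G →ₗ[R] M, v = w ∘ₗ d.rTensor G := by
  obtain ⟨w, hw⟩ := exists_factorization_of_forall (LinearMap.lcomp R M d)
    (TensorProduct.curry v).flip (fun g => by
      obtain ⟨ψ, hψ⟩ := h ((TensorProduct.curry v).flip g) (by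
        ext f
        exact LinearMap.congr_fun hv (f ⊗ₜ g))
      exact ⟨ψ, hψ.symm⟩)
  refine ⟨TensorProduct.lift w.flip, TensorProduct.ext' fun f g => ?_⟩
  simpa using (LinearMap.congr_fun (LinearMap.congr_fun hw g) f).symm

lemma exists_contraction {G : ℕ → Type*} [∀ t, AddCommGroup (G t)] [∀ t, Module R (G t)]
    [∀ t, Module.Projective R (G t)] {δ : ∀ t, G (t + 1) →ₗ[R] G t}
    (hδ : ∀ t, Function.Exact (δ (t + 1)) (δ t)) {k : Type*} [AddCommGroup k] [Module R k]
    {ε : G 0 →ₗ[R] k} (hε : Function.Exact (δ 0) ε) {x : R} (hx : ∀ a : k, x • a = 0) (t : ℕ) :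
    ∃ (h : G t →ₗ[R] G (t + 1)) (h' : G (t + 1) →ₗ[R] G (t + 2)),
      ∀ g, x • g = h (δ t g) + δ (t + 1) (h' g) := by
  have hstep : ∀ t (h : G t →ₗ[R] G (t + 1)), (∀ g, δ t (h (δ t g)) = x • δ t g) →
      ∃ h' : G (t + 1) →ₗ[R] G (t + 2), ∀ g, x • g = h (δ t g) + δ (t + 1) (h' g) := by
    intro t h hh
    obtain ⟨h', hh'⟩ := exists_factorization_of_forall (δ (t + 1))
      (x • LinearMap.id - h ∘ₗ δ t) (fun g => (hδ t _).1 (by simp [hh]))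
    refine ⟨h', fun g => ?_⟩
    have := LinearMap.congr_fun hh' g
    simp only [LinearMap.comp_apply, LinearMap.sub_apply, LinearMap.smul_apply,
      LinearMap.id_apply] at this
    rw [this]
    abel
  have key : ∀ t, ∃ h : G t →ₗ[R] G (t + 1), ∀ g, δ t (h (δ t g)) = x • δ t g := by
    intro t
    induction t with
    | zero =>
      obtain ⟨h, hh⟩ := exists_factorization_of_forall (δ 0) (x • LinearMap.id)
        (fun g => (hε _).1 (by simp [hx]))
      exact ⟨h, fun g => LinearMap.congr_fun hh (δ 0 g)⟩
    | succ t ih =>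
      obtain ⟨h, hh⟩ := ih
      obtain ⟨h', hh'⟩ := hstep t h hh
      refine ⟨h', fun g => ?_⟩
      rw [hh' (δ (t + 1) g), (hδ t).apply_apply_eq_zero, map_zero, zero_add]
  obtain ⟨h, hh⟩ := key t
  exact ⟨h, hstep t h hh⟩

lemma exists_staircase {F G : ℕ → Type*} [∀ t, AddCommGroup (G t)] [∀ t, Module R (G t)]
    [∀ t, Module.Projective R (G t)] [∀ t, AddCommGroup (F t)] [∀ t, Module R (F t)]
    [∀ t, Module.Projective R (F t)]
    {δ : ∀ t, G (t + 1) →ₗ[R] G t} (hδ : ∀ t, Function.Exact (δ (t + 1)) (δ t))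
    {k : Type*} [AddCommGroup k] [Module R k]
    {ε : G 0 →ₗ[R] k} (hε : Function.Exact (δ 0) ε) {J : Ideal R} (hJ : ∀ x ∈ J, ∀ a : k, x • a = 0)
    {d : ∀ t, F (t + 1) →ₗ[R] F t} (hd : ∀ t, d t ∘ₗ d (t + 1) = 0)
    (hM : ∀ l (φ : F (l + 1) →ₗ[R] M), φ ∘ₗ d (l + 1) = 0 →
      ∃ ψ : F l →ₗ[R] M, φ = ψ ∘ₗ d l) {ι : Type*} {s : ℕ} (l : ℕ) :
    ∀ t (_ : t + l + 1 = s) (y : ι → F (l + 1) ⊗[R] G t) (y' : ι → F l ⊗[R] G (t + 1))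
      (_ : ∀ i, (d l).rTensor _ (y i) = (δ t).lTensor _ (y' i)),
      ∃ Y : ι → F 0 ⊗[R] G s,
        (∀ i, ∀ x ∈ J, ∀ r : F 0 ⊗[R] G s →ₗ[R] M, r ∘ₗ (d 0).rTensor _ = 0 →
          r ∘ₗ (δ s).lTensor _ = 0 → x • r (Y i) = 0) ∧
        ∀ v : F (l + 1) ⊗[R] G t →ₗ[R] M, v ∘ₗ (d (l + 1)).rTensor _ = 0 →
          v ∘ₗ (δ t).lTensor _ = 0 → ∃ r : F 0 ⊗[R] G s →ₗ[R] M, r ∘ₗ (d 0).rTensor _ = 0 ∧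
          r ∘ₗ (δ s).lTensor _ = 0 ∧ ∀ i, v (y i) = r (Y i) := by
  have hδδ : ∀ t, δ t ∘ₗ δ (t + 1) = 0 := fun t => (hδ t).linearMap_comp_eq_zero
  have hpass : ∀ l t (v : F (l + 1) ⊗[R] G t →ₗ[R] M), v ∘ₗ (d (l + 1)).rTensor _ = 0 →
      v ∘ₗ (δ t).lTensor _ = 0 → ∃ r : F l ⊗[R] G (t + 1) →ₗ[R] M,
        r ∘ₗ (d l).rTensor _ = 0 ∧ r ∘ₗ (δ (t + 1)).lTensor _ = 0 ∧
        ∀ y y', (d l).rTensor _ y = (δ t).lTensor _ y' → v y = r y' := by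
    intro l t v hv hv'
    obtain ⟨w, rfl⟩ := exists_tensor_factorization (hM l) v hv
    refine ⟨w ∘ₗ (δ t).lTensor _, ?_, ?_, ?_⟩
    · rw [LinearMap.comp_assoc, LinearMap.lTensor_comp_rTensor, ← LinearMap.rTensor_comp_lTensor,
        ← LinearMap.comp_assoc, hv']
    · rw [LinearMap.comp_assoc, ← LinearMap.lTensor_comp, hδδ, LinearMap.lTensor_zero,
        LinearMap.comp_zero]
    · intro y y' h
      simp [h]
  induction l with
  | zero =>
    rintro t rfl y y' hy
    refine ⟨y', ?_, fun v hv hv' => ?_⟩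
    · intro i x hx r hr hr'
      obtain ⟨h, h', hh⟩ := exists_contraction hδ hε (hJ x hx) t
      have h1 : x • r = (r ∘ₗ h.lTensor _) ∘ₗ (δ t).lTensor _ := by
        refine TensorProduct.ext' fun f g => ?_
        have h2 := LinearMap.congr_fun hr' (f ⊗ₜ h' g)
        simp only [LinearMap.comp_apply, LinearMap.lTensor_tmul, LinearMap.zero_apply] at h2
        simp only [LinearMap.smul_apply, LinearMap.comp_apply, LinearMap.lTensor_tmul]
        rw [← map_smul, ← TensorProduct.tmul_smul, hh, TensorProduct.tmul_add, map_add]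
        erw [h2]
        rw [add_zero]
      have h3 : x • r (y' i) = (x • r) (y' i) := rfl
      rw [h3, h1, LinearMap.comp_apply, ← hy, LinearMap.comp_apply, ← LinearMap.comp_apply,
        ← LinearMap.comp_apply, LinearMap.comp_assoc, LinearMap.lTensor_comp_rTensor,
        ← LinearMap.rTensor_comp_lTensor, ← LinearMap.comp_assoc, hr, LinearMap.zero_comp,
        LinearMap.zero_apply]
    · obtain ⟨r, h1, h2, h3⟩ := hpass 0 t v hv hv'
      exact ⟨r, h1, h2, fun i => h3 _ _ (hy i)⟩
  | succ l ih =>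
    intro t hts y y' hy
    have hex : ∀ i, ∃ y'' : F l ⊗[R] G (t + 2),
        (d l).rTensor _ (y' i) = (δ (t + 1)).lTensor _ y'' := by
      intro i
      obtain ⟨y'', h⟩ := (Module.Flat.lTensor_exact (F l) (hδ t) ((d l).rTensor _ (y' i))).1 (by
        rw [← LinearMap.comp_apply, LinearMap.lTensor_comp_rTensor,
          ← LinearMap.rTensor_comp_lTensor, LinearMap.comp_apply, ← hy, ← LinearMap.comp_apply,
          ← LinearMap.rTensor_comp, hd, LinearMap.rTensor_zero, LinearMap.zero_apply])
      exact ⟨y'', h.symm⟩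
    choose y'' hy'' using hex
    obtain ⟨Y, hY, hY'⟩ := ih (t + 1) (by omega) y' y'' hy''
    refine ⟨Y, hY, fun v hv hv' => ?_⟩
    obtain ⟨r, h1, h2, h3⟩ := hpass (l + 1) t v hv hv'
    obtain ⟨r', h4, h5, h6⟩ := hY' r h1 h2
    exact ⟨r', h4, h5, fun i => (h3 _ _ (hy i)).trans (h6 i)⟩

end TensorPairing

section DepthReduction

variable {R : Type*} [CommRing R]

lemma exists_pow_mem_span_singleton {C : Type*} [AddCommGroup C] [Module R C] [Module.Finite R C]
    (hfaith : ∀ r : R, (∀ c : C, r • c = 0) → r = 0) {r x : R} (h : ∀ c : C, ∃ c', r • c = x • c') :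
    ∃ n, x ∣ r ^ n := by
  obtain ⟨p, hp, hdeg, hcoeff, hev⟩ :=
    LinearMap.exists_monic_and_natDegree_eq_and_coeff_mem_pow_and_aeval_eq_zero R
      (algebraMap R (Module.End R C) r) (Ideal.span {x}) (by
        rintro _ ⟨c, rfl⟩
        obtain ⟨c', hc'⟩ := h c
        rw [Module.algebraMap_end_apply, hc']
        exact Submodule.smul_mem_smul (Ideal.mem_span_singleton_self x) trivial)
  rw [Polynomial.aeval_algebraMap_apply] at hev
  have h0 : Polynomial.aeval r p = 0 := hfaith _ fun c => by
    simpa using LinearMap.congr_fun hev c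
  rw [Polynomial.aeval_def, Polynomial.eval₂_eq_sum_range, Finset.sum_range_succ, hp.coeff_natDegree,
    map_one, one_mul] at h0
  refine ⟨p.natDegree, Ideal.mem_span_singleton.1 ?_⟩
  rw [← neg_eq_of_add_eq_zero_right h0]
  refine neg_mem (Ideal.sum_mem _ fun i hi => Ideal.mul_mem_right _ _ ?_)
  refine Ideal.pow_le_self ?_ (hcoeff i)
  have := Finset.mem_range.1 hi
  omega

lemma isSMulRegular_of_linearMap_eq_zero [IsNoetherianRing R] {C M : Type*} [AddCommGroup C]
    [Module R C] [Module.Finite R C] [AddCommGroup M] [Module R M] [Module.Finite R M]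
    (hfaith : ∀ r : R, (∀ c : C, r • c = 0) → r = 0) {x : R}
    (h : ∀ φ : C →ₗ[R] M, x • φ = 0 → φ = 0) : IsSMulRegular M x := by
  have h1 : Subsingleton ((C ⧸ LinearMap.range (LinearMap.lsmul R C x)) →ₗ[R] M) := by
    refine subsingleton_of_forall_eq 0 fun φ => ?_
    have h2 := h (φ ∘ₗ Submodule.mkQ _) (LinearMap.ext fun c => by
      have h3 : Submodule.mkQ (LinearMap.range (LinearMap.lsmul R C x)) (x • c) = 0 :=
        (Submodule.Quotient.mk_eq_zero _).2 ⟨c, rfl⟩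
      rw [LinearMap.smul_apply, ← map_smul, LinearMap.comp_apply, h3, map_zero,
        LinearMap.zero_apply])
    refine Submodule.linearMap_qext _ ?_
    rw [h2, LinearMap.zero_comp]
  obtain ⟨r, hr, hreg⟩ := IsSMulRegular.subsingleton_linearMap_iff.1 h1
  obtain ⟨n, a, ha⟩ := exists_pow_mem_span_singleton (C := C) hfaith (r := r) (x := x) (fun c => by
    have := Module.mem_annihilator.1 hr (Submodule.Quotient.mk c)
    rw [← Submodule.Quotient.mk_smul, Submodule.Quotient.mk_eq_zero] at this
    obtain ⟨c', hc'⟩ := this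
    exact ⟨c', hc'.symm⟩)
  have := hreg.pow n
  rw [ha, mul_comm] at this
  exact this.of_mul

/-- Data obtained from a semidualizing module by dividing out a regular sequence: `e : C → M`
is a cyclic generator of `Hom(C, M)` with annihilator `I`, and the higher `Ext` modules vanish. -/
structure IsCyclicHom {C M : Type*} [AddCommGroup C] [Module R C] [AddCommGroup M] [Module R M]
    {F : ℕ → Type*} [∀ l, AddCommGroup (F l)] [∀ l, Module R (F l)]
    (d : ∀ l, F (l + 1) →ₗ[R] F l) (e : C →ₗ[R] M) (I : Ideal R) : Prop where
  exists_eq_smul : ∀ φ : C →ₗ[R] M, ∃ r : R, φ = r • e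
  smul_eq_zero_iff : ∀ r : R, r • e = 0 ↔ r ∈ I
  exists_extension : ∀ l (φ : F (l + 1) →ₗ[R] M), φ ∘ₗ d (l + 1) = 0 →
      ∃ ψ : F l →ₗ[R] M, φ = ψ ∘ₗ d l

lemma IsCyclicHom.quotient [IsNoetherianRing R] {C M : Type*} [AddCommGroup C] [Module R C]
    [Module.Finite R C] [AddCommGroup M] [Module R M] [Module.Finite R M]
    (hfaith : ∀ r : R, (∀ c : C, r • c = 0) → r = 0)
    {F : ℕ → Type*} [∀ l, AddCommGroup (F l)] [∀ l, Module R (F l)] [∀ l, Module.Projective R (F l)]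
    {d : ∀ l, F (l + 1) →ₗ[R] F l} (hd : ∀ l, d l ∘ₗ d (l + 1) = 0) {π : F 0 →ₗ[R] C}
    (hπ : Function.Surjective π) (hπd : Function.Exact (d 0) π)
    {e : C →ₗ[R] M} {I : Ideal R} (h : IsCyclicHom d e I) {x : R} (hx : ∀ r, x * r ∈ I → r ∈ I) :
    IsCyclicHom d ((LinearMap.range (LinearMap.lsmul R M x)).mkQ ∘ₗ e) (I ⊔ Ideal.span {x}) := by
  have hreg : IsSMulRegular M x := isSMulRegular_of_linearMap_eq_zero hfaith (C := C) fun φ hφ => by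
    obtain ⟨r, rfl⟩ := h.exists_eq_smul φ
    rw [smul_smul, h.smul_eq_zero_iff] at hφ
    exact (h.smul_eq_zero_iff r).2 (hx r hφ)
  set q := (LinearMap.range (LinearMap.lsmul R M x)).mkQ with hq
  have hqx : ∀ a, q (x • a) = 0 := fun a => (Submodule.Quotient.mk_eq_zero _).2 ⟨a, rfl⟩
  have hdiv : ∀ {X : Type _} [AddCommGroup X] [Module R X] [Module.Projective R X]
      (u : X →ₗ[R] M), q ∘ₗ u = 0 → ∃ w : X →ₗ[R] M, u = x • w := by
    intro X _ _ _ u hu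
    obtain ⟨w, hw⟩ := exists_factorization_of_forall (LinearMap.lsmul R M x) u (fun g =>
      (Submodule.Quotient.mk_eq_zero _).1 (LinearMap.congr_fun hu g))
    exact ⟨w, hw.symm⟩
  have hcancel : ∀ {X : Type _} [AddCommGroup X] [Module R X] (u : X →ₗ[R] M), x • u = 0 →
      u = 0 := fun u hu => LinearMap.ext fun g => hreg (by
        simpa using LinearMap.congr_fun hu g)
  have hlift : ∀ {X : Type _} [AddCommGroup X] [Module R X] [Module.Projective R X]
      (φ : X →ₗ[R] (M ⧸ LinearMap.range (LinearMap.lsmul R M x))), ∃ u : X →ₗ[R] M, q ∘ₗ u = φ :=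
    fun φ => exists_factorization_of_forall q φ fun g => Submodule.mkQ_surjective _ _
  have hqsmul : ∀ {X : Type _} [AddCommGroup X] [Module R X] (u : X →ₗ[R] M),
      q ∘ₗ (x • u) = 0 := fun u => LinearMap.ext fun g => hqx (u g)
  have main : ∀ l (φ : F l →ₗ[R] (M ⧸ LinearMap.range (LinearMap.lsmul R M x))), φ ∘ₗ d l = 0 →
      ∃ w : F l →ₗ[R] M, q ∘ₗ w = φ ∧ w ∘ₗ d l = 0 := by
    intro l φ hφ
    obtain ⟨u, rfl⟩ := hlift φ
    obtain ⟨w, hw⟩ := hdiv (u ∘ₗ d l) hφ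
    have hwd : w ∘ₗ d (l + 1) = 0 := hcancel _ (by
      rw [← LinearMap.smul_comp, ← hw, LinearMap.comp_assoc, hd, LinearMap.comp_zero])
    obtain ⟨ψ, hψ⟩ := h.exists_extension l w hwd
    refine ⟨u - x • ψ, ?_, ?_⟩
    · rw [LinearMap.comp_sub, hqsmul, sub_zero]
    · rw [LinearMap.sub_comp, hw, hψ, LinearMap.smul_comp, sub_self]
  have hfac : ∀ w : F 0 →ₗ[R] M, w ∘ₗ d 0 = 0 → ∃ r : R, w = (r • e) ∘ₗ π := by
    intro w hw
    obtain ⟨θ, hθ⟩ : ∃ θ : C →ₗ[R] M, w = θ ∘ₗ π := by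
      have hk : LinearMap.ker π ≤ LinearMap.ker w := by
        intro y hy
        obtain ⟨z, rfl⟩ := (hπd y).1 hy
        exact LinearMap.congr_fun hw z
      refine ⟨(LinearMap.ker π).liftQ w hk ∘ₗ (π.quotKerEquivOfSurjective hπ).symm.toLinearMap, ?_⟩
      ext y
      have : (π.quotKerEquivOfSurjective hπ).symm (π y) = Submodule.Quotient.mk y := by
        rw [LinearEquiv.symm_apply_eq]
        rfl
      simp [this]
    obtain ⟨r, rfl⟩ := h.exists_eq_smul θ
    exact ⟨r, hθ⟩
  have hπc : ∀ {Y : Type _} [AddCommGroup Y] [Module R Y] (u v : C →ₗ[R] Y), u ∘ₗ π = v ∘ₗ π →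
      u = v := fun u v huv => (LinearMap.cancel_right hπ).1 huv
  refine ⟨fun φ => ?_, fun r => ⟨fun hr => ?_, fun hr => ?_⟩, fun l φ hφ => ?_⟩
  · obtain ⟨w, hw, hw'⟩ := main 0 (φ ∘ₗ π) (by
      rw [LinearMap.comp_assoc, hπd.linearMap_comp_eq_zero, LinearMap.comp_zero])
    obtain ⟨r, rfl⟩ := hfac w hw'
    refine ⟨r, hπc _ _ ?_⟩
    rw [← hw]
    rfl
  · obtain ⟨w, hw⟩ := hdiv ((r • e) ∘ₗ π) (by
      have : q ∘ₗ (r • e) ∘ₗ π = (r • q ∘ₗ e) ∘ₗ π := by ext; simp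
      rw [this, hr, LinearMap.zero_comp])
    obtain ⟨s, rfl⟩ := hfac w (hcancel _ (by
      rw [← LinearMap.smul_comp, ← hw, LinearMap.comp_assoc, hπd.linearMap_comp_eq_zero,
        LinearMap.comp_zero]))
    have h1 : r • e = x • s • e := hπc _ _ hw
    have h2 : r - x * s ∈ I := (h.smul_eq_zero_iff _).1 (by rw [sub_smul, h1, mul_smul, sub_self])
    rw [← sub_add_cancel r (x * s)]
    exact add_mem (Ideal.mem_sup_left h2)
      (Ideal.mem_sup_right (Ideal.mul_mem_right _ _ (Ideal.mem_span_singleton_self x)))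
  · obtain ⟨a, ha, c, hc, rfl⟩ := Submodule.mem_sup.1 hr
    obtain ⟨s, rfl⟩ := Ideal.mem_span_singleton.1 hc
    ext c
    have h1 := LinearMap.congr_fun ((h.smul_eq_zero_iff a).2 ha) c
    simp only [LinearMap.smul_apply, LinearMap.zero_apply, LinearMap.comp_apply] at h1 ⊢
    rw [← map_smul, add_smul, h1, zero_add, mul_smul, hqx]
  · obtain ⟨w, hw, hw'⟩ := main (l + 1) φ hφ
    obtain ⟨ψ, rfl⟩ := h.exists_extension l w hw'
    exact ⟨q ∘ₗ ψ, hw.symm⟩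

/-- Ideals generated by regular sequences. -/
inductive IsRegularIdeal (J : Ideal R) : Ideal R → Prop
  | bot : IsRegularIdeal J ⊥
  | sup_span {I : Ideal R} {x : R} (hI : IsRegularIdeal J I) (hx : x ∈ J)
      (hreg : ∀ r, x * r ∈ I → r ∈ I) : IsRegularIdeal J (I ⊔ Ideal.span {x})

end DepthReduction

lemma exists_isCyclicHom {R : Type*} [CommRing R] [IsNoetherianRing R] {C : Type} [AddCommGroup C]
    [Module R C] [Module.Finite R C] (hC : Function.Bijective (LinearMap.lsmul R C))
    {F : ℕ → Type*} [∀ l, AddCommGroup (F l)] [∀ l, Module R (F l)] [∀ l, Module.Projective R (F l)]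
    {d : ∀ l, F (l + 1) →ₗ[R] F l} (hd : ∀ l, d l ∘ₗ d (l + 1) = 0) {π : F 0 →ₗ[R] C}
    (hπ : Function.Surjective π) (hπd : Function.Exact (d 0) π)
    (hext : ∀ l (φ : F (l + 1) →ₗ[R] C), φ ∘ₗ d (l + 1) = 0 →
      ∃ ψ : F l →ₗ[R] C, φ = ψ ∘ₗ d l) {J I : Ideal R} (hI : IsRegularIdeal J I) :
    ∃ (M : Type) (_ : AddCommGroup M) (_ : Module R M) (_ : Module.Finite R M) (e : C →ₗ[R] M),
      IsCyclicHom d e I := by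
  induction hI with
  | bot =>
    refine ⟨C, inferInstance, inferInstance, inferInstance, LinearMap.id,
      fun φ => ?_, fun r => ?_, hext⟩
    · obtain ⟨r, rfl⟩ := hC.2 φ
      exact ⟨r, rfl⟩
    · rw [Ideal.mem_bot, ← (injective_iff_map_eq_zero' _).1 hC.1 r]
      rfl
  | sup_span hI hx hreg ih =>
    obtain ⟨M, _, _, _, e, he⟩ := ih
    refine ⟨_, _, _, inferInstance, _, he.quotient (fun r hr => ?_) hd hπ hπd hreg⟩
    exact (injective_iff_map_eq_zero _).1 hC.1 r (LinearMap.ext hr)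

section BettiBound

open TensorProduct

variable {R : Type} [CommRing R] [IsLocalRing R]

lemma exists_maximal_isRegularIdeal [IsNoetherianRing R] :
    ∃ (I : Ideal R) (r₀ : R), IsRegularIdeal (IsLocalRing.maximalIdeal R) I ∧ r₀ ∉ I ∧
      ∀ x ∈ IsLocalRing.maximalIdeal R, x * r₀ ∈ I := by
  obtain ⟨I, hI, hmax⟩ := set_has_maximal_iff_noetherian.2 (inferInstance : IsNoetherian R R)
    {I : Ideal R | IsRegularIdeal (IsLocalRing.maximalIdeal R) I} ⟨⊥, .bot⟩
  refine ⟨I, ?_⟩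
  have hle : I ≤ IsLocalRing.maximalIdeal R := by
    clear hmax
    induction hI with
    | bot => exact bot_le
    | sup_span hI hx hreg ih =>
      exact sup_le ih ((Ideal.span_singleton_le_iff_mem _).2 hx)
  have hzd : ∀ x ∈ IsLocalRing.maximalIdeal R, ¬ ∀ r, x * r ∈ I → r ∈ I := by
    intro x hx hreg
    have h1 := hmax _ (IsRegularIdeal.sup_span hI hx hreg)
    have hxI : x ∈ I := by
      by_contra hxI
      exact h1 (lt_of_le_of_ne le_sup_left fun h => hxI
        (h ▸ Ideal.mem_sup_right (Ideal.mem_span_singleton_self x)))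
    have h2 := hreg 1 (by simpa using hxI)
    exact (Ideal.ne_top_iff_one _).1 (IsLocalRing.maximalIdeal.isMaximal R).ne_top (hle h2)
  have hns : ¬ Subsingleton ((R ⧸ IsLocalRing.maximalIdeal R) →ₗ[R] (R ⧸ I)) := by
    rw [IsSMulRegular.subsingleton_linearMap_iff]
    rintro ⟨x, hx, hreg⟩
    rw [Ideal.annihilator_quotient] at hx
    refine hzd x hx fun r hr => ?_
    have : x • Ideal.Quotient.mk I r = x • 0 := by
      rw [smul_zero]
      exact Ideal.Quotient.eq_zero_iff_mem.2 hr
    exact Ideal.Quotient.eq_zero_iff_mem.1 (hreg this)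
  rw [not_subsingleton_iff_nontrivial] at hns
  obtain ⟨f, hf⟩ := exists_ne (0 : (R ⧸ IsLocalRing.maximalIdeal R) →ₗ[R] (R ⧸ I))
  obtain ⟨r₀, hr₀⟩ := Ideal.Quotient.mk_surjective (f 1)
  refine ⟨r₀, hI, fun h => hf ?_, fun x hx => ?_⟩
  · refine Submodule.linearMap_qext _ (LinearMap.ext_ring ?_)
    change f 1 = 0
    rw [← hr₀]
    exact Ideal.Quotient.eq_zero_iff_mem.2 h
  · rw [← Ideal.Quotient.eq_zero_iff_mem, map_mul, hr₀]
    have h1 : x • (1 : R ⧸ IsLocalRing.maximalIdeal R) = 0 := by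
      rw [Algebra.smul_def, mul_one]
      exact Ideal.Quotient.eq_zero_iff_mem.2 hx
    have h2 := map_smul f x 1
    rw [h1, map_zero, Algebra.smul_def] at h2
    exact h2.symm

lemma card_le_of_exists_apply_eq_single {M : Type*} [AddCommGroup M] [Module R M] {g b : ℕ}
    (Θ : (Fin g → R) →ₗ[R] (Fin b → M))
    (hΘ : ∀ x ∈ IsLocalRing.maximalIdeal R, ∀ p, x • Θ p = 0) {u : M} (hu : u ≠ 0)
    (h : ∀ q, ∃ p, Θ p = Pi.single q u) : b ≤ g := by
  choose p hp using h
  have hli : LinearIndependent (IsLocalRing.ResidueField R)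
      (fun q i => IsLocalRing.residue R (p q i)) := by
    rw [Fintype.linearIndependent_iff]
    intro a ha q
    choose a' ha' using fun q => IsLocalRing.residue_surjective (a q)
    have h1 : ∀ i, (∑ q, a' q • p q) i ∈ IsLocalRing.maximalIdeal R := by
      intro i
      rw [← IsLocalRing.residue_eq_zero_iff]
      have := congrFun ha i
      simpa [ha'] using this
    have h2 : Θ (∑ q, a' q • p q) = 0 := by
      conv_lhs => rw [← Finset.univ_sum_single (∑ q, a' q • p q), map_sum]
      refine Finset.sum_eq_zero fun i _ => ?_
      have : Pi.single i ((∑ q, a' q • p q) i) =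
          ((∑ q, a' q • p q) i) • (Pi.single i 1 : Fin g → R) := by
        rw [← Pi.single_smul, smul_eq_mul, mul_one]
      rw [this, map_smul, hΘ _ (h1 i)]
    have h3 := congrFun h2 q
    simp only [map_sum, map_smul, hp, Finset.sum_apply, Pi.smul_apply, Pi.zero_apply] at h3
    rw [Finset.sum_eq_single q (fun q' _ hq' => by rw [Pi.single_eq_of_ne' hq', smul_zero])
      (by simp), Pi.single_eq_same] at h3
    by_contra hne
    have hunit : IsUnit (a' q) := by
      by_contra hnu
      exact hne (by rw [← ha' q, IsLocalRing.residue_eq_zero_iff]; exact hnu)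
    exact hu (hunit.smul_eq_zero.1 h3)
  simpa using hli.fintype_card_le_finrank

lemma betti_le_of_isCyclicHom {C M : Type} [AddCommGroup C] [Module R C] [AddCommGroup M]
    [Module R M] {b : ℕ → ℕ} {d : ∀ l, Matrix (Fin (b l)) (Fin (b (l + 1))) R}
    {π : (Fin (b 0) → R) →ₗ[R] C} (hd : IsMinimalResolution b d π) {e : C →ₗ[R] M} {I : Ideal R}
    (he : IsCyclicHom (F := fun l => Fin (b l) → R) (fun l => (d l).mulVecLin) e I) {r₀ : R} (hr₀ : r₀ ∉ I)
    (hr₀' : ∀ x ∈ IsLocalRing.maximalIdeal R, x * r₀ ∈ I) {bk : ℕ → ℕ}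
    {δ : ∀ l, Matrix (Fin (bk l)) (Fin (bk (l + 1))) R}
    {ε : (Fin (bk 0) → R) →ₗ[R] (R ⧸ IsLocalRing.maximalIdeal R)}
    (hδ : IsMinimalResolution bk δ ε) {m g : ℕ}
    (Ψ : (Fin g → R) →ₗ[R] ((Fin (bk m) → R) →ₗ[R] (R ⧸ I)))
    (hΨ : LinearMap.range Ψ = LinearMap.ker (LinearMap.lcomp R (R ⧸ I) (δ m).mulVecLin)) :
    b m ≤ g := by
  classical
  set F : ℕ → Type := fun l => Fin (b l) → R
  set G : ℕ → Type := fun l => Fin (bk l) → R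
  set d' : ∀ l, F (l + 1) →ₗ[R] F l := fun l => (d l).mulVecLin with hd'
  set δ' : ∀ l, G (l + 1) →ₗ[R] G l := fun l => (δ l).mulVecLin with hδ'
  obtain ⟨u, hu, hmu⟩ : ∃ u : M, u ≠ 0 ∧ ∀ x ∈ IsLocalRing.maximalIdeal R, x • u = 0 := by
    have h1 : r₀ • e ≠ 0 := fun h => hr₀ ((he.smul_eq_zero_iff r₀).1 h)
    obtain ⟨c, hc⟩ : ∃ c, (r₀ • e) c ≠ 0 := by
      by_contra! h
      exact h1 (LinearMap.ext h)
    refine ⟨(r₀ • e) c, hc, fun x hx => ?_⟩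
    have := (he.smul_eq_zero_iff _).2 (hr₀' x hx)
    rw [mul_smul] at this
    exact LinearMap.congr_fun this c
  obtain ⟨e₀, he₀⟩ := hδ.surjective 1
  have hk : ∀ x ∈ IsLocalRing.maximalIdeal R, ∀ a : R ⧸ IsLocalRing.maximalIdeal R, x • a = 0 := by
    intro x hx a
    rw [Algebra.smul_def]
    have : algebraMap R (R ⧸ IsLocalRing.maximalIdeal R) x = 0 := Ideal.Quotient.eq_zero_iff_mem.2 hx
    rw [this, zero_mul]
  have hdd : ∀ l, d' l ∘ₗ d' (l + 1) = 0 := fun l => (hd.exact l).linearMap_comp_eq_zero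
  -- cocycles hitting all socle elements
  let y : Fin (b m) → F m ⊗[R] G 0 := fun q => Pi.single q 1 ⊗ₜ e₀
  have hv : ∀ q, ∃ v : F m ⊗[R] G 0 →ₗ[R] M, v ∘ₗ (d' m).rTensor _ = 0 ∧
      v ∘ₗ (δ' 0).lTensor _ = 0 ∧ ∀ q', v (y q') = Pi.single (M := fun _ => M) q u q' := by
    intro q
    let w : (R ⧸ IsLocalRing.maximalIdeal R) →ₗ[R] M :=
      (IsLocalRing.maximalIdeal R).liftQ (LinearMap.toSpanSingleton R M u) (fun x hx => hmu x hx)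
    have hw : ∀ a, w (Submodule.Quotient.mk a) = a • u := fun a => rfl
    have hw1 : w 1 = u := (hw 1).trans (one_smul _ _)
    let v : F m ⊗[R] G 0 →ₗ[R] M := TensorProduct.lift
      (LinearMap.mk₂ R (fun (f : F m) (a : G 0) => f q • w (ε a))
        (fun _ _ _ => add_smul _ _ _) (fun _ _ _ => mul_smul _ _ _)
        (fun _ _ _ => by rw [map_add, map_add, smul_add])
        (fun _ _ _ => by rw [map_smul, map_smul, smul_comm]))
    have hv : ∀ f a, v (f ⊗ₜ a) = f q • w (ε a) := fun f a => rfl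
    refine ⟨v, ?_, ?_, fun q' => ?_⟩
    · refine TensorProduct.ext' fun f a => ?_
      rw [LinearMap.comp_apply, LinearMap.rTensor_tmul, hv, LinearMap.zero_apply, ← map_smul,
        hk, map_zero]
      change (∑ j, d m q j * f j) ∈ _
      exact Ideal.sum_mem _ fun j _ => Ideal.mul_mem_right _ _ (hd.mem_maximalIdeal m q j)
    · refine TensorProduct.ext' fun f a => ?_
      rw [LinearMap.comp_apply, LinearMap.lTensor_tmul, hv, LinearMap.zero_apply,
        hδ.exact_zero.apply_apply_eq_zero, map_zero, smul_zero]
    · rw [hv, he₀, hw1]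
      by_cases h : q' = q
      · subst h
        simp
      · rw [Pi.single_eq_of_ne' h, zero_smul, Pi.single_eq_of_ne h]
  -- transport to the other edge of the double complex
  obtain ⟨Y, hY, hY'⟩ : ∃ Y : Fin (b m) → F 0 ⊗[R] G m,
      (∀ i, ∀ x ∈ IsLocalRing.maximalIdeal R, ∀ r : F 0 ⊗[R] G m →ₗ[R] M,
        r ∘ₗ (d' 0).rTensor _ = 0 → r ∘ₗ (δ' m).lTensor _ = 0 → x • r (Y i) = 0) ∧
      ∀ q, ∃ r : F 0 ⊗[R] G m →ₗ[R] M, r ∘ₗ (d' 0).rTensor _ = 0 ∧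
          r ∘ₗ (δ' m).lTensor _ = 0 ∧ ∀ i, r (Y i) = Pi.single (M := fun _ => M) q u i := by
    obtain _ | l := m
    · refine ⟨y, fun i x hx r hr hr' => ?_, hv⟩
      obtain ⟨z, hz⟩ := (hδ.exact_zero (x • e₀)).1 (by rw [map_smul, hk x hx])
      have := LinearMap.congr_fun hr' (Pi.single i 1 ⊗ₜ z)
      rw [LinearMap.comp_apply, LinearMap.lTensor_tmul, LinearMap.zero_apply] at this
      rw [← map_smul, ← TensorProduct.tmul_smul, ← hz]
      exact this
    · have hex : ∀ q, ∃ y' : F l ⊗[R] G 1, (d' l).rTensor _ (y q) = (δ' 0).lTensor _ y' := by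
        intro q
        obtain ⟨y', h⟩ := (Module.Flat.lTensor_exact (F l) hδ.exact_zero
          ((d' l).rTensor _ (y q))).1 (by
          rw [LinearMap.rTensor_tmul, LinearMap.lTensor_tmul, he₀]
          have h1 : d' l (Pi.single q 1) = ∑ i, d l i q • (Pi.single i 1 : F l) := by
            ext j
            change ((d l).mulVec (Pi.single q 1)) j = _
            simp [Finset.sum_apply, Pi.single_apply]
          rw [h1, TensorProduct.sum_tmul]
          refine Finset.sum_eq_zero fun i _ => ?_
          rw [TensorProduct.smul_tmul, hk _ (hd.mem_maximalIdeal l i q), TensorProduct.tmul_zero])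
        exact ⟨y', h.symm⟩
      choose y' hy' using hex
      obtain ⟨Y, hY, hY'⟩ := exists_staircase (M := M) (F := F) (G := G) (δ := δ') hδ.exact
        hδ.exact_zero hk (d := d') hdd he.exists_extension (s := l + 1) l 0 (by omega) y y' hy'
      refine ⟨Y, hY, fun q => ?_⟩
      obtain ⟨v, h1, h2, h3⟩ := hv q
      obtain ⟨r, h4, h5, h6⟩ := hY' v h1 h2
      exact ⟨r, h4, h5, fun i => (h6 i).symm.trans (h3 i)⟩
  -- parametrize the cocycles on the other edge
  let E : (R ⧸ I) →ₗ[R] (C →ₗ[R] M) :=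
    I.liftQ (LinearMap.toSpanSingleton R _ e) (fun x hx => (he.smul_eq_zero_iff x).2 hx)
  have hE : ∀ a : R, E (Submodule.Quotient.mk a) = a • e := fun a => rfl
  let J : (R ⧸ I) →ₗ[R] (F 0 →ₗ[R] M) := LinearMap.lcomp R M π ∘ₗ E
  have hJ : Function.Injective J := by
    rw [injective_iff_map_eq_zero]
    intro a ha
    obtain ⟨a, rfl⟩ := Submodule.Quotient.mk_surjective _ a
    have h1 : (a • e) ∘ₗ π = 0 ∘ₗ π := by
      rw [LinearMap.zero_comp]
      exact ha
    rw [Submodule.Quotient.mk_eq_zero, ← he.smul_eq_zero_iff]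
    exact (LinearMap.cancel_right hd.surjective).1 h1
  have hJ0 : ∀ a f, J a (d' 0 f) = 0 := by
    intro a f
    change E a (π ((d 0).mulVecLin f)) = 0
    rw [hd.exact_zero.apply_apply_eq_zero, map_zero]
  have hJ1 : ∀ w : F 0 →ₗ[R] M, w ∘ₗ d' 0 = 0 → ∃ a, J a = w := by
    intro w hw
    have hk : LinearMap.ker π ≤ LinearMap.ker w := by
      intro y hy
      obtain ⟨z, rfl⟩ := (hd.exact_zero y).1 hy
      exact LinearMap.congr_fun hw z
    obtain ⟨a, ha⟩ := he.exists_eq_smul ((LinearMap.ker π).liftQ w hk ∘ₗ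
      (π.quotKerEquivOfSurjective hd.surjective).symm.toLinearMap)
    refine ⟨Submodule.Quotient.mk a, LinearMap.ext fun f => ?_⟩
    change (a • e) (π f) = w f
    rw [← ha]
    have : (π.quotKerEquivOfSurjective hd.surjective).symm (π f) = Submodule.Quotient.mk f := by
      rw [LinearEquiv.symm_apply_eq]
      rfl
    simp [this]
  let S : (G m →ₗ[R] (R ⧸ I)) →ₗ[R] (F 0 ⊗[R] G m →ₗ[R] M) :=
    (TensorProduct.uncurry (RingHom.id R) (F 0) (G m) M) ∘ₗ
      (LinearMap.lflip (σ₁₂ := RingHom.id R)).toLinearMap ∘ₗ (LinearMap.llcomp R (G m) (R ⧸ I) (F 0 →ₗ[R] M) J)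
  have hS : ∀ φ f a, S φ (f ⊗ₜ a) = J (φ a) f := fun φ f a => rfl
  have hcoc : ∀ p, S (Ψ p) ∘ₗ (d' 0).rTensor _ = 0 ∧ S (Ψ p) ∘ₗ (δ' m).lTensor _ = 0 := by
    intro p
    have h1 : Ψ p ∘ₗ δ' m = 0 := by
      have : Ψ p ∈ LinearMap.range Ψ := ⟨p, rfl⟩
      rw [hΨ] at this
      exact this
    constructor
    · refine TensorProduct.ext' fun f a => ?_
      rw [LinearMap.comp_apply, LinearMap.rTensor_tmul, hS, hJ0, LinearMap.zero_apply]
    · refine TensorProduct.ext' fun f a => ?_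
      rw [LinearMap.comp_apply, LinearMap.lTensor_tmul, hS]
      have h2 : Ψ p (δ' m a) = 0 := LinearMap.congr_fun h1 a
      rw [h2, map_zero, LinearMap.zero_apply, LinearMap.zero_apply]
  refine card_le_of_exists_apply_eq_single
    (LinearMap.pi fun i => LinearMap.applyₗ (Y i) ∘ₗ S ∘ₗ Ψ) (fun x hx p => ?_) hu (fun q => ?_)
  · ext i
    exact hY i x hx _ (hcoc p).1 (hcoc p).2
  · obtain ⟨r, h1, h2, h3⟩ := hY' q
    obtain ⟨φ, hφ⟩ := exists_factorization_of_forall J (TensorProduct.curry r).flip (fun a =>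
      hJ1 _ (LinearMap.ext fun f => LinearMap.congr_fun h1 (f ⊗ₜ a)))
    have hSφ : S φ = r := TensorProduct.ext' fun f a => by
      rw [hS, ← LinearMap.comp_apply, hφ]
      rfl
    have hφδ : φ ∘ₗ δ' m = 0 := by
      refine LinearMap.ext fun a => hJ (LinearMap.ext fun f => ?_)
      have h4 : J ((φ ∘ₗ δ' m) a) = (TensorProduct.curry r).flip (δ' m a) :=
        LinearMap.congr_fun hφ (δ' m a)
      have h5 : J ((0 : G (m + 1) →ₗ[R] R ⧸ I) a) = 0 := map_zero J
      rw [h4, h5]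
      exact LinearMap.congr_fun h2 (f ⊗ₜ a)
    have hmem : φ ∈ LinearMap.range Ψ := by
      rw [hΨ]
      exact hφδ
    obtain ⟨p, rfl⟩ := hmem
    refine ⟨p, funext fun i => ?_⟩
    rw [← h3 i, ← hSφ]
    rfl

/-- The Betti numbers of semidualizing modules are bounded. -/
lemma exists_betti_bound [IsNoetherianRing R] (m : ℕ) : ∃ N : ℕ, ∀ (C : Type) [AddCommGroup C]
    [Module R C] (_ : IsSemidualizing R C) (b : ℕ → ℕ)
    (d : ∀ l, Matrix (Fin (b l)) (Fin (b (l + 1))) R) (π : (Fin (b 0) → R) →ₗ[R] C)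
    (_ : IsMinimalResolution b d π), b m ≤ N := by
  obtain ⟨I, r₀, hI, hr₀, hr₀'⟩ := exists_maximal_isRegularIdeal (R := R)
  obtain ⟨bk, δ, ε, hδ⟩ := exists_isMinimalResolution (R := R) (R ⧸ IsLocalRing.maximalIdeal R)
  obtain ⟨g, Ψ, hΨ⟩ := Module.Finite.exists_fin' R
    (LinearMap.ker (LinearMap.lcomp R (R ⧸ I) (δ m).mulVecLin))
  refine ⟨g, fun C _ _ hC b d π hd => ?_⟩
  have := hC.1
  obtain ⟨M, _, _, _, e, he⟩ := exists_isCyclicHom (F := fun l => Fin (b l) → R)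
    (d := fun l => (d l).mulVecLin) hC.2.1 (fun l => (hd.exact l).linearMap_comp_eq_zero)
    hd.surjective hd.exact_zero (fun l φ hφ => hC.exists_extension hd φ hφ) hI
  refine betti_le_of_isCyclicHom hd he hr₀ hr₀' hδ ((Submodule.subtype _) ∘ₗ Ψ) ?_
  rw [LinearMap.range_comp, LinearMap.range_eq_top.2 hΨ, Submodule.map_top, Submodule.range_subtype]

end BettiBound

section Koszul

/-- The index set of the standard basis of a Koszul complex on `n` elements. -/
def KoszulIndex : ℕ → Type
  | 0 => Unit
  | n + 1 => KoszulIndex n ⊕ KoszulIndex n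

namespace KoszulIndex

/-- Left summand. -/
def inl {n : ℕ} (s : KoszulIndex n) : KoszulIndex (n + 1) := Sum.inl s

/-- Right summand. -/
def inr {n : ℕ} (s : KoszulIndex n) : KoszulIndex (n + 1) := Sum.inr s

instance instFinite : ∀ n, Finite (KoszulIndex n)
  | 0 => inferInstanceAs (Finite Unit)
  | n + 1 => by
    have := instFinite n
    exact inferInstanceAs (Finite (KoszulIndex n ⊕ KoszulIndex n))

/-- The homological degree of a basis element. -/
def deg : ∀ {n : ℕ}, KoszulIndex n → ℕ
  | 0, _ => 0
  | _ + 1, s => Sum.elim (fun s => deg s) (fun s => deg s + 1) s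

/-- The basis element of degree zero. -/
def empty : ∀ n : ℕ, KoszulIndex n
  | 0 => ()
  | n + 1 => inl (empty n)

@[simp] lemma deg_inl {n : ℕ} (s : KoszulIndex n) : deg (inl s) = deg s := rfl

@[simp] lemma deg_inr {n : ℕ} (s : KoszulIndex n) : deg (inr s) = deg s + 1 := rfl

@[simp] lemma deg_empty (n : ℕ) : deg (empty n) = 0 := by
  induction n with
  | zero => rfl
  | succ n ih => exact ih

lemma deg_le {n : ℕ} (s : KoszulIndex n) : deg s ≤ n := by
  induction n with
  | zero => exact le_rfl
  | succ n ih =>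
    obtain s | s := s
    · exact (ih s).trans n.le_succ
    · exact Nat.succ_le_succ (ih s)

lemma forall_succ {n : ℕ} {P : KoszulIndex (n + 1) → Prop} (h₁ : ∀ s, P (inl s))
    (h₂ : ∀ s, P (inr s)) (s : KoszulIndex (n + 1)) : P s :=
  Sum.rec h₁ h₂ s

end KoszulIndex

open KoszulIndex

variable {R : Type*} [CommRing R] {E : Type*} [AddCommGroup E] [Module R E]

/-- The pair `(a, b)` as an element of an iterated cone. -/
def koszulPair {n : ℕ} (a b : KoszulIndex n → E) : KoszulIndex (n + 1) → E := Sum.elim a b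

/-- The differential of the tensor product of `(E, D)` with the Koszul complex. -/
def koszulD (x : ℕ → R) (D : E →ₗ[R] E) : ∀ n, (KoszulIndex n → E) →ₗ[R] (KoszulIndex n → E)
  | 0 => D.compLeft _
  | n + 1 =>
    { toFun f := koszulPair (koszulD x D n (fun s => f (inl s)) + x n • fun s => f (inr s))
        (-(koszulD x D n fun s => f (inr s)))
      map_add' f g := funext <| forall_succ
        (fun s => by
          change koszulD x D n ((fun s => f (inl s)) + fun s => g (inl s)) s +
            x n • (f (inr s) + g (inr s)) = (koszulD x D n (fun s => f (inl s)) s +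
            x n • f (inr s)) + (koszulD x D n (fun s => g (inl s)) s + x n • g (inr s))
          rw [map_add, Pi.add_apply, smul_add]
          abel)
        (fun s => by
          change - koszulD x D n ((fun s => f (inr s)) + fun s => g (inr s)) s =
            - koszulD x D n (fun s => f (inr s)) s + - koszulD x D n (fun s => g (inr s)) s
          rw [map_add, Pi.add_apply, neg_add])
      map_smul' c f := funext <| forall_succ
        (fun s => by
          change koszulD x D n (c • fun s => f (inl s)) s + x n • c • f (inr s) =
            c • (koszulD x D n (fun s => f (inl s)) s + x n • f (inr s))
          rw [map_smul, Pi.smul_apply, smul_add, smul_comm (x n) c])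
        (fun s => by
          change - koszulD x D n (c • fun s => f (inr s)) s =
            c • - koszulD x D n (fun s => f (inr s)) s
          rw [map_smul, Pi.smul_apply, smul_neg]) }

lemma koszulD_zero_apply (x : ℕ → R) (D : E →ₗ[R] E) (f : KoszulIndex 0 → E) (s) :
    koszulD x D 0 f s = D (f s) := rfl

lemma koszulD_pair (x : ℕ → R) (D : E →ₗ[R] E) {n : ℕ} (a b : KoszulIndex n → E) :
    koszulD x D (n + 1) (koszulPair a b) =
      koszulPair (koszulD x D n a + x n • b) (-(koszulD x D n b)) := rfl

lemma koszulPair_eta {n : ℕ} (f : KoszulIndex (n + 1) → E) :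
    koszulPair (fun s => f (inl s)) (fun s => f (inr s)) = f :=
  funext (forall_succ (fun _ => rfl) fun _ => rfl)

lemma exists_eq_koszulPair {n : ℕ} (f : KoszulIndex (n + 1) → E) :
    ∃ a b, f = koszulPair a b := ⟨_, _, (koszulPair_eta f).symm⟩

lemma koszulPair_inj {n : ℕ} {a b a' b' : KoszulIndex n → E} :
    koszulPair a b = koszulPair a' b' ↔ a = a' ∧ b = b' :=
  ⟨fun h => ⟨funext fun s => congrFun h (inl s), funext fun s => congrFun h (inr s)⟩,
    fun h => by rw [h.1, h.2]⟩

lemma koszulPair_zero {n : ℕ} : koszulPair (0 : KoszulIndex n → E) 0 = 0 :=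
  funext (forall_succ (fun _ => rfl) fun _ => rfl)

lemma koszulPair_eq_zero {n : ℕ} {a b : KoszulIndex n → E} :
    koszulPair a b = 0 ↔ a = 0 ∧ b = 0 := by
  rw [← koszulPair_zero, koszulPair_inj]

lemma koszulPair_add {n : ℕ} (a b a' b' : KoszulIndex n → E) :
    koszulPair a b + koszulPair a' b' = koszulPair (a + a') (b + b') :=
  funext (forall_succ (fun _ => rfl) fun _ => rfl)

lemma koszulD_koszulD (x : ℕ → R) {D : E →ₗ[R] E} (hD : ∀ e, D (D e) = 0) {n : ℕ}
    (f : KoszulIndex n → E) : koszulD x D n (koszulD x D n f) = 0 := by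
  induction n with
  | zero => exact funext fun s => hD (f s)
  | succ n ih =>
    obtain ⟨a, b, rfl⟩ := exists_eq_koszulPair f
    rw [koszulD_pair, koszulD_pair, koszulPair_eq_zero]
    simp [ih]

lemma koszulD_eq_add (x : ℕ → R) (D : E →ₗ[R] E) {n : ℕ} (f : KoszulIndex n → E)
    (s : KoszulIndex n) :
    koszulD x D n f s = koszulD x 0 n f s + (-1 : R) ^ deg s • D (f s) := by
  induction n with
  | zero =>
    change D (f s) = 0 + (-1 : R) ^ 0 • D (f s)
    simp
  | succ n ih =>
    obtain ⟨a, b, rfl⟩ := exists_eq_koszulPair f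
    rw [koszulD_pair, koszulD_pair]
    revert s
    refine forall_succ (fun s => ?_) (fun s => ?_)
    · change koszulD x D n a s + x n • b s = koszulD x 0 n a s + x n • b s +
        (-1 : R) ^ deg s • D (a s)
      rw [ih]
      abel
    · change - koszulD x D n b s = - koszulD x 0 n b s + (-1 : R) ^ (deg s + 1) • D (b s)
      rw [ih, pow_succ]
      simp
      abel

/-- Multiplication by the elements defining a Koszul complex is homotopic to zero. -/
lemma exists_koszul_homotopy (x : ℕ → R) {n l : ℕ} (hl : l < n) :
    ∃ h : (KoszulIndex n → E) →ₗ[R] (KoszulIndex n → E),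
      ∀ f, koszulD x 0 n (h f) + h (koszulD x 0 n f) = x l • f := by
  induction n with
  | zero => omega
  | succ n ih =>
    let L : (KoszulIndex (n + 1) → E) →ₗ[R] (KoszulIndex n → E) := LinearMap.funLeft R E inl
    let U : (KoszulIndex (n + 1) → E) →ₗ[R] (KoszulIndex n → E) := LinearMap.funLeft R E inr
    let P : ((KoszulIndex n → E) × (KoszulIndex n → E)) →ₗ[R] (KoszulIndex (n + 1) → E) :=
      { toFun p := koszulPair p.1 p.2
        map_add' p q := (koszulPair_add _ _ _ _).symm
        map_smul' c p := funext (forall_succ (fun _ => rfl) fun _ => rfl) }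
    have hsmul : ∀ (c : R) (a b : KoszulIndex n → E), c • koszulPair a b =
      koszulPair (c • a) (c • b) := fun c a b => (map_smul P c (a, b)).symm
    obtain rfl | hne := eq_or_ne l n
    · refine ⟨P ∘ₗ LinearMap.prod 0 L, fun f => ?_⟩
      obtain ⟨a, b, rfl⟩ := exists_eq_koszulPair f
      rw [koszulD_pair]
      change koszulD x 0 (l + 1) (koszulPair 0 a) +
        koszulPair 0 (koszulD x 0 l a + x l • b) = _
      rw [koszulD_pair, koszulPair_add, hsmul, koszulPair_inj]
      simp
    · obtain ⟨h, hh⟩ := ih (by omega)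
      refine ⟨P ∘ₗ LinearMap.prod (h ∘ₗ L) (- h ∘ₗ U), fun f => ?_⟩
      obtain ⟨a, b, rfl⟩ := exists_eq_koszulPair f
      rw [koszulD_pair]
      change koszulD x 0 (n + 1) (koszulPair (h a) (- h b)) +
        koszulPair (h (koszulD x 0 n a + x n • b)) (- h (- koszulD x 0 n b)) = _
      rw [koszulD_pair, koszulPair_add, hsmul, koszulPair_inj]
      simp only [map_neg, neg_neg, map_add, map_smul, hh, and_true]
      rw [← hh a]
      simp only [smul_neg]
      abel

/-- The projection to the component of homological degree `k`. -/
noncomputable def koszulProj (R : Type*) [CommRing R] [Module R E] (n k : ℕ) :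
    (KoszulIndex n → E) →ₗ[R] (KoszulIndex n → E) :=
  LinearMap.pi fun s => if deg s = k then LinearMap.proj s else 0

lemma koszulProj_apply (n k : ℕ) (f : KoszulIndex n → E) (s : KoszulIndex n) :
    koszulProj R n k f s = if deg s = k then f s else 0 := by
  simp only [koszulProj, LinearMap.pi_apply]
  split_ifs <;> rfl

lemma koszulProj_pair_succ (n k : ℕ) (a b : KoszulIndex n → E) :
    koszulProj R (n + 1) (k + 1) (koszulPair a b) =
      koszulPair (koszulProj R n (k + 1) a) (koszulProj R n k b) :=
  funext (forall_succ (fun s => by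
    change _ = koszulProj R n (k + 1) a s
    rw [koszulProj_apply, koszulProj_apply]; rfl) fun s => by
    change _ = koszulProj R n k b s
    rw [koszulProj_apply, koszulProj_apply, deg_inr]
    simp only [add_left_inj]
    rfl)

lemma koszulProj_pair_zero (n : ℕ) (a b : KoszulIndex n → E) :
    koszulProj R (n + 1) 0 (koszulPair a b) = koszulPair (koszulProj R n 0 a) 0 :=
  funext (forall_succ (fun s => by
    change _ = koszulProj R n 0 a s
    rw [koszulProj_apply, koszulProj_apply]; rfl) fun s => by
    change _ = 0
    rw [koszulProj_apply, deg_inr, if_neg (Nat.succ_ne_zero _)])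

lemma koszulD_koszulProj_zero (x : ℕ → R) {n : ℕ} (f : KoszulIndex n → E) :
    koszulD x 0 n (koszulProj R n 0 f) = 0 := by
  induction n with
  | zero => rfl
  | succ n ih =>
    obtain ⟨a, b, rfl⟩ := exists_eq_koszulPair f
    rw [koszulProj_pair_zero, koszulD_pair, koszulPair_eq_zero, ih]
    simp

lemma koszulD_koszulProj_succ (x : ℕ → R) {n : ℕ} (k : ℕ) (f : KoszulIndex n → E) :
    koszulD x 0 n (koszulProj R n (k + 1) f) = koszulProj R n k (koszulD x 0 n f) := by
  induction n generalizing k with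
  | zero =>
    ext s
    rw [koszulProj_apply]
    simp [koszulD_zero_apply]
  | succ n ih =>
    obtain ⟨a, b, rfl⟩ := exists_eq_koszulPair f
    rw [koszulProj_pair_succ, koszulD_pair, koszulD_pair]
    obtain _ | k := k
    · rw [koszulProj_pair_zero, koszulPair_inj, ih, koszulD_koszulProj_zero]
      simp
    · rw [koszulProj_pair_succ, koszulPair_inj, ih, ih]
      simp

end Koszul

section KoszulFiltration

open KoszulIndex

variable {R : Type*} [CommRing R] {E : Type*} [AddCommGroup E] [Module R E]

lemma mem_smul_top_pi {ι : Type*} [Finite ι] {J : Ideal R} {f : ι → E} :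
    f ∈ (J • ⊤ : Submodule R (ι → E)) ↔ ∀ i, f i ∈ (J • ⊤ : Submodule R E) := by
  classical
  cases nonempty_fintype ι
  constructor
  · intro hf i
    have h := Submodule.mem_map_of_mem (f := LinearMap.proj i) hf
    rw [Submodule.map_smul''] at h
    exact Submodule.smul_mono le_rfl le_top h
  · intro hf
    rw [← Finset.univ_sum_single f]
    refine sum_mem fun i _ => ?_
    have h := Submodule.mem_map_of_mem (f := LinearMap.single R (fun _ => E) i) (hf i)
    rw [Submodule.map_smul''] at h
    exact Submodule.smul_mono le_rfl le_top h

lemma map_mem_smul_top {M M' : Type*} [AddCommGroup M] [Module R M] [AddCommGroup M'] [Module R M']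
    (A : M →ₗ[R] M') {J : Ideal R} {f : M} (hf : f ∈ (J • ⊤ : Submodule R M)) :
    A f ∈ (J • ⊤ : Submodule R M') := by
  have h := Submodule.mem_map_of_mem (f := A) hf
  rw [Submodule.map_smul''] at h
  exact Submodule.smul_mono le_rfl le_top h

lemma exists_koszul_primitive [IsNoetherianRing R] [Module.Finite R E] (x : ℕ → R) (n : ℕ)
    {J : Ideal R} (hJ : J = Ideal.span (x '' Set.Iio n)) :
    ∃ c, ∀ M, c ≤ M → ∀ f ∈ (J ^ (M + 1) • ⊤ : Submodule R (KoszulIndex n → E)),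
      koszulD x 0 n f = 0 →
      ∃ y ∈ (J ^ M • ⊤ : Submodule R (KoszulIndex n → E)), koszulD x 0 n y = f := by
  obtain ⟨c, hc⟩ := J.exists_pow_inf_eq_pow_smul
    (LinearMap.ker (koszulD x (0 : E →ₗ[R] E) n))
  refine ⟨c, fun M hM f hf hf0 => ?_⟩
  set Z := LinearMap.ker (koszulD x (0 : E →ₗ[R] E) n)
  have h1 : f ∈ (J ^ (M + 1) • ⊤ : Submodule R (KoszulIndex n → E)) ⊓ Z := ⟨hf, hf0⟩
  rw [hc (M + 1) (by omega), show M + 1 - c = (M - c) + 1 by omega, pow_succ', Submodule.mul_smul,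
    ← hc M hM] at h1
  have h2 : J • (J ^ M • ⊤ ⊓ Z) ≤ (J ^ M • ⊤ : Submodule R (KoszulIndex n → E)).map
      (koszulD x 0 n) := by
    rw [Submodule.smul_le]
    intro r hr s hs
    have h3 : J ≤ ((J ^ M • ⊤ : Submodule R (KoszulIndex n → E)).map
        (koszulD x 0 n)).comap (LinearMap.toSpanSingleton R _ s) := by
      conv_lhs => rw [hJ]
      rw [Ideal.span_le]
      rintro _ ⟨l, hl, rfl⟩
      obtain ⟨h, hh⟩ := exists_koszul_homotopy (E := E) x hl
      refine ⟨h s, map_mem_smul_top h hs.1, ?_⟩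
      have := hh s
      rw [show koszulD x 0 n s = 0 from hs.2, map_zero, add_zero] at this
      exact this
    exact h3 hr
  exact h2 h1

/-- The filtration of a Koszul complex compatible with the differential. -/
def koszulFil (E : Type*) [AddCommGroup E] [Module R E] (J : Ideal R) (n N : ℕ) :
    Submodule R (KoszulIndex n → E) where
  carrier := {f | ∀ s, f s ∈ (J ^ (N - deg s) • ⊤ : Submodule R E)}
  add_mem' hf hg s := add_mem (hf s) (hg s)
  zero_mem' _ := zero_mem _
  smul_mem' c _ hf s := Submodule.smul_mem _ c (hf s)

lemma koszulPair_mem_koszulFil {J : Ideal R} {n N : ℕ} {a b : KoszulIndex n → E} :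
    koszulPair a b ∈ koszulFil E J (n + 1) N ↔ a ∈ koszulFil E J n N ∧
      b ∈ koszulFil E J n (N - 1) := by
  refine ⟨fun h => ⟨fun s => h (inl s), fun s => ?_⟩, fun h => forall_succ h.1 fun s => ?_⟩
  · have := h (inr s)
    rw [deg_inr] at this
    rwa [Nat.sub_sub, add_comm]
  · have := h.2 s
    rw [deg_inr]
    rwa [Nat.sub_sub, add_comm] at this

lemma koszulD_mem_koszulFil {x : ℕ → R} {J : Ideal R} {n : ℕ} (hx : ∀ l < n, x l ∈ J)
    (D : E →ₗ[R] E) {N : ℕ} {f : KoszulIndex n → E} (hf : f ∈ koszulFil E J n N) :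
    koszulD x D n f ∈ koszulFil E J n N := by
  induction n generalizing N with
  | zero => exact fun s => map_mem_smul_top D (hf s)
  | succ n ih =>
    obtain ⟨a, b, rfl⟩ := exists_eq_koszulPair f
    rw [koszulPair_mem_koszulFil] at hf
    rw [koszulD_pair, koszulPair_mem_koszulFil]
    refine ⟨add_mem (ih (fun l hl => hx l (by omega)) hf.1) fun s => ?_,
      neg_mem (ih (fun l hl => hx l (by omega)) hf.2)⟩
    have h1 : x n • b s ∈ (J • J ^ (N - 1 - deg s) • ⊤ : Submodule R E) :=
      Submodule.smul_mem_smul (hx n (by omega)) (hf.2 s)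
    rw [← Submodule.mul_smul, ← pow_succ'] at h1
    exact Submodule.smul_mono_left (Ideal.pow_le_pow_right (by omega)) h1

lemma exists_primitive_mem_koszulFil [IsNoetherianRing R] [Module.Finite R E] (x : ℕ → R) (n : ℕ)
    {J : Ideal R} (hJ : J = Ideal.span (x '' Set.Iio n)) :
    ∃ N₀, ∀ N, N₀ ≤ N → ∀ D : E →ₗ[R] E, (∀ e, D (D e) = 0) → ∀ f ∈ koszulFil E J n N,
      koszulD x D n f = 0 → ∃ g ∈ koszulFil E J n N, koszulD x D n g = f := by
  obtain ⟨c, hc⟩ := exists_koszul_primitive (E := E) x n hJ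
  refine ⟨c + n + 1, fun N hN D hD => ?_⟩
  have hx : ∀ l < n, x l ∈ J := fun l hl => hJ ▸ Ideal.subset_span ⟨l, hl, rfl⟩
  have key : ∀ j k, j + k = n + 1 → ∀ f ∈ koszulFil E J n N, koszulD x D n f = 0 →
      (∀ s, deg s < k → f s = 0) → ∃ g ∈ koszulFil E J n N, koszulD x D n g = f := by
    intro j
    induction j with
    | zero =>
      intro k hk f _ _ hf
      refine ⟨0, zero_mem _, ?_⟩
      rw [map_zero]
      exact funext fun s => (hf s (by have := deg_le s; omega)).symm
    | succ j ih =>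
      intro k hk f hf hDf hfk
      have h1 : koszulD x 0 n (koszulProj R n k f) = 0 := by
        obtain _ | k := k
        · exact koszulD_koszulProj_zero x f
        · rw [koszulD_koszulProj_succ]
          ext s
          rw [koszulProj_apply]
          split_ifs with hs
          · have h2 := koszulD_eq_add x D f s
            rw [hDf, hfk s (by omega), map_zero, smul_zero, add_zero] at h2
            exact h2.symm
          · rfl
      have h2 : koszulProj R n k f ∈ (J ^ (N - k - 1 + 1) • ⊤ : Submodule R (KoszulIndex n → E)) := by
        rw [mem_smul_top_pi]
        intro s
        rw [koszulProj_apply]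
        split_ifs with hs
        · have h3 := hf s
          rwa [hs, show N - k = N - k - 1 + 1 by omega] at h3
        · exact zero_mem _
      obtain ⟨y, hy, hy'⟩ := hc (N - k - 1) (by omega) _ h2 h1
      set g := koszulProj R n (k + 1) y with hg
      have hg0 : koszulD x 0 n g = koszulProj R n k f := by
        rw [hg, koszulD_koszulProj_succ, hy']
        ext s
        simp only [koszulProj_apply]
        split_ifs <;> rfl
      have hgF : g ∈ koszulFil E J n N := by
        intro s
        rw [hg, koszulProj_apply]
        split_ifs with hs
        · rw [hs, show N - (k + 1) = N - k - 1 by omega]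
          exact mem_smul_top_pi.1 hy s
        · exact zero_mem _
      obtain ⟨g', hg', hg''⟩ := ih (k + 1) (by omega) (f - koszulD x D n g)
        (sub_mem hf (koszulD_mem_koszulFil hx D hgF))
        (by rw [map_sub, hDf, koszulD_koszulD x hD, sub_zero]) (fun s hs => by
          rw [Pi.sub_apply, koszulD_eq_add, hg0, koszulProj_apply, hg, koszulProj_apply,
            if_neg (by omega : ¬ deg s = k + 1), map_zero, smul_zero, add_zero]
          split_ifs with hsk
          · exact sub_self _
          · rw [hfk s (by omega), sub_zero])
      refine ⟨g' + g, add_mem hg' hgF, ?_⟩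
      rw [map_add, hg'', sub_add_cancel]
  intro f hf hDf
  exact key (n + 1) 0 rfl f hf hDf (fun s hs => absurd hs (Nat.not_lt_zero _))

end KoszulFiltration

section KoszulDegree

open KoszulIndex

variable {R : Type*} [CommRing R] {E : Type*} [AddCommGroup E] [Module R E]

/-- The projection of a Koszul complex to the component of total degree `l`, in terms of the
projections of the coefficients to their homogeneous components. -/
def koszulTot (pr : ℕ → E →ₗ[R] E) (n l : ℕ) :
    (KoszulIndex n → E) →ₗ[R] (KoszulIndex n → E) :=
  LinearMap.pi fun s => pr (l + deg s) ∘ₗ LinearMap.proj s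

lemma koszulTot_apply (pr : ℕ → E →ₗ[R] E) (n l : ℕ) (f : KoszulIndex n → E) (s) :
    koszulTot pr n l f s = pr (l + deg s) (f s) := rfl

lemma koszulTot_pair (pr : ℕ → E →ₗ[R] E) (n l : ℕ) (a b : KoszulIndex n → E) :
    koszulTot pr (n + 1) l (koszulPair a b) =
      koszulPair (koszulTot pr n l a) (koszulTot pr n (l + 1) b) :=
  funext <| forall_succ (fun _ => rfl) fun s => by
    change pr (l + (deg s + 1)) (b s) = pr (l + 1 + deg s) (b s)
    rw [add_assoc, add_comm 1]

lemma koszulTot_koszulTot {pr : ℕ → E →ₗ[R] E} (hpr : ∀ l e, pr l (pr l e) = pr l e) (n l : ℕ)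
    (f : KoszulIndex n → E) : koszulTot pr n l (koszulTot pr n l f) = koszulTot pr n l f :=
  funext fun _ => hpr _ _

lemma koszulD_koszulTot (x : ℕ → R) {pr : ℕ → E →ₗ[R] E} {D : E →ₗ[R] E}
    (hD : ∀ l e, D (pr l e) = pr (l + 1) (D e)) (n l : ℕ) (f : KoszulIndex n → E) :
    koszulD x D n (koszulTot pr n l f) = koszulTot pr n (l + 1) (koszulD x D n f) := by
  induction n generalizing l with
  | zero => exact funext fun s => hD _ _
  | succ n ih =>
    obtain ⟨a, b, rfl⟩ := exists_eq_koszulPair f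
    rw [koszulTot_pair, koszulD_pair, koszulD_pair, koszulTot_pair, ih, ih, map_add, map_neg,
      map_smul]

lemma koszulTot_mem_koszulFil (pr : ℕ → E →ₗ[R] E) {J : Ideal R} {n N : ℕ} (l : ℕ)
    {f : KoszulIndex n → E} (hf : f ∈ koszulFil E J n N) :
    koszulTot pr n l f ∈ koszulFil E J n N :=
  fun s => map_mem_smul_top _ (hf s)

lemma exists_koszul_preimage (x : ℕ → R) {pr : ℕ → E →ₗ[R] E} {D : E →ₗ[R] E}
    (n L : ℕ)
    (H : ∀ l, l < n + L → ∀ e, pr (l + 1) e = e → D e = 0 → ∃ g, pr l g = g ∧ D g = e)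
    (l : ℕ) (hl : l < L) (f : KoszulIndex n → E) (hf : koszulTot pr n (l + 1) f = f)
    (hDf : koszulD x D n f = 0) : ∃ g, koszulTot pr n l g = g ∧ koszulD x D n g = f := by
  induction n generalizing l L with
  | zero =>
    choose g hg hg' using fun s => H l (by omega) (f s) (congrFun hf s) (congrFun hDf s)
    exact ⟨g, funext fun s => hg s, funext hg'⟩
  | succ n ih =>
    obtain ⟨a, b, rfl⟩ := exists_eq_koszulPair f
    rw [koszulTot_pair, koszulPair_inj] at hf
    rw [koszulD_pair, koszulPair_eq_zero, neg_eq_zero] at hDf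
    obtain ⟨β, hβ, hβb⟩ := ih (L + 1) (fun l hl => H l (by omega)) (l + 1) (by omega) b hf.2 hDf.2
    obtain ⟨α, hα, hαa⟩ := ih (L + 1) (fun l hl => H l (by omega)) l (by omega) (a + x n • β)
      (by rw [map_add, map_smul, hf.1, hβ]) (by rw [map_add, map_smul, hβb, hDf.1])
    refine ⟨koszulPair α (-β), ?_, ?_⟩
    · rw [koszulTot_pair, hα, map_neg, hβ]
    · rw [koszulD_pair, hαa, map_neg, hβb, neg_neg, smul_neg, add_neg_cancel_right]

lemma koszul_preimage_of_succ [IsNoetherianRing R] [IsLocalRing R] [Module.Finite R E]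
    {x : ℕ → R} {pr : ℕ → E →ₗ[R] E} {D : E →ₗ[R] E}
    (hpr : ∀ l e, pr l (pr l e) = pr l e) (hD : ∀ l e, D (pr l e) = pr (l + 1) (D e)) {n : ℕ}
    (hx : x n ∈ IsLocalRing.maximalIdeal R)
    (H : ∀ f, koszulTot pr (n + 1) 1 f = f → koszulD x D (n + 1) f = 0 →
      ∃ g, koszulD x D (n + 1) g = f)
    (f : KoszulIndex n → E) (hf : koszulTot pr n 1 f = f)
    (hDf : koszulD x D n f = 0) : ∃ g, koszulD x D n g = f := by
  let Z : Submodule R (KoszulIndex n → E) :=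
    LinearMap.ker (koszulD x D n) ⊓ LinearMap.ker (koszulTot pr n 1 - LinearMap.id)
  have hmem : ∀ f, f ∈ Z ↔ koszulD x D n f = 0 ∧ koszulTot pr n 1 f = f := fun f => by
    rw [← sub_eq_zero (b := f)]
    rfl
  have hle : Z ≤ LinearMap.range (koszulD x D n) := by
    refine Submodule.le_of_le_smul_of_le_jacobson_bot (I := IsLocalRing.maximalIdeal R)
      (IsNoetherian.noetherian Z) (IsLocalRing.maximalIdeal_le_jacobson _) ?_
    intro a ha
    rw [hmem] at ha
    obtain ⟨g, hg⟩ := H (koszulPair a 0)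
      (by rw [koszulTot_pair, ha.2, map_zero])
      (by rw [koszulD_pair, ha.1, map_zero, smul_zero, add_zero, neg_zero, koszulPair_zero])
    obtain ⟨α, β, rfl⟩ := exists_eq_koszulPair g
    rw [koszulD_pair, koszulPair_inj, neg_eq_zero] at hg
    have h1 : a = koszulD x D n (koszulTot pr n 0 α) + x n • koszulTot pr n 1 β := by
      rw [koszulD_koszulTot x hD, ← map_smul, ← map_add, hg.1, ha.2]
    rw [h1]
    refine Submodule.add_mem_sup ⟨_, rfl⟩ (Submodule.smul_mem_smul hx ((hmem _).2 ⟨?_, ?_⟩))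
    · rw [koszulD_koszulTot x hD, hg.2, map_zero]
    · exact koszulTot_koszulTot hpr _ _ _
  exact hle ((hmem f).2 ⟨hDf, hf⟩)

lemma exists_koszul_cycle [IsLocalRing R]
    {x : ℕ → R} {pr : ℕ → E →ₗ[R] E} {D : E →ₗ[R] E}
    (hpr : ∀ l e, pr l (pr l e) = pr l e) (hD : ∀ l e, D (pr l e) = pr (l + 1) (D e)) {n : ℕ}
    (hx : ∀ l < n, x l ∈ IsLocalRing.maximalIdeal R)
    (H : ∀ k < n, ∀ f, koszulTot pr k 1 f = f → koszulD x D k f = 0 → ∃ g, koszulD x D k g = f)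
    (z : KoszulIndex n → E) (hz : koszulTot pr n 0 z = z) (hDz : koszulD x D n z = 0) :
    ∃ g, pr 0 g = g ∧ D g = 0 ∧ g - z (empty n) ∈ (IsLocalRing.maximalIdeal R • ⊤ : Submodule R E) := by
  induction n with
  | zero =>
    refine ⟨z (empty 0), congrFun hz _, congrFun hDz _, ?_⟩
    rw [sub_self]
    exact zero_mem _
  | succ n ih =>
    obtain ⟨a, b, rfl⟩ := exists_eq_koszulPair z
    rw [koszulTot_pair, koszulPair_inj] at hz
    rw [koszulD_pair, koszulPair_eq_zero, neg_eq_zero] at hDz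
    obtain ⟨w, hw⟩ := H n (by omega) b hz.2 hDz.2
    obtain ⟨g, hg, hDg, hga⟩ := ih (fun l hl => hx l (by omega)) (fun k hk => H k (by omega))
      (a + x n • koszulTot pr n 0 w)
      (by rw [map_add, map_smul, hz.1, koszulTot_koszulTot hpr])
      (by rw [map_add, map_smul, koszulD_koszulTot x hD, hw, hz.2, hDz.1])
    refine ⟨g, hg, hDg, ?_⟩
    have h1 : g - a (empty n) = (g - (a + x n • koszulTot pr n 0 w) (empty n)) +
        x n • koszulTot pr n 0 w (empty n) := by
      rw [Pi.add_apply, Pi.smul_apply]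
      abel
    change g - a (empty n) ∈ _
    rw [h1]
    exact add_mem hga (Submodule.smul_mem_smul (hx n (by omega)) trivial)

/-- For every differential, the quotient of the Koszul complex by its filtration detects
exactness in degree one, and degree zero cycles of the quotient lift approximately. -/
theorem exists_koszul_approximation [IsNoetherianRing R] [IsLocalRing R] [Module.Finite R E]
    {x : ℕ → R} {n : ℕ} (hx : ∀ l < n, x l ∈ IsLocalRing.maximalIdeal R) {J : Ideal R}
    (hJ : J = Ideal.span (x '' Set.Iio n))
    {pr : ℕ → E →ₗ[R] E} (hpr : ∀ l e, pr l (pr l e) = pr l e) :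
    ∃ N, ∀ D : E →ₗ[R] E, (∀ e, D (D e) = 0) → (∀ l e, D (pr l e) = pr (l + 1) (D e)) →
      ((∀ l, l < n + 1 → ∀ e, pr (l + 1) e = e → D e = 0 → ∃ g, pr l g = g ∧ D g = e) →
        ∀ f, koszulTot pr n 1 f = f → koszulD x D n f ∈ koszulFil E J n (N + 1) →
          ∃ g, koszulTot pr n 0 g = g ∧ f - koszulD x D n g ∈ koszulFil E J n (N + 1)) ∧
      ((∀ f, koszulTot pr n 1 f = f → koszulD x D n f ∈ koszulFil E J n (N + 1) →
          ∃ g, koszulTot pr n 0 g = g ∧ f - koszulD x D n g ∈ koszulFil E J n (N + 1)) →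
        ∀ z, koszulTot pr n 0 z = z → koszulD x D n z ∈ koszulFil E J n (N + 1) →
          ∃ g, pr 0 g = g ∧ D g = 0 ∧
            g - z (empty n) ∈ (IsLocalRing.maximalIdeal R • ⊤ : Submodule R E)) := by
  obtain ⟨N, hN⟩ := exists_primitive_mem_koszulFil (E := E) x n hJ
  have hJm : J ≤ IsLocalRing.maximalIdeal R := by
    rw [hJ, Ideal.span_le]
    rintro _ ⟨l, hl, rfl⟩
    exact hx l hl
  refine ⟨N, fun D hDD hD => ⟨fun H f hf hDf => ?_, fun H z hz hDz => ?_⟩⟩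
  · obtain ⟨u, hu, hu'⟩ := hN (N + 1) (by omega) D hDD _ hDf (koszulD_koszulD x hDD f)
    obtain ⟨g, hg, hg'⟩ := exists_koszul_preimage x n 1 H 0 one_pos
      (f - koszulTot pr n 1 u) (by rw [map_sub, hf, koszulTot_koszulTot hpr])
      (by rw [map_sub, koszulD_koszulTot x hD, hu', ← koszulD_koszulTot x hD, hf, sub_self])
    refine ⟨g, hg, ?_⟩
    rw [hg', sub_sub_cancel]
    exact koszulTot_mem_koszulFil pr 1 hu
  · have H1 : ∀ k, ∀ l, n = l + k → ∀ f, koszulTot pr l 1 f = f → koszulD x D l f = 0 →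
        ∃ g, koszulD x D l g = f := by
      intro k
      induction k with
      | zero =>
        intro l hl f hf hDf
        obtain rfl : n = l := hl
        obtain ⟨g, -, hg⟩ := H f hf (by rw [hDf]; exact zero_mem _)
        obtain ⟨u, -, hu⟩ := hN (N + 1) (by omega) D hDD _ hg
          (by rw [map_sub, hDf, koszulD_koszulD x hDD, sub_zero])
        exact ⟨g + u, by rw [map_add, hu, add_sub_cancel]⟩
      | succ k ih =>
        intro l hl
        exact koszul_preimage_of_succ hpr hD (hx l (by omega)) (ih (l + 1) (by omega))
    obtain ⟨u, hu, hu'⟩ := hN (N + 1) (by omega) D hDD _ hDz (koszulD_koszulD x hDD z)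
    obtain ⟨g, hg, hDg, hgz⟩ := exists_koszul_cycle hpr hD hx
      (fun k hk => H1 (n - k) k (by omega)) (z - koszulTot pr n 0 u)
      (by rw [map_sub, hz, koszulTot_koszulTot hpr])
      (by rw [map_sub, koszulD_koszulTot x hD, hu', ← koszulD_koszulTot x hD, hz, sub_self])
    refine ⟨g, hg, hDg, ?_⟩
    have h1 := koszulTot_mem_koszulFil pr 0 hu (empty n)
    rw [deg_empty, Nat.sub_zero, pow_succ'] at h1
    have hJN : J * J ^ N ≤ IsLocalRing.maximalIdeal R := Ideal.mul_le_left.trans hJm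
    have h2 := Submodule.smul_mono_left (N := (⊤ : Submodule R E)) hJN h1
    have h3 := sub_mem hgz h2
    rwa [Pi.sub_apply, ← sub_add, add_sub_cancel_right] at h3

end KoszulDegree

section TruncatedResolution

open IsLocalRing Matrix

/-- A free resolution of `C` up to degree `T`, with graded basis indexed by `ε`, which computes
`Ext(C, C) = 0` in the range where it can. -/
structure IsTruncatedResolution {R : Type*} [CommRing R] {ε : Type*} [Fintype ε] (δ : ε → ℕ)
    (T : ℕ) {C : Type*} [AddCommGroup C] [Module R C] (d : Matrix ε ε R)
    (π : (ε → R) →ₗ[R] C) : Prop where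
  apply_eq_zero : ∀ p q, δ q ≠ δ p + 1 → d p q = 0
  mul_self : d * d = 0
  surjective : ∀ c, ∃ v, (∀ p, δ p ≠ 0 → v p = 0) ∧ π v = c
  map_congr : ∀ v w, (∀ p, δ p = 0 → v p = w p) → π v = π w
  map_mulVec : ∀ w, π (d *ᵥ w) = 0
  exact_zero : ∀ v, (∀ p, δ p ≠ 0 → v p = 0) → π v = 0 →
    ∃ w, (∀ p, δ p ≠ 1 → w p = 0) ∧ d *ᵥ w = v
  exact : ∀ a, a + 2 ≤ T → ∀ v, (∀ p, δ p ≠ a + 1 → v p = 0) → d *ᵥ v = 0 →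
    ∃ w, (∀ p, δ p ≠ a + 2 → w p = 0) ∧ d *ᵥ w = v
  exists_ext : ∀ l, l + 2 ≤ T → ∀ φ : ε → C, (∀ p, δ p ≠ l + 1 → φ p = 0) →
    (∀ q, ∑ p, d p q • φ p = 0) →
    ∃ ψ : ε → C, (∀ p, δ p ≠ l → ψ p = 0) ∧ ∀ q, δ q = l + 1 → φ q = ∑ p, d p q • ψ p

namespace SigmaBlock

variable {T : ℕ} {b : ℕ → ℕ} {M : Type*} [AddCommGroup M]

/-- Extension by zero of a family indexed by a block. -/
def extend (a : ℕ) (v : Fin (b a) → M) (p : (a : Fin (T + 1)) × Fin (b a)) : M :=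
  if h : (p.1 : ℕ) = a then v (Fin.cast (congrArg b h) p.2) else 0

lemma extend_apply {a : ℕ} (ha : a < T + 1) (v : Fin (b a) → M) (i : Fin (b a)) :
    extend a v (⟨⟨a, ha⟩, i⟩ : (a : Fin (T + 1)) × Fin (b a)) = v i := by
  simp [extend]

lemma extend_of_ne {a : ℕ} (v : Fin (b a) → M) (p : (a : Fin (T + 1)) × Fin (b a))
    (h : (p.1 : ℕ) ≠ a) : extend a v p = 0 := dif_neg h

lemma sum_eq {a : ℕ} (ha : a < T + 1) (f : ((a : Fin (T + 1)) × Fin (b a)) → M)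
    (h : ∀ p, (p.1 : ℕ) ≠ a → f p = 0) : ∑ p, f p = ∑ i, f ⟨⟨a, ha⟩, i⟩ := by
  rw [Fintype.sum_sigma]
  exact Finset.sum_eq_single _ (fun c _ hc => Finset.sum_eq_zero fun i _ => h _ fun h' =>
    hc (Fin.ext h')) fun h => absurd (Finset.mem_univ _) h

lemma eq_extend {a : ℕ} (ha : a < T + 1) {f : ((a : Fin (T + 1)) × Fin (b a)) → M}
    (h : ∀ p, (p.1 : ℕ) ≠ a → f p = 0) : f = extend a fun i => f ⟨⟨a, ha⟩, i⟩ := by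
  ext ⟨⟨c, hc⟩, i⟩
  obtain rfl | hne := eq_or_ne c a
  · rw [extend_apply]
  · rw [h _ hne, extend_of_ne _ _ hne]

end SigmaBlock

open SigmaBlock

variable {R : Type} [CommRing R]

/-- The total differential of a sequence of matrices. -/
def totalMatrix (T : ℕ) {b : ℕ → ℕ} (D : ∀ l, Matrix (Fin (b l)) (Fin (b (l + 1))) R) :
    Matrix ((a : Fin (T + 1)) × Fin (b a)) ((a : Fin (T + 1)) × Fin (b a)) R :=
  fun p => extend (p.1 + 1) (D p.1 p.2)

variable {T : ℕ} {b : ℕ → ℕ} (D : ∀ l, Matrix (Fin (b l)) (Fin (b (l + 1))) R)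

lemma totalMatrix_apply {a : ℕ} (ha : a + 1 < T + 1) (i : Fin (b a)) (j : Fin (b (a + 1))) :
    totalMatrix T D ⟨⟨a, by omega⟩, i⟩ ⟨⟨a + 1, ha⟩, j⟩ = D a i j :=
  extend_apply _ _ _

lemma totalMatrix_of_ne (p q : (a : Fin (T + 1)) × Fin (b a))
    (h : (q.1 : ℕ) ≠ p.1 + 1) : totalMatrix T D p q = 0 := extend_of_ne _ _ h

lemma totalMatrix_mulVec {a : ℕ} (ha : a + 1 < T + 1) (i : Fin (b a)) (w) :
    (totalMatrix T D *ᵥ w) ⟨⟨a, by omega⟩, i⟩ = (D a *ᵥ fun j => w ⟨⟨a + 1, ha⟩, j⟩) i := by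
  rw [mulVec, dotProduct, sum_eq ha]
  · simp only [totalMatrix_apply]
    rfl
  · intro p hp
    rw [totalMatrix_of_ne _ _ _ hp, zero_mul]

lemma totalMatrix_mulVec_last (p : (a : Fin (T + 1)) × Fin (b a)) (hp : (p.1 : ℕ) = T) (w) :
    (totalMatrix T D *ᵥ w) p = 0 := by
  rw [mulVec, dotProduct]
  refine Finset.sum_eq_zero fun q _ => ?_
  rw [totalMatrix_of_ne _ _ _ (by have := q.1.2; omega), zero_mul]

lemma totalMatrix_mulVec_extend {a : ℕ} (ha : a + 1 < T + 1) (w : Fin (b (a + 1)) → R) :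
    (totalMatrix T D *ᵥ extend (a + 1) w) = extend a (D a *ᵥ w) := by
  ext ⟨⟨c, hc⟩, i⟩
  obtain rfl | hne := eq_or_ne c a
  · rw [totalMatrix_mulVec D ha, extend_apply]
    simp only [extend_apply]
  · rw [extend_of_ne _ _ hne, mulVec, dotProduct]
    refine Finset.sum_eq_zero fun q _ => ?_
    by_cases hq : (q.1 : ℕ) = c + 1
    · rw [extend_of_ne _ _ (by omega), mul_zero]
    · rw [totalMatrix_of_ne _ _ _ hq, zero_mul]

lemma totalMatrix_mul_self (hD : ∀ l, D l * D (l + 1) = 0) :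
    totalMatrix T D * totalMatrix T D = 0 := by
  refine Matrix.ext_of_mulVec_single fun q => ?_
  rw [zero_mulVec, ← mulVec_mulVec]
  ext ⟨⟨c, hc⟩, i⟩
  by_cases h1 : c + 1 < T + 1
  · rw [totalMatrix_mulVec D h1]
    by_cases h2 : c + 1 + 1 < T + 1
    · simp only [totalMatrix_mulVec D h2]
      change (D c *ᵥ (D (c + 1) *ᵥ _)) i = 0
      rw [mulVec_mulVec, hD, zero_mulVec]
      rfl
    · have : (fun j => (totalMatrix T D *ᵥ Pi.single q 1) ⟨⟨c + 1, h1⟩, j⟩) = 0 :=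
        funext fun j => totalMatrix_mulVec_last D _ (by simp; omega) _
      rw [this, mulVec_zero]
      rfl
  · exact totalMatrix_mulVec_last D _ (by simp; omega) _

theorem IsMinimalResolution.isTruncatedResolution [IsLocalRing R] (hT : 1 ≤ T) {C : Type}
    [AddCommGroup C] [Module R C] (hC : IsSemidualizing R C) {π : (Fin (b 0) → R) →ₗ[R] C}
    (h : IsMinimalResolution b D π) :
    IsTruncatedResolution (fun p : (a : Fin (T + 1)) × Fin (b a) => (p.1 : ℕ)) T
      (totalMatrix T D) (π ∘ₗ LinearMap.funLeft R R (fun i => ⟨⟨0, by omega⟩, i⟩)) where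
  apply_eq_zero p q := totalMatrix_of_ne D p q
  mul_self := totalMatrix_mul_self D fun l => by
    refine Matrix.ext_of_mulVec_single fun q => ?_
    rw [zero_mulVec, ← mulVec_mulVec]
    exact (h.exact l).apply_apply_eq_zero _
  surjective c := by
    obtain ⟨v, rfl⟩ := h.surjective c
    refine ⟨extend 0 v, extend_of_ne v, ?_⟩
    rw [LinearMap.comp_apply]
    congr 1
  map_congr v w hvw := congrArg π (funext fun i => hvw _ rfl)
  map_mulVec w := by
    rw [LinearMap.comp_apply]
    have : LinearMap.funLeft R R (fun i => ⟨⟨0, by omega⟩, i⟩) (totalMatrix T D *ᵥ w) =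
        D 0 *ᵥ fun j => w ⟨⟨0 + 1, by omega⟩, j⟩ :=
      funext fun i => totalMatrix_mulVec D (by omega) i w
    rw [this]
    exact h.exact_zero.apply_apply_eq_zero _
  exact_zero v hv hπ := by
    obtain ⟨w, hw⟩ := (h.exact_zero _).1 hπ
    refine ⟨extend (0 + 1) w, extend_of_ne w, ?_⟩
    rw [totalMatrix_mulVec_extend D (by omega), eq_extend (by omega) hv]
    exact congrArg _ hw
  exact a ha v hv hdv := by
    have h1 : D a *ᵥ (fun i => v ⟨⟨a + 1, by omega⟩, i⟩) = 0 := by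
      ext i
      rw [← totalMatrix_mulVec D (by omega), hdv]
      rfl
    obtain ⟨w, hw⟩ := (h.exact a _).1 h1
    refine ⟨extend (a + 1 + 1) w, extend_of_ne w, ?_⟩
    rw [totalMatrix_mulVec_extend D (by omega), eq_extend (by omega) hv]
    exact congrArg _ hw
  exists_ext l hl φ hφ hdφ := by
    obtain ⟨ψ, hψ⟩ := hC.exists_extension h (l := l)
      (Fintype.linearCombination R fun i => φ ⟨⟨l + 1, by omega⟩, i⟩) (by
        refine LinearMap.pi_ext' fun j => LinearMap.ext_ring ?_
        have := hdφ ⟨⟨l + 1 + 1, by omega⟩, j⟩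
        rw [sum_eq (a := l + 1) (by omega)] at this
        · simpa [Fintype.linearCombination_apply, totalMatrix_apply D] using this
        · intro p hp
          rw [hφ p hp, smul_zero])
    refine ⟨extend l fun i => ψ (Pi.single i 1), extend_of_ne _, ?_⟩
    rintro ⟨⟨c, hc⟩, j⟩ rfl
    have h1 := LinearMap.congr_fun hψ (Pi.single j 1)
    rw [Fintype.linearCombination_apply_single, one_smul] at h1
    rw [h1, sum_eq (a := l) (by omega)]
    · simp only [totalMatrix_apply D, extend_apply]
      rw [LinearMap.comp_apply, mulVecLin_apply, mulVec_single_one]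
      rw [LinearMap.pi_apply_eq_sum_univ ψ]
      refine Finset.sum_congr rfl fun i _ => congrArg _ (congrArg ψ (funext fun k => ?_))
      rw [Pi.single_apply]
      exact if_congr eq_comm rfl rfl
    · intro p hp
      rw [extend_of_ne _ _ hp, smul_zero]

end TruncatedResolution

section HomComplex

open Matrix

variable {R : Type*} [CommRing R] {ε : Type*} [Fintype ε] [DecidableEq ε] (δ : ε → ℕ)

/-- The component of degree `l` of a matrix with graded rows and columns. -/
def degreeProj (R : Type*) [CommRing R] (l : ℕ) : Matrix ε ε R →ₗ[R] Matrix ε ε R where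
  toFun g := Matrix.of fun p q => if δ q = δ p + l then g p q else 0
  map_add' g h := by
    ext p q
    simp only [Matrix.add_apply, Matrix.of_apply]
    split_ifs <;> simp
  map_smul' c g := by
    ext p q
    simp only [Matrix.smul_apply, RingHom.id_apply, Matrix.of_apply]
    split_ifs <;> simp

/-- The grading involution. -/
def signMatrix (R : Type*) [CommRing R] : Matrix ε ε R := diagonal fun p => (-1) ^ δ p

/-- The differential of the Hom complex between complexes with differentials `d` and `d'`. -/
def homD (d' d : Matrix ε ε R) : Matrix ε ε R →ₗ[R] Matrix ε ε R where
  toFun g := d' * g - signMatrix δ R * g * signMatrix δ R * d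
  map_add' g h := by noncomm_ring
  map_smul' c g := by simp [smul_sub]

lemma degreeProj_apply (l : ℕ) (g : Matrix ε ε R) (p q : ε) :
    degreeProj δ R l g p q = if δ q = δ p + l then g p q else 0 := rfl

lemma homD_apply (d' d g : Matrix ε ε R) :
    homD δ d' d g = d' * g - signMatrix δ R * g * signMatrix δ R * d := rfl

lemma degreeProj_degreeProj (l : ℕ) (g : Matrix ε ε R) :
    degreeProj δ R l (degreeProj δ R l g) = degreeProj δ R l g := by
  ext p q
  simp only [degreeProj_apply]
  split_ifs <;> rfl

lemma degreeProj_eq_iff {l : ℕ} {g : Matrix ε ε R} :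
    degreeProj δ R l g = g ↔ ∀ p q, δ q ≠ δ p + l → g p q = 0 := by
  refine ⟨fun h p q hpq => ?_, fun h => ?_⟩
  · rw [← h, degreeProj_apply, if_neg hpq]
  · ext p q
    rw [degreeProj_apply]
    split_ifs with hpq
    · rfl
    · rw [h p q hpq]

variable {δ}

lemma signMatrix_mul_self : signMatrix δ R * signMatrix δ R = 1 := by
  rw [signMatrix, diagonal_mul_diagonal, ← diagonal_one]
  congr 1
  ext p
  rw [← mul_pow]
  simp

lemma signMatrix_mul_mul (g : Matrix ε ε R) (p q : ε) :
    (signMatrix δ R * g * signMatrix δ R) p q = (-1) ^ (δ p + δ q) * g p q := by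
  rw [signMatrix, mul_diagonal, diagonal_mul, pow_add]
  ring

lemma signMatrix_conj {l : ℕ} {g : Matrix ε ε R} (hg : ∀ p q, δ q ≠ δ p + l → g p q = 0) :
    signMatrix δ R * g * signMatrix δ R = (-1 : R) ^ l • g := by
  ext p q
  rw [signMatrix_mul_mul, Matrix.smul_apply, smul_eq_mul]
  by_cases h : δ q = δ p + l
  · rw [h, ← add_assoc, pow_add, ← two_mul, pow_mul]
    simp
  · rw [hg p q h, mul_zero, mul_zero]

lemma homD_eq {l : ℕ} (d' d : Matrix ε ε R) {g : Matrix ε ε R}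
    (hg : ∀ p q, δ q ≠ δ p + l → g p q = 0) :
    homD δ d' d g = d' * g - (-1 : R) ^ l • (g * d) := by
  rw [homD_apply, signMatrix_conj hg, smul_mul_assoc]

lemma homD_homD {d' d : Matrix ε ε R} (hd : ∀ p q, δ q ≠ δ p + 1 → d p q = 0)
    (hd' : ∀ p q, δ q ≠ δ p + 1 → d' p q = 0) (hdd : d * d = 0) (hdd' : d' * d' = 0)
    (g : Matrix ε ε R) : homD δ d' d (homD δ d' d g) = 0 := by
  have h1 : signMatrix δ R * d' = - (d' * signMatrix δ R) := by
    have := signMatrix_conj hd'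
    rw [pow_one, neg_one_smul] at this
    rw [← neg_mul, ← this, mul_assoc, mul_assoc, signMatrix_mul_self, mul_one]
  have h2 : signMatrix δ R * d = - (d * signMatrix δ R) := by
    have := signMatrix_conj hd
    rw [pow_one, neg_one_smul] at this
    rw [← neg_mul, ← this, mul_assoc, mul_assoc, signMatrix_mul_self, mul_one]
  rw [homD_apply, homD_apply, mul_sub, ← mul_assoc d' d', hdd', zero_mul, zero_sub, mul_sub,
    sub_mul, sub_mul, ← mul_assoc (signMatrix δ R) d', h1]
  have h3 : signMatrix δ R * (signMatrix δ R * g * signMatrix δ R * d) * signMatrix δ R * d = 0 := by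
    have : signMatrix δ R * (signMatrix δ R * g * signMatrix δ R * d) * signMatrix δ R * d =
      (signMatrix δ R * signMatrix δ R) * g * (signMatrix δ R * d) * signMatrix δ R * d := by
      simp only [mul_assoc]
    rw [this, h2]
    have : ∀ u : Matrix ε ε R, u * -(d * signMatrix δ R) * signMatrix δ R * d =
      - (u * (d * (signMatrix δ R * signMatrix δ R) * d)) := fun u => by noncomm_ring
    rw [this, signMatrix_mul_self, mul_one, hdd, mul_zero, neg_zero]
  rw [h3]
  noncomm_ring

lemma homD_degreeProj {d' d : Matrix ε ε R} (hd : ∀ p q, δ q ≠ δ p + 1 → d p q = 0)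
    (hd' : ∀ p q, δ q ≠ δ p + 1 → d' p q = 0) (l : ℕ) (g : Matrix ε ε R) :
    homD δ d' d (degreeProj δ R l g) = degreeProj δ R (l + 1) (homD δ d' d g) := by
  ext p q
  rw [degreeProj_apply, homD_apply, homD_apply, Matrix.sub_apply, Matrix.sub_apply,
    mul_apply, mul_apply, mul_apply, mul_apply]
  simp only [signMatrix_mul_mul, degreeProj_apply]
  split_ifs with h
  · congr 1
    · refine Finset.sum_congr rfl fun k _ => ?_
      by_cases hk : δ k = δ p + 1
      · rw [if_pos (by omega)]
      · rw [hd' p k hk, zero_mul, zero_mul]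
    · refine Finset.sum_congr rfl fun k _ => ?_
      by_cases hk : δ q = δ k + 1
      · rw [if_pos (by omega)]
      · rw [hd k q hk, mul_zero, mul_zero]
  · rw [Finset.sum_eq_zero, Finset.sum_eq_zero, sub_zero]
    · intro k _
      by_cases hk : δ q = δ k + 1
      · rw [if_neg (by omega), mul_zero, zero_mul]
      · rw [hd k q hk, mul_zero]
    · intro k _
      by_cases hk : δ k = δ p + 1
      · rw [if_neg (by omega), mul_zero]
      · rw [hd' p k hk, zero_mul]

end HomComplex

section HomCycles

open Matrix

variable {R : Type*} [CommRing R] {ε : Type*} [Fintype ε] [DecidableEq ε] {δ : ε → ℕ} {T : ℕ}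
  {C C' : Type*} [AddCommGroup C] [Module R C] [AddCommGroup C'] [Module R C']
  {d d' : Matrix ε ε R} {π : (ε → R) →ₗ[R] C} {π' : (ε → R) →ₗ[R] C'}

omit [DecidableEq ε] in
lemma mul_apply_eq_mulVec (A B : Matrix ε ε R) (p q : ε) :
    (A * B) p q = (A *ᵥ fun k => B k q) p := rfl

namespace IsTruncatedResolution

lemma exists_row_zero (h : IsTruncatedResolution δ T d π) {l : ℕ} (hl : l + 2 ≤ T)
    {g : Matrix ε ε R} (hg : ∀ p q, δ q ≠ δ p + (l + 1) → g p q = 0) (hDg : homD δ d d g = 0) :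
    ∃ u, (∀ p q, δ q ≠ δ p + l → u p q = 0) ∧ ∀ p q, δ p ≤ 0 → (g - homD δ d d u) p q = 0 := by
  classical
  rw [homD_eq d d hg, sub_eq_zero] at hDg
  obtain ⟨ψ, hψ, hψφ⟩ := h.exists_ext l hl
    (fun q => if δ q = l + 1 then π (fun p => g p q) else 0)
    (fun q hq => if_neg hq) (fun q' => by
      by_cases hq' : δ q' = l + 2
      · have h1 : ∀ q, d q q' • (if δ q = l + 1 then π (fun p => g p q) else 0) =
            π (d q q' • fun p => g p q) := by
          intro q
          split_ifs with hq
          · rw [map_smul]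
          · rw [h.apply_eq_zero q q' (by omega), zero_smul, zero_smul, map_zero]
        rw [Finset.sum_congr rfl fun q _ => h1 q, ← map_sum]
        have h2 : (∑ q, d q q' • fun p => g p q) =
            (-1 : R) ^ (l + 1) • (d *ᵥ fun k => g k q') := by
          ext p
          rw [Pi.smul_apply, ← mul_apply_eq_mulVec, hDg, Matrix.smul_apply, smul_smul, ← pow_add,
            Even.neg_one_pow ⟨l + 1, rfl⟩, one_smul, mul_apply, Finset.sum_apply]
          exact Finset.sum_congr rfl fun q _ => mul_comm _ _
        rw [h2, map_smul, h.map_mulVec, smul_zero]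
      · refine Finset.sum_eq_zero fun q _ => ?_
        split_ifs with hq
        · rw [h.apply_eq_zero q q' (by omega), zero_smul]
        · rw [smul_zero])
  choose v hv hvψ using fun p => h.surjective (ψ p)
  let h0 : Matrix ε ε R := Matrix.of fun p' p => if δ p = l then v p p' else 0
  have hh0 : ∀ p q, δ q ≠ δ p + l → h0 p q = 0 := by
    intro p q hpq
    change (if δ q = l then v q p else 0) = 0
    split_ifs with hq
    · exact hv q p (by omega)
    · rfl
  have h1 : ∀ q, ∃ w, (∀ p, δ p ≠ 1 → w p = 0) ∧
      (δ q = l + 1 → d *ᵥ w = fun p => (g - h0 * d) p q) := by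
    intro q
    by_cases hq : δ q = l + 1
    · obtain ⟨w, hw, hw'⟩ := h.exact_zero (fun p => (g - h0 * d) p q) (fun p hp => by
        rw [Matrix.sub_apply, hg p q (by omega), mul_apply, Finset.sum_eq_zero, sub_zero]
        intro k _
        by_cases hk : δ q = δ k + 1
        · rw [hh0 p k (by omega), zero_mul]
        · rw [h.apply_eq_zero k q hk, mul_zero]) (by
        have h2 : (fun p => (g - h0 * d) p q) = (fun p => g p q) - ∑ k, d k q • fun p => h0 p k := by
          ext p
          rw [Matrix.sub_apply, Pi.sub_apply, mul_apply, Finset.sum_apply]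
          congr 1
          exact Finset.sum_congr rfl fun k _ => mul_comm _ _
        have h3 := hψφ q hq
        rw [if_pos hq] at h3
        rw [h2, map_sub, h3, map_sum, sub_eq_zero]
        refine Finset.sum_congr rfl fun k _ => ?_
        by_cases hk : δ k = l
        · rw [map_smul, ← hvψ k]
          congr 2
          exact funext fun p => (if_pos hk).symm
        · rw [hψ k hk, h.apply_eq_zero k q (by omega), zero_smul, zero_smul, map_zero])
      exact ⟨w, hw, fun _ => hw'⟩
    · exact ⟨0, fun _ _ => rfl, fun h => absurd h hq⟩
  choose w hw hw' using h1
  let w' : Matrix ε ε R := Matrix.of fun p q => if δ q = l + 1 then w q p else 0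
  have hw'0 : ∀ p q, (δ p ≠ 1 ∨ δ q ≠ l + 1) → w' p q = 0 := by
    intro p q hpq
    change (if δ q = l + 1 then w q p else 0) = 0
    split_ifs with hq
    · exact hw q p (by tauto)
    · rfl
  have hu : ∀ p q, δ q ≠ δ p + l → (w' - (-1 : R) ^ l • h0) p q = 0 := by
    intro p q hpq
    rw [Matrix.sub_apply, Matrix.smul_apply, hh0 p q hpq, hw'0 p q (by omega), smul_zero, sub_zero]
  refine ⟨w' - (-1 : R) ^ l • h0, hu, fun p q hp => ?_⟩
  rw [homD_eq d d hu]
  by_cases hq : δ q = l + 1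
  · have e1 : (d * w') p q = (g - h0 * d) p q := by
      rw [mul_apply_eq_mulVec]
      have : (fun k => w' k q) = w q := funext fun k => if_pos hq
      rw [this, hw' q hq]
    have e2 : (d * h0) p q = 0 := by
      refine Finset.sum_eq_zero fun k _ => ?_
      change d p k * (if δ q = l then _ else 0) = 0
      rw [if_neg (by omega), mul_zero]
    have e3 : (w' * d) p q = 0 := by
      rw [mul_apply]
      refine Finset.sum_eq_zero fun k _ => ?_
      rw [hw'0 p k (by omega), zero_mul]
    simp only [mul_sub, sub_mul, Matrix.sub_apply, Matrix.smul_apply, smul_sub, Matrix.mul_smul,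
      Matrix.smul_mul, smul_smul, e1, e2, e3, ← pow_add, Even.neg_one_pow ⟨l, rfl⟩, one_smul,
      smul_zero]
    ring
  · have e1 : g p q = 0 := hg p q (by omega)
    have e2 := homD_degreeProj (δ := δ) h.apply_eq_zero h.apply_eq_zero l (w' - (-1 : R) ^ l • h0)
    rw [(degreeProj_eq_iff δ).2 hu] at e2
    rw [← homD_eq d d hu, Matrix.sub_apply, e1, e2, degreeProj_apply, if_neg (by omega), sub_zero]

lemma exists_row_succ (h : IsTruncatedResolution δ T d π) (hδ : ∀ p, δ p ≤ T) {l : ℕ}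
    {g : Matrix ε ε R} (hg : ∀ p q, δ q ≠ δ p + (l + 1) → g p q = 0) (hDg : homD δ d d g = 0)
    {a : ℕ} (hga : ∀ p q, δ p ≤ a → g p q = 0) :
    ∃ u, (∀ p q, δ q ≠ δ p + l → u p q = 0) ∧ ∀ p q, δ p ≤ a + 1 → (g - homD δ d d u) p q = 0 := by
  classical
  rw [homD_eq d d hg, sub_eq_zero] at hDg
  have h1 : ∀ q, ∃ w, (∀ p, δ p ≠ a + 2 → w p = 0) ∧
      (δ q = a + l + 2 → d *ᵥ w = fun p => g p q) := by
    intro q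
    by_cases hq : δ q = a + l + 2
    · obtain ⟨w, hw, hw'⟩ := h.exact a (by have := hδ q; omega) (fun p => g p q)
        (fun p hp => hg p q (by omega)) (by
          ext p
          rw [← mul_apply_eq_mulVec]
          change (d * g) p q = 0
          by_cases hp : δ p ≤ a
          · rw [hDg, Matrix.smul_apply, mul_apply, Finset.sum_eq_zero, smul_zero]
            intro k _
            rw [hga p k hp, zero_mul]
          · rw [mul_apply]
            refine Finset.sum_eq_zero fun k _ => ?_
            by_cases hk : δ k = δ p + 1
            · rw [hg k q (by omega), mul_zero]
            · rw [h.apply_eq_zero p k hk, zero_mul])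
      exact ⟨w, hw, fun _ => hw'⟩
    · exact ⟨0, fun _ _ => rfl, fun h => absurd h hq⟩
  choose w hw hw' using h1
  let u : Matrix ε ε R := Matrix.of fun p q => if δ q = a + l + 2 then w q p else 0
  have hu0 : ∀ p q, (δ p ≠ a + 2 ∨ δ q ≠ a + l + 2) → u p q = 0 := by
    intro p q hpq
    change (if δ q = a + l + 2 then w q p else 0) = 0
    split_ifs with hq
    · exact hw q p (by tauto)
    · rfl
  have hu : ∀ p q, δ q ≠ δ p + l → u p q = 0 := fun p q hpq => hu0 p q (by omega)
  refine ⟨u, hu, fun p q hp => ?_⟩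
  have e3 : (u * d) p q = 0 := by
    rw [mul_apply]
    refine Finset.sum_eq_zero fun k _ => ?_
    rw [hu0 p k (by omega), zero_mul]
  rw [homD_eq d d hu, Matrix.sub_apply, Matrix.sub_apply, Matrix.smul_apply, e3, smul_zero, sub_zero]
  by_cases hq : δ q = a + l + 2
  · rw [mul_apply_eq_mulVec]
    have : (fun k => u k q) = w q := funext fun k => if_pos hq
    rw [this, hw' q hq, sub_self]
  · have e1 : g p q = 0 := by
      by_cases hp' : δ p ≤ a
      · exact hga p q hp'
      · exact hg p q (by omega)
    rw [e1, mul_apply, Finset.sum_eq_zero, sub_zero]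
    intro k _
    rw [hu0 k q (by omega), mul_zero]

theorem exists_homD_eq (h : IsTruncatedResolution δ T d π) (hδ : ∀ p, δ p ≤ T) {l : ℕ}
    (hl : l + 2 ≤ T) {g : Matrix ε ε R} (hg : degreeProj δ R (l + 1) g = g)
    (hDg : homD δ d d g = 0) : ∃ u, degreeProj δ R l u = u ∧ homD δ d d u = g := by
  simp only [degreeProj_eq_iff] at hg ⊢
  have key : ∀ a, ∃ u, (∀ p q, δ q ≠ δ p + l → u p q = 0) ∧
      ∀ p q, δ p ≤ a → (g - homD δ d d u) p q = 0 := by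
    intro a
    induction a with
    | zero => exact h.exists_row_zero hl hg hDg
    | succ a ih =>
      obtain ⟨u, hu, hua⟩ := ih
      have hgu : ∀ p q, δ q ≠ δ p + (l + 1) → (g - homD δ d d u) p q = 0 := by
        rw [← degreeProj_eq_iff, map_sub, (degreeProj_eq_iff δ).2 hg,
          ← homD_degreeProj h.apply_eq_zero h.apply_eq_zero, (degreeProj_eq_iff δ).2 hu]
      obtain ⟨u', hu', hua'⟩ := h.exists_row_succ hδ hgu
        (by rw [map_sub, hDg, homD_homD h.apply_eq_zero h.apply_eq_zero h.mul_self h.mul_self,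
          sub_zero]) hua
      refine ⟨u + u', fun p q hpq => ?_, fun p q hp => ?_⟩
      · rw [Matrix.add_apply, hu p q hpq, hu' p q hpq, add_zero]
      · rw [map_add, ← sub_sub]
        exact hua' p q hp
  obtain ⟨u, hu, hua⟩ := key T
  refine ⟨u, hu, ?_⟩
  ext p q
  exact (sub_eq_zero.1 (hua p q (hδ p))).symm

theorem exists_surjective [IsLocalRing R] (h : IsTruncatedResolution δ T d π)
    (h' : IsTruncatedResolution δ T d' π') {b : ℕ} (e : Fin b ≃ {p // δ p = 0})
    {g : Matrix ε ε R} (hg : degreeProj δ R 0 g = g) (hDg : homD δ d' d g = 0)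
    (hdet : (Matrix.of fun i j => IsLocalRing.residue R (g (e i) (e j))).det ≠ 0) :
    ∃ f : C →ₗ[R] C', Function.Surjective f := by
  classical
  rw [degreeProj_eq_iff] at hg
  rw [homD_eq d' d hg, pow_zero, one_smul, sub_eq_zero] at hDg
  have hg0 : ∀ v w : ε → R, (∀ p, δ p = 0 → v p = w p) → ∀ p, δ p = 0 →
      (g *ᵥ v) p = (g *ᵥ w) p := by
    intro v w hvw p hp
    refine Finset.sum_congr rfl fun k _ => ?_
    by_cases hk : δ k = 0
    · rw [hvw k hk]
    · change g p k * _ = g p k * _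
      rw [hg p k (by omega), zero_mul, zero_mul]
  have hker : LinearMap.ker π ≤ LinearMap.ker (π' ∘ₗ g.mulVecLin) := by
    intro v hv
    have h1 : ∀ p, δ p = 0 → v p = (fun p => if δ p = 0 then v p else 0) p :=
      fun p hp => (if_pos hp).symm
    obtain ⟨w, -, hw⟩ := h.exact_zero (fun p => if δ p = 0 then v p else 0) (fun p hp => if_neg hp)
      (by rw [← h.map_congr _ _ h1]; exact hv)
    rw [LinearMap.mem_ker, LinearMap.comp_apply, mulVecLin_apply, h'.map_congr _ _ (hg0 _ _ h1), ← hw,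
      mulVec_mulVec, ← hDg, ← mulVec_mulVec, h'.map_mulVec]
  have hπ : Function.Surjective π := fun c => by
    obtain ⟨v, -, hv⟩ := h.surjective c
    exact ⟨v, hv⟩
  refine ⟨(LinearMap.ker π).liftQ _ hker ∘ₗ (π.quotKerEquivOfSurjective hπ).symm.toLinearMap, ?_⟩
  rw [LinearMap.coe_comp]
  refine Function.Surjective.comp ?_ (LinearEquiv.surjective _)
  intro c
  obtain ⟨v, hv, rfl⟩ := h'.surjective c
  let G : Matrix (Fin b) (Fin b) R := Matrix.of fun i j => g (e i) (e j)
  have hG : IsUnit G.det := by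
    rw [← IsLocalRing.residue_ne_zero_iff_isUnit, RingHom.map_det]
    exact hdet
  refine ⟨Submodule.Quotient.mk fun p => if hp : δ p = 0 then
    (G⁻¹ *ᵥ fun i => v (e i)) (e.symm ⟨p, hp⟩) else 0, ?_⟩
  change π' (g *ᵥ _) = _
  refine h'.map_congr _ _ fun p hp => ?_
  obtain ⟨i, hi⟩ := e.surjective ⟨p, hp⟩
  have hpi : p = e i := congrArg Subtype.val hi.symm
  have h2 : (g *ᵥ fun p => if hp : δ p = 0 then
      (G⁻¹ *ᵥ fun i => v (e i)) (e.symm ⟨p, hp⟩) else 0) (e i) =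
      (G *ᵥ (G⁻¹ *ᵥ fun i => v (e i))) i := by
    rw [mulVec, dotProduct, mulVec, dotProduct, ← Finset.sum_filter_of_ne (p := fun p => δ p = 0)]
    · rw [Finset.sum_subtype (p := fun p => δ p = 0) _ (fun p => by simp), ← e.sum_comp]
      refine Finset.sum_congr rfl fun j _ => ?_
      rw [dif_pos (e j).2]
      simp only [Subtype.coe_eta, Equiv.symm_apply_apply]
      rfl
    · intro p _ hp0
      by_contra hne
      exact hp0 (by rw [dif_neg hne, mul_zero])
  rw [hpi, h2, mulVec_mulVec, Matrix.mul_nonsing_inv _ hG, one_mulVec]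

end IsTruncatedResolution

end HomCycles

section ResidueLength

variable {B Λ : Type*} [CommRing B] [CommRing Λ] [IsLocalRing Λ] [Algebra B Λ]
  (hs : Function.Surjective ((IsLocalRing.residue Λ).comp (algebraMap B Λ)))

include hs in
lemma isSimpleModule_of_residue_surjective (M : Type*) [AddCommGroup M] [Module Λ M] [Module B M]
    [IsScalarTower B Λ M] [IsSimpleModule Λ M] : IsSimpleModule B M := by
  have : Nontrivial M := IsSimpleModule.nontrivial Λ M
  rw [isSimpleModule_iff_toSpanSingleton_surjective]
  refine ⟨this, fun x hx y => ?_⟩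
  obtain ⟨c, hc⟩ := IsSimpleModule.toSpanSingleton_surjective Λ hx y
  obtain ⟨b, hb⟩ := hs (IsLocalRing.residue Λ c)
  refine ⟨b, ?_⟩
  have hbc : algebraMap B Λ b - c ∈ IsLocalRing.maximalIdeal Λ := by
    rw [← IsLocalRing.residue_eq_zero_iff, map_sub, sub_eq_zero]
    exact hb
  have hann : IsLocalRing.maximalIdeal Λ ≤ Module.annihilator Λ M :=
    (IsLocalRing.eq_maximalIdeal (IsSimpleModule.annihilator_isMaximal (R := Λ) (M := M))).ge
  have h1 := Module.mem_annihilator.1 (hann hbc) x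
  rw [sub_smul, algebraMap_smul, sub_eq_zero] at h1
  rw [← hc]
  exact h1

include hs in
lemma length_eq_of_residue_surjective {M : Type*} [AddCommGroup M] [Module Λ M]
    (hM : IsFiniteLength Λ M) : ∀ [Module B M] [IsScalarTower B Λ M],
    Module.length B M = Module.length Λ M := by
  induction hM with
  | of_subsingleton =>
    intro _ _
    rw [Module.length_eq_zero, Module.length_eq_zero]
  | @of_simple_quotient M _ _ N _ _ ih =>
    intro _ _
    have := isSimpleModule_of_residue_surjective hs (M ⧸ N)
    rw [Module.length_eq_add_of_exact N.subtype N.mkQ N.subtype_injective N.mkQ_surjective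
        (LinearMap.exact_subtype_mkQ N),
      Module.length_eq_add_of_exact (N.subtype.restrictScalars B) (N.mkQ.restrictScalars B)
        N.subtype_injective N.mkQ_surjective (LinearMap.exact_subtype_mkQ N), ih,
      Module.length_eq_one B (M ⧸ N), Module.length_eq_one Λ (M ⧸ N)]

end ResidueLength

section TorsionModule

lemma isFiniteLength_of_finite {Λ : Type*} [CommRing Λ] [IsNoetherianRing Λ] [IsLocalRing Λ]
    {t : ℕ} (ht : IsLocalRing.maximalIdeal Λ ^ t = ⊥) (M : Type*) [AddCommGroup M] [Module Λ M]
    [Module.Finite Λ M] : IsFiniteLength Λ M := by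
  have : IsArtinianRing Λ := (isArtinianRing_iff_isNilpotent_maximalIdeal Λ).2 ⟨t, ht⟩
  exact isFiniteLength_iff_isNoetherian_isArtinian.2 ⟨inferInstance, inferInstance⟩

lemma exists_module_quotient {R : Type*} [CommRing R] (I : Ideal R) (M : Type*) [AddCommGroup M]
    [Module R M] [Module.Finite R M] (hM : ∀ r ∈ I, ∀ x : M, r • x = 0) :
    ∃ _ : Module (R ⧸ I) M, Module.Finite (R ⧸ I) M ∧
      ∀ (r : R) (x : M), Ideal.Quotient.mk I r • x = r • x := by
  have h : Module.IsTorsionBySet R M I := fun x r => hM r r.2 x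
  let := h.module
  have : IsScalarTower R (R ⧸ I) M := h.isScalarTower
  exact ⟨h.module, Module.Finite.of_restrictScalars_finite R _ _, fun r x => rfl⟩

end TorsionModule

section Transfer

variable {R Λ B : Type*} [CommRing R] [CommRing Λ] [CommRing B] [Algebra R Λ] [Algebra B Λ]
  {G H : Type*} [AddCommGroup G] [Module R G] [Module Λ G] [Module B G] [IsScalarTower R Λ G]
  [IsScalarTower B Λ G] [AddCommGroup H] [Module R H] [Module Λ H] [Module B H]
  [IsScalarTower R Λ H] [IsScalarTower B Λ H]

lemma LinearMap.map_smul_of_surjective_algebraMap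
    (hR : Function.Surjective (algebraMap R Λ)) (f : G →ₗ[R] H) (b : B) (x : G) :
    f (b • x) = b • f x := by
  obtain ⟨r, hr⟩ := hR (algebraMap B Λ b)
  rw [← algebraMap_smul Λ b x, ← algebraMap_smul Λ b (f x), ← hr, algebraMap_smul, algebraMap_smul,
    map_smul]

/-- A linear map over a ring `R` is linear over any ring acting through a quotient of `R`. -/
def LinearMap.transfer (B : Type*) [CommRing B] [Algebra B Λ] [Module B G] [IsScalarTower B Λ G]
    [Module B H] [IsScalarTower B Λ H] (hR : Function.Surjective (algebraMap R Λ))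
    (f : G →ₗ[R] H) : G →ₗ[B] H where
  toFun := f
  map_add' := f.map_add
  map_smul' := f.map_smul_of_surjective_algebraMap hR

variable {κ ν : Type*} [Fintype κ] [Fintype ν]

/-- The `B`-linear family of maps obtained from an `R`-linear family by expanding the parameters
with respect to a finite family `w`. -/
noncomputable def transferFamily (B : Type*) [CommRing B] [Algebra B Λ] [Module B G]
    [IsScalarTower B Λ G] [Module B H] [IsScalarTower B Λ H] [DecidableEq κ]
    (hR : Function.Surjective (algebraMap R Λ))
    (w : ν → R) (L : (κ → R) →ₗ[R] G →ₗ[R] H) : (κ × ν → B) →ₗ[B] G →ₗ[B] H :=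
  ∑ p : κ × ν, (LinearMap.proj p : (κ × ν → B) →ₗ[B] B).smulRight
    (LinearMap.transfer B hR (L (Pi.single p.1 (w p.2))))

lemma transferFamily_apply [DecidableEq κ] (hR : Function.Surjective (algebraMap R Λ)) (w : ν → R)
    (L : (κ → R) →ₗ[R] G →ₗ[R] H) {γ : R → ν → B}
    (hγ : ∀ r, algebraMap R Λ r = ∑ v, algebraMap B Λ (γ r v) * algebraMap R Λ (w v))
    (d : κ → R) (x : G) :
    transferFamily B hR w L (fun p => γ (d p.1) p.2) x = L d x := by
  have key : ∀ k, ∑ v, γ (d k) v • w v • L (Pi.single k 1) x = d k • L (Pi.single k 1) x := by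
    intro k
    rw [← algebraMap_smul Λ (d k), hγ, Finset.sum_smul]
    refine Finset.sum_congr rfl fun v _ => ?_
    rw [mul_smul, algebraMap_smul, algebraMap_smul]
  have h1 : ∀ k (r : R), L (Pi.single k r) x = r • L (Pi.single k 1) x := fun k r => by
    rw [← LinearMap.smul_apply, ← map_smul, ← Pi.single_smul, smul_eq_mul, mul_one]
  have h2 : L d x = ∑ k, d k • L (Pi.single k 1) x := by
    conv_lhs => rw [← Finset.univ_sum_single d]
    rw [map_sum, LinearMap.sum_apply]
    exact Finset.sum_congr rfl fun k _ => h1 _ _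
  rw [h2, transferFamily, LinearMap.sum_apply, LinearMap.sum_apply, Fintype.sum_prod_type]
  refine Finset.sum_congr rfl fun k _ => ?_
  rw [← key]
  refine Finset.sum_congr rfl fun v _ => ?_
  rw [← h1]
  rfl

lemma transfer_add_transferFamily [DecidableEq κ] (hR : Function.Surjective (algebraMap R Λ))
    (w : ν → R) {γ : R → ν → B}
    (hγ : ∀ r, algebraMap R Λ r = ∑ v, algebraMap B Λ (γ r v) * algebraMap R Λ (w v))
    {d₀ : κ → R} {D : (κ → R) → G →ₗ[R] H} {L : (κ → R) →ₗ[R] G →ₗ[R] H}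
    (hD : ∀ d, D d = D d₀ + L (d - d₀)) (d : κ → R) (x : G) :
    (LinearMap.transfer B hR (D d₀) + transferFamily B hR w L
      ((fun p => γ (d p.1) p.2) - fun p => γ (d₀ p.1) p.2)) x = D d x := by
  rw [hD d, map_sub, LinearMap.add_apply, LinearMap.sub_apply, transferFamily_apply hR w L hγ,
    transferFamily_apply hR w L hγ, LinearMap.add_apply, map_sub, LinearMap.sub_apply]
  rfl

end Transfer

section TransferOpen

open MvPolynomial

variable {R Λ B : Type*} [CommRing R] [CommRing Λ] [CommRing B] [Algebra R Λ] [Algebra B Λ]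
  {G₀ G₁ G₂ : Type*} [AddCommGroup G₀] [Module R G₀] [Module Λ G₀] [Module B G₀]
  [IsScalarTower R Λ G₀] [IsScalarTower B Λ G₀] [Module.Finite B G₀]
  [AddCommGroup G₁] [Module R G₁] [Module Λ G₁] [Module B G₁]
  [IsScalarTower R Λ G₁] [IsScalarTower B Λ G₁] [Module.Finite B G₁]
  [AddCommGroup G₂] [Module R G₂] [Module Λ G₂] [Module B G₂]
  [IsScalarTower R Λ G₂] [IsScalarTower B Λ G₂] [Module.Finite B G₂]
  {κ ν : Type*} [Fintype κ] [Fintype ν]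

theorem exists_open_condition_of_surjective_algebraMap {π : B} {t : ℕ} (hB : IsChainRing B π t)
    {K : Type*} [Field K] (τ : Λ →+* K)
    (hτ : Function.Surjective (τ.comp (algebraMap B Λ)))
    (hR : Function.Surjective (algebraMap R Λ)) (w : ν → R) {γ : R → ν → B}
    (hγ : ∀ r, algebraMap R Λ r = ∑ v, algebraMap B Λ (γ r v) * algebraMap R Λ (w v))
    (d₀ : κ → R)
    (D₀ : (κ → R) → G₀ →ₗ[R] G₁) (L₀ : (κ → R) →ₗ[R] G₀ →ₗ[R] G₁)
    (hD₀ : ∀ d, D₀ d = D₀ d₀ + L₀ (d - d₀))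
    (D₁ : (κ → R) → G₁ →ₗ[R] G₂) (L₁ : (κ → R) →ₗ[R] G₁ →ₗ[R] G₂)
    (hD₁ : ∀ d, D₁ d = D₁ d₀ + L₁ (d - d₀))
    (hexact : LinearMap.ker (D₁ d₀) = LinearMap.range (D₀ d₀))
    {b : ℕ} (ρ : G₀ → Matrix (Fin b) (Fin b) K)
    (hρadd : ∀ x y, ρ (x + y) = ρ x + ρ y)
    (hρsmul : ∀ (r : R) x, ρ (r • x) = τ (algebraMap R Λ r) • ρ x)
    (z₀ : G₀) (hz₀ : D₀ d₀ z₀ = 0) (hρz₀ : (ρ z₀).det ≠ 0) {l : ℕ}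
    (hl₁ : Module.length B G₁ ≤ l) (hl₂ : Module.length B G₂ ≤ l) (hlt : l ≤ t)
    (hblt : l * b ≤ t) :
    ∃ f : Fin 3 → MvPolynomial (κ × ν) B,
      (∀ k, eval (fun p => γ (d₀ p.1) p.2) (f k) ≠ 0) ∧
      ∀ d : κ → R, (∀ k, eval (fun p => γ (d p.1) p.2) (f k) ≠ 0) → D₁ d ∘ₗ D₀ d = 0 →
        LinearMap.ker (D₁ d) ≤ LinearMap.range (D₀ d) ∧ ∃ z, D₀ d z = 0 ∧ (ρ z).det ≠ 0 := by
  classical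
  let c : (κ → R) → κ × ν → B := fun d p => γ (d p.1) p.2
  obtain ⟨f, hf, hf'⟩ := MvPolynomial.exists_open_condition hB (τ.comp (algebraMap B Λ)) hτ (c d₀)
    (fun e => LinearMap.transfer B hR (D₀ d₀) + transferFamily B hR w L₀ (e - c d₀))
    (transferFamily B hR w L₀) (fun e => by rw [sub_self, map_zero, add_zero])
    (fun e => LinearMap.transfer B hR (D₁ d₀) + transferFamily B hR w L₁ (e - c d₀))
    (transferFamily B hR w L₁) (fun e => by rw [sub_self, map_zero, add_zero]) (by
      ext x
      rw [LinearMap.mem_ker, LinearMap.mem_range, transfer_add_transferFamily hR w hγ hD₁]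
      refine (SetLike.ext_iff.1 hexact x).trans (exists_congr fun y => ?_)
      rw [transfer_add_transferFamily hR w hγ hD₀]) ρ hρadd (fun a x => by
        obtain ⟨r, hr⟩ := hR (algebraMap B Λ a)
        rw [← algebraMap_smul Λ a x, ← hr, algebraMap_smul, hρsmul, hr]
        rfl) z₀ (by rw [transfer_add_transferFamily hR w hγ hD₀, hz₀]) hρz₀ hl₁ hl₂ hlt hblt
  refine ⟨f, hf, fun d hd hDD => ?_⟩
  obtain ⟨h1, z, hz, hz'⟩ := hf' (c d) hd (by
    ext x
    rw [LinearMap.comp_apply, transfer_add_transferFamily hR w hγ hD₁, transfer_add_transferFamily hR w hγ hD₀]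
    exact LinearMap.congr_fun hDD x)
  refine ⟨fun x hx => ?_, z, by rw [transfer_add_transferFamily hR w hγ hD₀] at hz; exact hz, hz'⟩
  obtain ⟨y, hy⟩ := h1 (x := x) (by
    rw [LinearMap.mem_ker, transfer_add_transferFamily hR w hγ hD₁]
    exact hx)
  rw [transfer_add_transferFamily hR w hγ hD₀] at hy
  exact ⟨y, hy⟩

end TransferOpen

section Parametrization

open MvPolynomial IsLocalRing

lemma isNoetherian_of_residue_surjective {B Λ : Type*} [CommRing B] [CommRing Λ] [IsLocalRing Λ]
    [Algebra B Λ] (hs : Function.Surjective ((residue Λ).comp (algebraMap B Λ))) {M : Type*}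
    [AddCommGroup M] [Module Λ M] (hM : IsFiniteLength Λ M) [Module B M] [IsScalarTower B Λ M] :
    IsNoetherian B M := by
  have h : Module.length B M ≠ ⊤ := by
    rw [length_eq_of_residue_surjective hs hM]
    exact Module.length_ne_top_iff.2 hM
  exact (isFiniteLength_iff_isNoetherian_isArtinian.1 (Module.length_ne_top_iff.1 h)).1

theorem exists_parametrization {R : Type} [CommRing R] [IsNoetherianRing R] [IsLocalRing R]
    {G₀ G₁ G₂ : Type*} [AddCommGroup G₀] [Module R G₀] [Module.Finite R G₀]
    [AddCommGroup G₁] [Module R G₁] [Module.Finite R G₁]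
    [AddCommGroup G₂] [Module R G₂] [Module.Finite R G₂] {N : ℕ}
    (h₀ : ∀ r ∈ maximalIdeal R ^ (N + 1), ∀ x : G₀, r • x = 0)
    (h₁ : ∀ r ∈ maximalIdeal R ^ (N + 1), ∀ x : G₁, r • x = 0)
    (h₂ : ∀ r ∈ maximalIdeal R ^ (N + 1), ∀ x : G₂, r • x = 0)
    (κ : Type) [Fintype κ] (b : ℕ) :
    ∃ (B : Type) (_ : CommRing B) (_ : IsNoetherianRing B) (σ : Type) (_ : Fintype σ)
      (c : (κ → R) → σ → B),
      ∀ (d₀ : κ → R)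
        (D₀ : (κ → R) → G₀ →ₗ[R] G₁) (L₀ : (κ → R) →ₗ[R] G₀ →ₗ[R] G₁)
        (_ : ∀ d, D₀ d = D₀ d₀ + L₀ (d - d₀))
        (D₁ : (κ → R) → G₁ →ₗ[R] G₂) (L₁ : (κ → R) →ₗ[R] G₁ →ₗ[R] G₂)
        (_ : ∀ d, D₁ d = D₁ d₀ + L₁ (d - d₀))
        (_ : LinearMap.ker (D₁ d₀) = LinearMap.range (D₀ d₀))
        (ρ : G₀ → Matrix (Fin b) (Fin b) (ResidueField R))
        (_ : ∀ x y, ρ (x + y) = ρ x + ρ y)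
        (_ : ∀ (r : R) x, ρ (r • x) = residue R r • ρ x)
        (z₀ : G₀) (_ : D₀ d₀ z₀ = 0) (_ : (ρ z₀).det ≠ 0),
      ∃ f : Fin 3 → MvPolynomial σ B, (∀ k, eval (c d₀) (f k) ≠ 0) ∧
        ∀ d : κ → R, (∀ k, eval (c d) (f k) ≠ 0) → D₁ d ∘ₗ D₀ d = 0 →
          LinearMap.ker (D₁ d) ≤ LinearMap.range (D₀ d) ∧ ∃ z, D₀ d z = 0 ∧ (ρ z).det ≠ 0 := by
  classical
  let I := maximalIdeal R ^ (N + 1)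
  have hI : I ≤ maximalIdeal R := Ideal.pow_le_self (by omega)
  have : Nontrivial (R ⧸ I) := Ideal.Quotient.nontrivial_iff.2
    (ne_top_of_le_ne_top (maximalIdeal.isMaximal R).ne_top hI)
  have hmk : Function.Surjective (algebraMap R (R ⧸ I)) := Ideal.Quotient.mk_surjective
  have : IsLocalRing (R ⧸ I) := IsLocalRing.of_surjective' _ hmk
  have hmax : maximalIdeal (R ⧸ I) = (maximalIdeal R).map (algebraMap R (R ⧸ I)) :=
    (map_maximalIdeal_of_surjective _ hmk).symm
  have hmaxN : maximalIdeal (R ⧸ I) ^ (N + 1) = ⊥ := by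
    rw [hmax, ← Ideal.map_pow]
    exact Ideal.map_quotient_self I
  obtain ⟨i₀, _, hs₀⟩ := exists_module_quotient I G₀ h₀
  obtain ⟨i₁, _, hs₁⟩ := exists_module_quotient I G₁ h₁
  obtain ⟨i₂, _, hs₂⟩ := exists_module_quotient I G₂ h₂
  have := (⟨fun r s x => by rw [Algebra.smul_def, mul_smul]; exact hs₀ r _⟩ :
    IsScalarTower R (R ⧸ I) G₀)
  have := (⟨fun r s x => by rw [Algebra.smul_def, mul_smul]; exact hs₁ r _⟩ :
    IsScalarTower R (R ⧸ I) G₁)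
  have := (⟨fun r s x => by rw [Algebra.smul_def, mul_smul]; exact hs₂ r _⟩ :
    IsScalarTower R (R ⧸ I) G₂)
  have f₀ := isFiniteLength_of_finite hmaxN G₀
  have f₁ := isFiniteLength_of_finite hmaxN G₁
  have f₂ := isFiniteLength_of_finite hmaxN G₂
  obtain ⟨l₁, hl₁⟩ := ENat.ne_top_iff_exists.1 (Module.length_ne_top_iff.2 f₁)
  obtain ⟨l₂, hl₂⟩ := ENat.ne_top_iff_exists.1 (Module.length_ne_top_iff.2 f₂)
  let l := max l₁ l₂
  let t := max N (max l (l * b))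
  obtain ⟨B, _, π, φ, hB, hφ⟩ := exists_chainRing (Λ := R ⧸ I) (t := t)
    (le_bot_iff.1 ((Ideal.pow_le_pow_right (Nat.succ_le_succ (le_max_left N _))).trans hmaxN.le))
  let _ : Algebra B (R ⧸ I) := φ.toAlgebra
  let _ : Module B G₀ := Module.compHom G₀ φ
  let _ : Module B G₁ := Module.compHom G₁ φ
  let _ : Module B G₂ := Module.compHom G₂ φ
  have : IsScalarTower B (R ⧸ I) G₀ := ⟨fun b s x => mul_smul (φ b) s x⟩
  have : IsScalarTower B (R ⧸ I) G₁ := ⟨fun b s x => mul_smul (φ b) s x⟩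
  have : IsScalarTower B (R ⧸ I) G₂ := ⟨fun b s x => mul_smul (φ b) s x⟩
  have := isNoetherian_of_residue_surjective hφ f₀
  have := isNoetherian_of_residue_surjective hφ f₁
  have := isNoetherian_of_residue_surjective hφ f₂
  have := isNoetherian_of_residue_surjective hφ (isFiniteLength_of_finite hmaxN (R ⧸ I))
  obtain ⟨ν, p, hp⟩ := Module.Finite.exists_fin' B (R ⧸ I)
  choose w hw using fun v => hmk (p (Pi.single v 1))
  choose γ hγ using fun r : R => hp (algebraMap R (R ⧸ I) r)
  let τ : R ⧸ I →+* ResidueField R :=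
    Ideal.Quotient.lift I (residue R) fun r hr => (residue_eq_zero_iff r).2 (hI hr)
  refine ⟨B, inferInstance, hB.isNoetherianRing, κ × Fin ν, inferInstance,
    fun d p => γ (d p.1) p.2, ?_⟩
  intro d₀ D₀ L₀ hD₀ D₁ L₁ hD₁ hexact ρ hρadd hρsmul z₀ hz₀ hρz₀
  refine exists_open_condition_of_surjective_algebraMap hB τ ?_ hmk w ?_ d₀ D₀ L₀ hD₀ D₁ L₁ hD₁
    hexact ρ hρadd hρsmul z₀ hz₀ hρz₀ (l := l) ?_ ?_ ?_ ?_
  · intro k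
    obtain ⟨r, rfl⟩ := residue_surjective k
    obtain ⟨a, ha⟩ := hφ (residue _ (algebraMap R (R ⧸ I) r))
    obtain ⟨s, hs⟩ := hmk (φ a)
    refine ⟨a, ?_⟩
    change τ (φ a) = _
    rw [← hs]
    change residue R s = _
    change residue _ (φ a) = _ at ha
    rw [← sub_eq_zero, ← map_sub, residue_eq_zero_iff]
    rw [← hs, ← sub_eq_zero, ← map_sub, ← map_sub, residue_eq_zero_iff] at ha
    exact fun hu => ha (hu.map _)
  · intro r
    rw [← hγ r]
    conv_lhs => rw [← Finset.univ_sum_single (γ r)]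
    rw [map_sum]
    refine Finset.sum_congr rfl fun v _ => ?_
    rw [hw, ← Algebra.smul_def, ← map_smul, ← Pi.single_smul, smul_eq_mul, mul_one]
  · rw [length_eq_of_residue_surjective hφ f₁, ← hl₁]
    exact_mod_cast le_max_left l₁ l₂
  · rw [length_eq_of_residue_surjective hφ f₂, ← hl₂]
    exact_mod_cast le_max_right l₁ l₂
  · exact (le_max_left l (l * b)).trans (le_max_right _ _)
  · exact (le_max_right l (l * b)).trans (le_max_right _ _)

end Parametrization

section KoszulQuotient

open KoszulIndex

variable {R : Type*} [CommRing R] {E : Type*} [AddCommGroup E] [Module R E]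

/-- A coefficient placed in degree zero of the Koszul complex. -/
def koszulEmb (e : E) : ∀ n, KoszulIndex n → E
  | 0 => fun _ => e
  | n + 1 => koszulPair (koszulEmb e n) 0

lemma koszulEmb_empty (e : E) (n : ℕ) : koszulEmb e n (empty n) = e := by
  induction n with
  | zero => rfl
  | succ n ih => exact ih

lemma koszulD_koszulEmb (x : ℕ → R) {D : E →ₗ[R] E} {e : E} (he : D e = 0) (n : ℕ) :
    koszulD x D n (koszulEmb e n) = 0 := by
  induction n with
  | zero => exact funext fun _ => he
  | succ n ih =>
    rw [koszulEmb, koszulD_pair, ih, map_zero, smul_zero, add_zero, neg_zero, koszulPair_zero]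

variable (pr : ℕ → E →ₗ[R] E) (J : Ideal R) (n N : ℕ)

/-- The filtration of the total degree `l` part of the Koszul complex. -/
def koszulFilTot (l : ℕ) : Submodule R (KoszulIndex n → E) :=
  (koszulFil E J n N).comap (koszulTot pr n l)

lemma smul_mem_koszulFilTot (l : ℕ) {r : R} (hr : r ∈ J ^ N) (f : KoszulIndex n → E) :
    r • f ∈ koszulFilTot pr J n N l := by
  refine koszulTot_mem_koszulFil pr l fun s => ?_
  exact Submodule.smul_mem_smul (Ideal.pow_le_pow_right (Nat.sub_le _ _) hr) trivial

variable {pr J n N}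

lemma koszulFilTot_le_comap {A : (KoszulIndex n → E) →ₗ[R] (KoszulIndex n → E)} {l : ℕ}
    (hA : ∀ f, A (koszulTot pr n l f) = koszulTot pr n (l + 1) (A f))
    (hA' : ∀ f ∈ koszulFil E J n N, A f ∈ koszulFil E J n N) :
    koszulFilTot pr J n N l ≤ (koszulFilTot pr J n N (l + 1)).comap A := by
  intro f hf
  change koszulTot pr n (l + 1) (A f) ∈ koszulFil E J n N
  rw [← hA]
  exact hA' _ hf

lemma ker_mapQ_le_range_iff (hpr : ∀ l e, pr l (pr l e) = pr l e)
    {A : (KoszulIndex n → E) →ₗ[R] (KoszulIndex n → E)}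
    (hA : ∀ l f, A (koszulTot pr n l f) = koszulTot pr n (l + 1) (A f))
    (h₀ : koszulFilTot pr J n N 0 ≤ (koszulFilTot pr J n N 1).comap A)
    (h₁ : koszulFilTot pr J n N 1 ≤ (koszulFilTot pr J n N 2).comap A) :
    LinearMap.ker (Submodule.mapQ _ _ A h₁) ≤ LinearMap.range (Submodule.mapQ _ _ A h₀) ↔
      ∀ f, koszulTot pr n 1 f = f → A f ∈ koszulFil E J n N →
        ∃ g, koszulTot pr n 0 g = g ∧ f - A g ∈ koszulFil E J n N := by
  constructor
  · intro h f hf hAf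
    have hmem : (koszulFilTot pr J n N 1).mkQ f ∈ LinearMap.ker (Submodule.mapQ _ _ A h₁) := by
      rw [LinearMap.mem_ker, Submodule.mkQ_apply, Submodule.mapQ_apply,
        Submodule.Quotient.mk_eq_zero]
      exact koszulTot_mem_koszulFil pr 2 hAf
    obtain ⟨g, hg⟩ := h hmem
    obtain ⟨g, rfl⟩ := Submodule.mkQ_surjective _ g
    rw [Submodule.mkQ_apply, Submodule.mapQ_apply, Submodule.mkQ_apply, eq_comm,
      Submodule.Quotient.eq] at hg
    refine ⟨koszulTot pr n 0 g, koszulTot_koszulTot hpr n 0 g, ?_⟩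
    have hg' : koszulTot pr n 1 (f - A g) ∈ koszulFil E J n N := hg
    rwa [map_sub, hf, ← hA 0] at hg'
  · intro h f hf
    obtain ⟨f, rfl⟩ := Submodule.mkQ_surjective _ f
    rw [LinearMap.mem_ker, Submodule.mkQ_apply, Submodule.mapQ_apply,
      Submodule.Quotient.mk_eq_zero] at hf
    have hf' : koszulTot pr n 2 (A f) ∈ koszulFil E J n N := hf
    obtain ⟨g, hg, hg'⟩ := h (koszulTot pr n 1 f) (koszulTot_koszulTot hpr n 1 f) (by rwa [hA 1])
    refine ⟨(koszulFilTot pr J n N 0).mkQ g, ?_⟩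
    rw [Submodule.mkQ_apply, Submodule.mapQ_apply, Submodule.mkQ_apply, eq_comm,
      Submodule.Quotient.eq]
    change koszulTot pr n 1 (f - A g) ∈ koszulFil E J n N
    rwa [map_sub, ← hA 0, hg]

/-- Left multiplications on the coefficients, with the signs of the Koszul complex. -/
def koszulMul (A : E →ₗ[R] E) (n : ℕ) : (KoszulIndex n → E) →ₗ[R] (KoszulIndex n → E) :=
  LinearMap.pi fun s => (-1 : R) ^ deg s • (A ∘ₗ LinearMap.proj s)

lemma koszulMul_apply (A : E →ₗ[R] E) (f : KoszulIndex n → E) (s : KoszulIndex n) :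
    koszulMul A n f s = (-1 : R) ^ deg s • A (f s) := rfl

lemma koszulD_add (x : ℕ → R) (D A : E →ₗ[R] E) :
    koszulD x (D + A) n = koszulD x D n + koszulMul A n := by
  ext f s
  rw [LinearMap.add_apply, Pi.add_apply, koszulD_eq_add, koszulD_eq_add x D, koszulMul_apply,
    LinearMap.add_apply, smul_add, add_assoc]

lemma koszulMul_koszulTot {A : E →ₗ[R] E} (hA : ∀ l e, A (pr l e) = pr (l + 1) (A e)) (l : ℕ)
    (f : KoszulIndex n → E) :
    koszulMul A n (koszulTot pr n l f) = koszulTot pr n (l + 1) (koszulMul A n f) := by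
  ext s
  rw [koszulMul_apply, koszulTot_apply, koszulTot_apply, koszulMul_apply, map_smul, hA,
    add_right_comm]

lemma koszulMul_mem_koszulFil (A : E →ₗ[R] E) {f : KoszulIndex n → E}
    (hf : f ∈ koszulFil E J n N) : koszulMul A n f ∈ koszulFil E J n N :=
  fun s => Submodule.smul_mem _ _ (map_mem_smul_top A (hf s))

end KoszulQuotient

section GenericSurjection

open KoszulIndex IsLocalRing MvPolynomial

variable {R : Type*} [CommRing R] {ε : Type*} [Fintype ε] [DecidableEq ε] (δ : ε → ℕ)

/-- The degree one matrix with the given entries. -/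
def degreeOneMatrix (R : Type*) [CommRing R] : (ε × ε → R) →ₗ[R] Matrix ε ε R where
  toFun d := degreeProj δ R 1 (Matrix.of fun p q => d (p, q))
  map_add' d d' := by rw [← map_add]; rfl
  map_smul' c d := by rw [← map_smul]; rfl

omit [Fintype ε] [DecidableEq ε] in
lemma degreeOneMatrix_eq_zero (d : ε × ε → R) (p q : ε) (h : δ q ≠ δ p + 1) :
    degreeOneMatrix δ R d p q = 0 := if_neg h

lemma degreeOneMatrix_uncurry {d : Matrix ε ε R} (hd : ∀ p q, δ q ≠ δ p + 1 → d p q = 0) :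
    degreeOneMatrix δ R (fun p => d p.1 p.2) = d := (degreeProj_eq_iff δ).2 hd

lemma homD_add (d' a d : Matrix ε ε R) :
    homD δ (d' + a) d = homD δ d' d + LinearMap.mulLeft R a := by
  ext1 g
  rw [LinearMap.add_apply, homD_apply, homD_apply, LinearMap.mulLeft_apply, add_mul]
  abel

lemma mulLeft_degreeProj {a : Matrix ε ε R} (ha : ∀ p q, δ q ≠ δ p + 1 → a p q = 0) (l : ℕ)
    (g : Matrix ε ε R) :
    LinearMap.mulLeft R a (degreeProj δ R l g) = degreeProj δ R (l + 1) (LinearMap.mulLeft R a g) := by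
  have h := homD_degreeProj (δ := δ) (d := 0) (fun _ _ _ => rfl) ha l g
  rw [homD_apply, homD_apply, mul_zero, mul_zero, sub_zero, sub_zero] at h
  exact h

lemma koszulMul_le_comap {J : Ideal R} {n N : ℕ} {a : Matrix ε ε R}
    (ha : ∀ p q, δ q ≠ δ p + 1 → a p q = 0) (l : ℕ) :
    koszulFilTot (degreeProj δ R) J n N l ≤
      (koszulFilTot (degreeProj δ R) J n N (l + 1)).comap (koszulMul (LinearMap.mulLeft R a) n) :=
  koszulFilTot_le_comap (koszulMul_koszulTot (mulLeft_degreeProj δ ha) l)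
    fun _ hf => koszulMul_mem_koszulFil _ hf

lemma koszulD_homD_le_comap {x : ℕ → R} {J : Ideal R} {n N : ℕ} (hx : ∀ l < n, x l ∈ J)
    {d' d : Matrix ε ε R} (hd' : ∀ p q, δ q ≠ δ p + 1 → d' p q = 0)
    (hd : ∀ p q, δ q ≠ δ p + 1 → d p q = 0) (l : ℕ) :
    koszulFilTot (degreeProj δ R) J n N l ≤
      (koszulFilTot (degreeProj δ R) J n N (l + 1)).comap (koszulD x (homD δ d' d) n) :=
  koszulFilTot_le_comap (koszulD_koszulTot x (homD_degreeProj hd hd') n l)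
    fun _ hf => koszulD_mem_koszulFil hx _ hf

/-- The linear family of maps induced by left multiplication with degree one matrices. -/
def koszulMulFamily (J : Ideal R) (n N l : ℕ) : (ε × ε → R) →ₗ[R]
    ((KoszulIndex n → Matrix ε ε R) ⧸ koszulFilTot (degreeProj δ R) J n N l) →ₗ[R]
    ((KoszulIndex n → Matrix ε ε R) ⧸ koszulFilTot (degreeProj δ R) J n N (l + 1)) where
  toFun d := Submodule.mapQ _ _ _ (koszulMul_le_comap δ (degreeOneMatrix_eq_zero δ d) l)
  map_add' d d' := Submodule.linearMap_qext _ <| LinearMap.ext fun f =>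
    congrArg (koszulFilTot (degreeProj δ R) J n N (l + 1)).mkQ (show _ =
      koszulMul (LinearMap.mulLeft R (degreeOneMatrix δ R d)) n f +
        koszulMul (LinearMap.mulLeft R (degreeOneMatrix δ R d')) n f by
      ext1 s
      rw [Pi.add_apply, koszulMul_apply, koszulMul_apply, koszulMul_apply, ← smul_add]
      simp only [LinearMap.mulLeft_apply, map_add, add_mul])
  map_smul' c d := Submodule.linearMap_qext _ <| LinearMap.ext fun f =>
    congrArg (koszulFilTot (degreeProj δ R) J n N (l + 1)).mkQ (show _ =
      c • koszulMul (LinearMap.mulLeft R (degreeOneMatrix δ R d)) n f by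
      ext1 s
      rw [Pi.smul_apply, koszulMul_apply, koszulMul_apply, smul_comm c]
      simp only [LinearMap.mulLeft_apply, map_smul, smul_mul_assoc])

lemma mapQ_koszulD_eq_add {x : ℕ → R} {J : Ideal R} {n N : ℕ} (hx : ∀ l < n, x l ∈ J)
    (d₀ d : ε × ε → R) {e : Matrix ε ε R} (he : ∀ p q, δ q ≠ δ p + 1 → e p q = 0) (l : ℕ) :
    Submodule.mapQ _ _ _ (koszulD_homD_le_comap δ (N := N) hx (degreeOneMatrix_eq_zero δ d) he l) =
      Submodule.mapQ _ _ _ (koszulD_homD_le_comap δ hx (degreeOneMatrix_eq_zero δ d₀) he l) +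
        koszulMulFamily δ J n N l (d - d₀) := by
  refine Submodule.linearMap_qext _ <| LinearMap.ext fun f =>
    congrArg (koszulFilTot (degreeProj δ R) J n N (l + 1)).mkQ (show _ =
      koszulD x (homD δ (degreeOneMatrix δ R d₀) e) n f +
        koszulMul (LinearMap.mulLeft R (degreeOneMatrix δ R (d - d₀))) n f from ?_)
  rw [← LinearMap.add_apply, ← koszulD_add, ← homD_add, ← map_add, add_sub_cancel]

/-- The residue matrix of the degree zero part of a Koszul cochain. -/
noncomputable def residueMatrix {R : Type*} [CommRing R] [IsLocalRing R] {b : ℕ}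
    (e : Fin b → ε) (n N : ℕ) :
    ((KoszulIndex n → Matrix ε ε R) ⧸ koszulFilTot (degreeProj δ R) (maximalIdeal R) n (N + 1) 0)
      →ₗ[R] Matrix (Fin b) (Fin b) (ResidueField R) :=
  Submodule.liftQ _
    { toFun f := Matrix.of fun i j =>
        residue R (koszulTot (degreeProj δ R) n 0 f (empty n) (e i) (e j))
      map_add' f g := by
        ext i j
        simp
      map_smul' c f := by
        ext i j
        rw [map_smul, Matrix.of_apply]
        simp only [Pi.smul_apply, Matrix.smul_apply, smul_eq_mul, map_mul, RingHom.id_apply,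
          Matrix.of_apply]
        rfl }
    (by
      intro f hf
      ext i j
      have h1 : koszulTot (degreeProj δ R) n 0 f (empty n) ∈
          ((maximalIdeal R) ^ (N + 1 - deg (empty n)) • ⊤ : Submodule R (Matrix ε ε R)) :=
        hf (empty n)
      have h2 := map_mem_smul_top (Matrix.entryLinearMap R R (e i) (e j)) h1
      rw [deg_empty, tsub_zero, smul_eq_mul, Ideal.mul_top] at h2
      exact (residue_eq_zero_iff _).2 (Ideal.pow_le_self (by omega) h2))

omit [Fintype ε] [DecidableEq ε] in
lemma residueMatrix_mk {R : Type*} [CommRing R] [IsLocalRing R] {b : ℕ}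
    (e : Fin b → ε) (n N : ℕ) (f : KoszulIndex n → Matrix ε ε R) (i j : Fin b) :
    residueMatrix δ e n N (Submodule.Quotient.mk f) i j =
      residue R (koszulTot (degreeProj δ R) n 0 f (empty n) (e i) (e j)) := rfl

end GenericSurjection

section GenericSurjection

open KoszulIndex IsLocalRing MvPolynomial

theorem IsTruncatedResolution.exists_generic_surjection {R : Type} [CommRing R]
    [IsNoetherianRing R] [IsLocalRing R] {ε : Type} [Fintype ε] [DecidableEq ε] {δ : ε → ℕ}
    {x : ℕ → R} {n : ℕ} (hJ : maximalIdeal R = Ideal.span (x '' Set.Iio n))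
    (hδ : ∀ p, δ p ≤ n + 2) {b : ℕ} (e : Fin b ≃ {p // δ p = 0}) :
    ∃ (B : Type) (_ : CommRing B) (_ : IsNoetherianRing B) (σ : Type) (_ : Fintype σ)
      (c : Matrix ε ε R → σ → B),
      ∀ (C : Type) [AddCommGroup C] [Module R C] (d : Matrix ε ε R) (π : (ε → R) →ₗ[R] C),
        IsTruncatedResolution δ (n + 2) d π →
        ∃ f : Fin 3 → MvPolynomial σ B, (∀ k, eval (c d) (f k) ≠ 0) ∧
          ∀ (C' : Type) [AddCommGroup C'] [Module R C'] (d' : Matrix ε ε R)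
            (π' : (ε → R) →ₗ[R] C'), IsTruncatedResolution δ (n + 2) d' π' →
            (∀ k, eval (c d') (f k) ≠ 0) → ∃ φ : C →ₗ[R] C', Function.Surjective φ := by
  have hx : ∀ l < n, x l ∈ maximalIdeal R := fun l hl => by
    rw [hJ]
    exact Ideal.subset_span ⟨l, hl, rfl⟩
  obtain ⟨N, hN⟩ := exists_koszul_approximation hx hJ (degreeProj_degreeProj δ (R := R))
  have hkill : ∀ l, ∀ r ∈ maximalIdeal R ^ (N + 1), ∀ y : (KoszulIndex n → Matrix ε ε R) ⧸
      koszulFilTot (degreeProj δ R) (maximalIdeal R) n (N + 1) l, r • y = 0 := by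
    intro l r hr y
    obtain ⟨f, rfl⟩ := Submodule.mkQ_surjective _ y
    rw [Submodule.mkQ_apply, ← Submodule.Quotient.mk_smul, Submodule.Quotient.mk_eq_zero]
    exact smul_mem_koszulFilTot _ _ n _ l hr f
  obtain ⟨B, iB, hB, σ, iσ, c, hc⟩ := exists_parametrization (hkill 0) (hkill 1) (hkill 2) (ε × ε) b
  refine ⟨B, iB, hB, σ, iσ, fun d => c fun p => d p.1 p.2, fun C _ _ d π h => ?_⟩
  have hd := h.apply_eq_zero
  let D (l : ℕ) (a : ε × ε → R) := Submodule.mapQ _ _ _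
    (koszulD_homD_le_comap δ (N := N + 1) hx (degreeOneMatrix_eq_zero δ a) hd l)
  have hA {d' : Matrix ε ε R} (hd' : ∀ p q, δ q ≠ δ p + 1 → d' p q = 0) :=
    koszulD_koszulTot x (homD_degreeProj hd hd') n
  have hzero {d' : Matrix ε ε R} (hd' : ∀ p q, δ q ≠ δ p + 1 → d' p q = 0) (hdd : d' * d' = 0) :
      D 1 (fun p => d' p.1 p.2) ∘ₗ D 0 (fun p => d' p.1 p.2) = 0 := by
    refine Submodule.linearMap_qext _ (LinearMap.ext fun f => ?_)
    change Submodule.Quotient.mk (koszulD x _ n (koszulD x _ n f)) = 0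
    rw [degreeOneMatrix_uncurry δ hd', koszulD_koszulD x (homD_homD hd hd' h.mul_self hdd),
      Submodule.Quotient.mk_zero]
  have hiff {d' : Matrix ε ε R} (hd' : ∀ p q, δ q ≠ δ p + 1 → d' p q = 0) :
      LinearMap.ker (D 1 (fun p => d' p.1 p.2)) ≤ LinearMap.range (D 0 (fun p => d' p.1 p.2)) ↔
      ∀ f, koszulTot (degreeProj δ R) n 1 f = f → koszulD x (homD δ d' d) n f ∈
        koszulFil (Matrix ε ε R) (maximalIdeal R) n (N + 1) →
        ∃ g, koszulTot (degreeProj δ R) n 0 g = g ∧ f - koszulD x (homD δ d' d) n g ∈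
          koszulFil (Matrix ε ε R) (maximalIdeal R) n (N + 1) := by
    refine (ker_mapQ_le_range_iff (degreeProj_degreeProj δ (R := R))
      (hA (degreeOneMatrix_eq_zero δ (fun p : ε × ε => d' p.1 p.2))) _ _).trans ?_
    rw [degreeOneMatrix_uncurry δ hd']
  have hHG := (hN (homD δ d d) (homD_homD hd hd h.mul_self h.mul_self) (homD_degreeProj hd hd)).1
    fun l hl g hg hDg => h.exists_homD_eq hδ (by omega) hg hDg
  obtain ⟨f, hf, hf'⟩ := hc (fun p => d p.1 p.2) (D 0) (koszulMulFamily δ _ n _ 0)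
    (fun a => mapQ_koszulD_eq_add δ hx _ a hd 0) (D 1) (koszulMulFamily δ _ n _ 1)
    (fun a => mapQ_koszulD_eq_add δ hx _ a hd 1)
    (le_antisymm ((hiff hd).2 hHG) (LinearMap.range_le_ker_iff.2 (hzero hd h.mul_self)))
    (residueMatrix δ (fun i => (e i : ε)) n N) (map_add _) (map_smul _)
    (Submodule.Quotient.mk (koszulEmb 1 n))
    (by
      change Submodule.Quotient.mk (koszulD x _ n (koszulEmb 1 n)) = 0
      rw [degreeOneMatrix_uncurry δ hd, koszulD_koszulEmb, Submodule.Quotient.mk_zero]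
      rw [homD_eq (l := 0) d d fun p q hpq => Matrix.one_apply_ne (by rintro rfl; exact hpq rfl)]
      simp)
    (by
      have : residueMatrix δ (fun i => (e i : ε)) n N
          (Submodule.Quotient.mk (koszulEmb (1 : Matrix ε ε R) n)) = 1 := by
        ext i j
        rw [residueMatrix_mk, koszulTot_apply, koszulEmb_empty, deg_empty, degreeProj_apply,
          if_pos (by rw [(e i).2, (e j).2]), Matrix.one_apply, Matrix.one_apply]
        simp only [Subtype.coe_inj, e.injective.eq_iff]
        split_ifs <;> simp
      rw [this, Matrix.det_one]
      exact one_ne_zero)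
  refine ⟨f, hf, fun C' _ _ d' π' h' hfd' => ?_⟩
  have hd' := h'.apply_eq_zero
  obtain ⟨h1, z, hz, hdet⟩ := hf' _ hfd' (hzero hd' h'.mul_self)
  obtain ⟨z, rfl⟩ := Submodule.mkQ_surjective _ z
  obtain ⟨g, hg, hDg, hgz⟩ := (hN (homD δ d' d) (homD_homD hd hd' h.mul_self h'.mul_self)
    (homD_degreeProj hd hd')).2 ((hiff hd').1 h1) (koszulTot (degreeProj δ R) n 0 z)
    (koszulTot_koszulTot (degreeProj_degreeProj δ) n 0 z) (by
      have hz' := (Submodule.Quotient.mk_eq_zero _).1 hz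
      rw [degreeOneMatrix_uncurry δ hd'] at hz'
      rw [hA hd']
      exact hz')
  refine h.exists_surjective h' e hg hDg ?_
  convert hdet using 2
  ext i j
  rw [Submodule.mkQ_apply, residueMatrix_mk, Matrix.of_apply, ← sub_eq_zero, ← map_sub,
    residue_eq_zero_iff]
  have h2 := map_mem_smul_top (Matrix.entryLinearMap R R (e i : ε) (e j : ε)) hgz
  rwa [smul_eq_mul, Ideal.mul_top] at h2

end GenericSurjection

section Finiteness

open IsLocalRing MvPolynomial

lemma exists_bijective_of_surjective {R : Type*} [CommRing R] {M : ℕ → Type*}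
    [∀ k, AddCommGroup (M k)] [∀ k, Module R (M k)] [IsNoetherian R (M 0)]
    (φ : ∀ k, M k →ₗ[R] M (k + 1)) (hφ : ∀ k, Function.Surjective (φ k)) :
    ∃ k, Function.Bijective (φ k) := by
  let F : ∀ k, M 0 →ₗ[R] M k := fun k =>
    Nat.rec (motive := fun k => M 0 →ₗ[R] M k) LinearMap.id (fun k f => φ k ∘ₗ f) k
  have hF : ∀ k, Function.Surjective (F k) := by
    intro k
    induction k with
    | zero => exact Function.surjective_id
    | succ k ih => exact (hφ k).comp ih
  obtain ⟨k, hk⟩ := monotone_stabilizes_iff_noetherian.2 (inferInstance : IsNoetherian R (M 0))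
    ⟨fun k => LinearMap.ker (F k), monotone_nat_of_le_succ fun k => LinearMap.ker_le_ker_comp _ _⟩
  refine ⟨k, (injective_iff_map_eq_zero (φ k)).2 fun y hy => ?_, hφ k⟩
  obtain ⟨z, rfl⟩ := hF k y
  have h : LinearMap.ker (F k) = LinearMap.ker (F (k + 1)) := hk (k + 1) k.le_succ
  exact h.ge hy

theorem IsSemidualizing.finite_quotient (R : Type) [CommRing R] [IsNoetherianRing R]
    [IsLocalRing R] (s : Setoid {C : ModuleCat.{0} R // IsSemidualizing R C})
    (hs : ∀ C D, s.r C D ↔ Nonempty (C.1 ≃ₗ[R] D.1)) : Finite (Quotient s) := by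
  by_contra hinf
  rw [not_finite_iff_infinite] at hinf
  obtain ⟨n, g, hg⟩ := Submodule.fg_iff_exists_fin_generating_family.1
    (IsNoetherian.noetherian (maximalIdeal R))
  let x : ℕ → R := fun l => if h : l < n then g ⟨l, h⟩ else 0
  have hx : maximalIdeal R = Ideal.span (x '' Set.Iio n) := by
    rw [← hg]
    congr 1
    ext y
    constructor
    · rintro ⟨i, rfl⟩
      exact ⟨i, i.2, dif_pos i.2⟩
    · rintro ⟨l, hl, rfl⟩
      exact ⟨⟨l, hl⟩, Eq.symm (dif_pos (c := l < n) hl)⟩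
  choose N hN using exists_betti_bound (R := R)
  let δ (β : Fin (n + 2 + 1) → ℕ) (p : (a : Fin (n + 2 + 1)) × Fin (β a)) : ℕ := p.1
  have key : ∀ q : Quotient s, ∃ β : Set.Iic (fun a : Fin (n + 2 + 1) => N a), ∃ d π,
      IsTruncatedResolution (R := R) (C := q.out.1) (δ β) (n + 2) d π := by
    intro q
    have := q.out.2.1
    obtain ⟨b, d, π, h⟩ := exists_isMinimalResolution (R := R) q.out.1
    exact ⟨⟨fun a => b a, fun a => hN a _ q.out.2 b d π h⟩, _, _,
      h.isTruncatedResolution (T := n + 2) d (by omega) q.out.2⟩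
  choose β hβ using key
  have : Finite (Set.Iic (fun a : Fin (n + 2 + 1) => N a)) := (Set.finite_Iic _).to_subtype
  obtain ⟨β₀, hβ₀⟩ := Finite.exists_infinite_fiber β
  have hres : ∀ q : β ⁻¹' {β₀}, ∃ d π,
      IsTruncatedResolution (R := R) (C := q.1.out.1) (δ β₀) (n + 2) d π := by
    rintro ⟨q, rfl⟩
    exact hβ q
  choose d π h using hres
  let e : Fin ((β₀ : Fin (n + 2 + 1) → ℕ) 0) ≃ {p // δ β₀ p = 0} :=
    { toFun i := ⟨⟨0, i⟩, rfl⟩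
      invFun p := Fin.cast (congrArg _ (Fin.ext p.2)) p.1.2
      left_inv i := rfl
      right_inv := by
        rintro ⟨⟨⟨a, ha⟩, i⟩, hp⟩
        obtain rfl : a = 0 := hp
        rfl }
  obtain ⟨B, _, _, σ, _, c, hc⟩ := IsTruncatedResolution.exists_generic_surjection hx
    (fun p => Nat.lt_succ_iff.1 p.1.2) e
  choose f hf hf' using fun q => hc _ (d q) (π q) (h q)
  obtain ⟨Z, -, hZ, hZf⟩ := exists_infinite_mutually_generic Set.univ Set.infinite_univ
    (fun q => c (d q)) f hf
  obtain ⟨u, -, hu⟩ := exists_seq_of_forall_finset_exists (· ∈ Z)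
    (fun q q' => q ≠ q' ∧ ∃ φ : q.1.out.1 →ₗ[R] q'.1.out.1, Function.Surjective φ) (by
      intro t ht
      obtain ⟨y, hy, hyt⟩ := (hZ.sdiff ((t.finite_toSet).union
        (t.finite_toSet.biUnion fun q hq => hZf q (ht q hq)))).nonempty
      rw [Set.mem_union, not_or, Set.mem_iUnion₂] at hyt
      refine ⟨y, hy, fun q hq => ⟨fun hqy => hyt.1 (hqy ▸ hq), hf' q _ (d y) (π y) (h y) ?_⟩⟩
      intro k hk
      exact hyt.2 ⟨q, hq, hy, k, hk⟩)
  choose φ hφ using fun k => (hu k (k + 1) k.lt_succ_self).2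
  have := (u 0).1.out.2.1
  obtain ⟨k, hk⟩ := exists_bijective_of_surjective (M := fun k => (u k).1.out.1) φ hφ
  refine (hu k (k + 1) k.lt_succ_self).1 (Subtype.ext ?_)
  rw [← Quotient.out_eq (u k).1, ← Quotient.out_eq (u (k + 1)).1]
  exact Quotient.sound ((hs _ _).2 ⟨LinearEquiv.ofBijective _ hk⟩)

end Finiteness

/-- A commutative noetherian local ring has only finitely many semidualizing modules
up to isomorphism: there is a finite set of modules containing a representative of
every isomorphism class of semidualizing modules. -/
theorem finitely_many_semidualizing_modules
    (R : Type) [CommRing R] [IsNoetherianRing R] [IsLocalRing R] :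
    ∃ T : Set (ModuleCat R), T.Finite ∧
      ∀ C : ModuleCat R, IsSemidualizing R C → ∃ D ∈ T, Nonempty (C ≃ₗ[R] D) := by
  let s : Setoid {C : ModuleCat.{0} R // IsSemidualizing R C} :=
    { r C D := Nonempty (C.1 ≃ₗ[R] D.1)
      iseqv := ⟨fun C => ⟨LinearEquiv.refl R _⟩, fun ⟨f⟩ => ⟨f.symm⟩,
        fun ⟨f⟩ ⟨g⟩ => ⟨f.trans g⟩⟩ }
  have := IsSemidualizing.finite_quotient R s fun _ _ => Iff.rfl
  refine ⟨Set.range fun q : Quotient s => ModuleCat.of R (ULift q.out.1), Set.finite_range _, fun C hC => ?_⟩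
  obtain ⟨f⟩ : s.r (Quotient.mk s ⟨C, hC⟩).out ⟨C, hC⟩ := Quotient.mk_out _
  exact ⟨_, ⟨Quotient.mk s ⟨C, hC⟩, rfl⟩, ⟨f.symm.trans ULift.moduleEquiv.symm⟩⟩
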